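/- Let C > 0 and ℓ ≥ 3 be fixed and let p : ℕ → (0,1] be any function. Let (G_n) be a sequence of graphs with |G_n| = n satisfying: (i) sup_n s_p(T,G_n) < ∞ for every finite tree T; (ii) there is a constant D such that Σ_u Σ_{v≠u} p_{ℓ−1}(u,v)² ≤ D·n^{2ℓ−2}·p(n)^{2ℓ−2} for all n; and (iii) for every k ≥ 1 there is a constant D_k such that Σ_u Σ_{v≠u} p_ℓ(u,v)^k ≤ D_k·n^{2+k(ℓ−1)}·p(n)^{kℓ} for all n. Suppose also that δ_□(G_n,κ) → 0 for some kernel κ : [0,1]² → [0,C]. Then s_p(F,G_n) → s(F,κ) as n → ∞ for each F ∈ F_ℓ. -/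

import Mathlib

open MeasureTheory Set Filter
open scoped ENNReal Classical

noncomputable section

/-- The (0-based) index of the subinterval `((i)/n, (i+1)/n]` of `[0,1]` containing `x`. -/
def idx (n : ℕ) (x : ℝ) : ℕ := ⌈x * n⌉₊ - 1

/-- The subset of `[0,1]` corresponding to a set of vertices of a graph on `Fin n`:
the union of the intervals `(i/n, (i+1)/n]` for `i ∈ X` (vertices `0`-indexed). -/
def vtxSet (n : ℕ) (X : Finset (Fin n)) : Set ℝ :=
  ⋃ i ∈ X, Ioc ((i : ℝ) / n) (((i : ℝ) + 1) / n)

/-- The kernel associated to a graph `G` on `{1,…,n}` and normalizing constant `p`: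
it takes the value `1/p` on `((i−1)/n, i/n] × ((j−1)/n, j/n]` whenever `ij ∈ E(G)`,
and `0` elsewhere. -/
def graphKernel {n : ℕ} (p : ℝ) (G : SimpleGraph (Fin n)) : ℝ → ℝ → ℝ := fun x y =>
  if h : x ∈ Ioc (0:ℝ) 1 ∧ y ∈ Ioc (0:ℝ) 1 ∧ idx n x < n ∧ idx n y < n then
    (if G.Adj ⟨idx n x, h.2.2.1⟩ ⟨idx n y, h.2.2.2⟩ then 1 / p else 0)
  else 0

/-- The cut norm of `W : [0,1]² → ℝ`. -/
def cutNorm (W : ℝ → ℝ → ℝ) : ℝ :=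
  sSup {r | ∃ S T : Set ℝ, MeasurableSet S ∧ MeasurableSet T ∧
    S ⊆ Icc 0 1 ∧ T ⊆ Icc 0 1 ∧ r = |∫ q in S ×ˢ T, W q.1 q.2|}

/-- `τ` is a Lebesgue-measure-preserving bijection of `[0,1]`. -/
def MPBij (τ : ℝ → ℝ) : Prop :=
  MeasurePreserving τ (volume.restrict (Icc 0 1)) (volume.restrict (Icc 0 1)) ∧
    BijOn τ (Icc 0 1) (Icc 0 1)

/-- The cut distance between two kernels. -/
def cutDist (κ₁ κ₂ : ℝ → ℝ → ℝ) : ℝ :=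
  sInf {r | ∃ τ : ℝ → ℝ, MPBij τ ∧ r = cutNorm (fun x y => κ₁ x y - κ₂ (τ x) (τ y))}

/-- The number of homomorphisms from `F` to `G`. -/
def homCount {α β : Type*} (F : SimpleGraph α) (G : SimpleGraph β) : ℕ :=
  Nat.card (F →g G)

/-- The number of injective homomorphisms (embeddings) from `F` to `G`. -/
def embCount {α β : Type*} (F : SimpleGraph α) (G : SimpleGraph β) : ℕ :=
  Nat.card {φ : F →g G // Function.Injective φ}

/-- The number of edges of a graph. -/
def edgeCount {α : Type*} (F : SimpleGraph α) : ℕ := Nat.card F.edgeSet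

/-- The normalized homomorphism count `t_p(F,G)`. -/
def tDen {α β : Type*} [Fintype α] [Fintype β] (p : ℝ) (F : SimpleGraph α)
    (G : SimpleGraph β) : ℝ :=
  homCount F G / (p ^ edgeCount F * (Fintype.card β : ℝ) ^ Fintype.card α)

/-- The normalized embedding count `s_p(F,G)`. -/
def sDen {α β : Type*} [Fintype α] [Fintype β] (p : ℝ) (F : SimpleGraph α)
    (G : SimpleGraph β) : ℝ :=
  embCount F G / (p ^ edgeCount F * ((Fintype.card β).descFactorial (Fintype.card α) : ℝ))

/-- The homomorphism density `s(F,κ)` of a finite graph in a kernel. -/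
def homDensity {α : Type*} [Fintype α] (F : SimpleGraph α) (κ : ℝ → ℝ → ℝ) : ℝ :=
  ∫ x in Set.univ.pi (fun _ : α => Icc (0:ℝ) 1),
    ∏ e ∈ F.edgeFinset,
      Sym2.lift ⟨fun i j => (κ (x i) (x j) + κ (x j) (x i)) / 2,
        fun i j => by dsimp only; rw [add_comm (κ (x i) (x j)) (κ (x j) (x i))]⟩ e

/-- The homomorphism density as a lower integral (for possibly unbounded kernels). -/
def homDensityL {α : Type*} [Fintype α] (F : SimpleGraph α) (κ : ℝ → ℝ → ℝ) : ℝ≥0∞ :=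
  ∫⁻ x in Set.univ.pi (fun _ : α => Icc (0:ℝ) 1),
    ∏ e ∈ F.edgeFinset,
      Sym2.lift ⟨fun i j => ENNReal.ofReal ((κ (x i) (x j) + κ (x j) (x i)) / 2),
        fun i j => by dsimp only; rw [add_comm (κ (x i) (x j)) (κ (x j) (x i))]⟩ e

/-- A kernel: a symmetric measurable function `[0,1]² → [0,∞)`. -/
def IsKernel (κ : ℝ → ℝ → ℝ) : Prop :=
  Measurable (Function.uncurry κ) ∧ (∀ x y, κ x y = κ y x) ∧ ∀ x y, 0 ≤ κ x y

/-- A kernel taking values in `[0,C]`. -/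
def IsKernelBdd (κ : ℝ → ℝ → ℝ) (C : ℝ) : Prop :=
  Measurable (Function.uncurry κ) ∧ (∀ x y, κ x y = κ y x) ∧ ∀ x y, κ x y ∈ Icc 0 C

/-- A standard kernel: a symmetric measurable function `[0,1]² → [0,1]`. -/
def IsStdKernel (κ : ℝ → ℝ → ℝ) : Prop := IsKernelBdd κ 1

/-- A doubly stochastic measure: a Borel measure on `[0,1]²` both of whose marginals
are Lebesgue measure on `[0,1]`. -/
def IsDoublyStochastic (μ : Measure (ℝ × ℝ)) : Prop :=
  μ.map Prod.fst = volume.restrict (Icc 0 1) ∧ μ.map Prod.snd = volume.restrict (Icc 0 1)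

/-- The quantity `d_μ(κ₁,κ₂)`. -/
def dMu (μ : Measure (ℝ × ℝ)) (κ₁ κ₂ : ℝ → ℝ → ℝ) : ℝ :=
  sSup {r | ∃ S T : Set (ℝ × ℝ), MeasurableSet S ∧ MeasurableSet T ∧
    S ⊆ Icc 0 1 ×ˢ Icc 0 1 ∧ T ⊆ Icc 0 1 ×ˢ Icc 0 1 ∧
    r = |∫ w in S ×ˢ T, (κ₁ w.1.1 w.2.1 - κ₂ w.1.2 w.2.2) ∂(μ.prod μ)|}

/-- Equivalence of kernels via a coupling. -/
def KernelEquiv (κ₁ κ₂ : ℝ → ℝ → ℝ) : Prop :=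
  ∃ μ : Measure (ℝ × ℝ), IsDoublyStochastic μ ∧
    ∀ᵐ w ∂(μ.prod μ), κ₁ w.1.1 w.2.1 = κ₂ w.1.2 w.2.2

/-- `e_G(A,B)`: the number of ordered pairs `(i,j) ∈ A × B` with `ij ∈ E(G)`. -/
def ePairs {n : ℕ} (G : SimpleGraph (Fin n)) (A B : Finset (Fin n)) : ℕ :=
  ((A ×ˢ B).filter fun q => G.Adj q.1 q.2).card

/-- The normalized density `d_p(A,B)`. -/
def dDens {n : ℕ} (p : ℝ) (G : SimpleGraph (Fin n)) (A B : Finset (Fin n)) : ℝ :=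
  ePairs G A B / (p * A.card * B.card)

/-- A sequence of graphs has density bounded by `C`. -/
def DensityBoundedBy (p : ℕ → ℝ) (G : ∀ n, SimpleGraph (Fin n)) (C : ℝ) : Prop :=
  ∀ ε > (0:ℝ), ∀ δ > (0:ℝ), ∀ᶠ n in atTop, ∀ A B : Finset (Fin n),
    ε * n ≤ A.card → ε * n ≤ B.card → dDens (p n) (G n) A B ≤ C + δ

/-- The parts of a partition of `Fin n` indexed by `Fin k`, given as a colouring. -/
def fiber {n k : ℕ} (c : Fin n → Fin k) (a : Fin k) : Finset (Fin n) :=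
  Finset.univ.filter fun v => c v = a

/-- The finite-type kernel `G/Π` associated to a partition of the vertex set of `G`. -/
def partKernel {n k : ℕ} (p : ℝ) (G : SimpleGraph (Fin n)) (c : Fin n → Fin k) :
    ℝ → ℝ → ℝ := fun x y =>
  if h : x ∈ Ioc (0:ℝ) 1 ∧ y ∈ Ioc (0:ℝ) 1 ∧ idx n x < n ∧ idx n y < n then
    dDens p G (fiber c (c ⟨idx n x, h.2.2.1⟩)) (fiber c (c ⟨idx n y, h.2.2.2⟩))
  else 0

/-- A partition is weakly `(ε,p)`-regular for `G`. -/
def WeaklyRegular {n k : ℕ} (p ε : ℝ) (G : SimpleGraph (Fin n)) (c : Fin n → Fin k) : Prop :=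
  cutNorm (fun x y => graphKernel p G x y - partKernel p G c x y) ≤ ε

/-- `(A,B)` is an `(ε,p)`-regular pair for `G`. -/
def RegPair {n : ℕ} (p ε : ℝ) (G : SimpleGraph (Fin n)) (A B : Finset (Fin n)) : Prop :=
  ∀ A' ⊆ A, ∀ B' ⊆ B, ε * A.card ≤ A'.card → ε * B.card ≤ B'.card →
    |dDens p G A' B' - dDens p G A B| ≤ ε

/-- An `(ε,p)`-regular partition of `G` into `k` parts. -/
def RegPartition {n k : ℕ} (p ε : ℝ) (G : SimpleGraph (Fin n)) (c : Fin n → Fin k) : Prop :=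
  (∀ a : Fin k, (fiber c a).card = n / k ∨ (fiber c a).card = n / k + 1) ∧
  ((Finset.univ.filter (fun q : Fin k × Fin k =>
      q.1 < q.2 ∧ ¬ RegPair p ε G (fiber c q.1) (fiber c q.2))).card : ℝ)
    ≤ ε * ((k : ℝ) * ((k : ℝ) - 1) / 2)

/-- The number of walks `v₀v₁⋯v_ℓ` in `G` with `v_i ∈ X_i` for each `i`. -/
def walkCount {n ℓ : ℕ} (G : SimpleGraph (Fin n)) (X : Fin (ℓ+1) → Finset (Fin n)) : ℕ :=
  Nat.card {v : Fin (ℓ+1) → Fin n //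
    (∀ i, v i ∈ X i) ∧ ∀ i : Fin ℓ, G.Adj (v i.castSucc) (v i.succ)}

/-- `κ(X₀,X₁,…,X_ℓ)`: the kernel analogue of the walk count. -/
def kernelWalk {ℓ : ℕ} (κ : ℝ → ℝ → ℝ) (X : Fin (ℓ+1) → Set ℝ) : ℝ :=
  ∫ x in Set.univ.pi X, ∏ i : Fin ℓ, κ (x i.castSucc) (x i.succ)

/-- `p_t(u,v)`: the number of paths of length `t` in `G` from `u` to `v`. -/
def pathCount {n : ℕ} (G : SimpleGraph (Fin n)) (t : ℕ) (u v : Fin n) : ℕ :=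
  Nat.card {w : Fin (t+1) → Fin n // w 0 = u ∧ w (Fin.last t) = v ∧
    Function.Injective w ∧ ∀ i : Fin t, G.Adj (w i.castSucc) (w i.succ)}

/-- The `i`-th vertex on the `r`-th subdivided edge (from `u r` to `v r`, `ℓ` steps). -/
def pv (ℓ : ℕ) {k m : ℕ} (u v : Fin m → Fin k) (r : Fin m) (i : ℕ) :
    Fin k ⊕ (Fin m × Fin (ℓ - 1)) :=
  if h0 : i = 0 then Sum.inl (u r)
  else if h : i < ℓ then Sum.inr (r, ⟨i - 1, by omega⟩)
  else Sum.inl (v r)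

/-- The `(ℓ−1)`-fold subdivision of the loopless multigraph with `k` vertices and
edges `u r — v r` for `r < m`. -/
def multiSubdiv (ℓ : ℕ) {k m : ℕ} (u v : Fin m → Fin k) :
    SimpleGraph (Fin k ⊕ (Fin m × Fin (ℓ - 1))) :=
  SimpleGraph.fromRel fun a b =>
    ∃ r : Fin m, ∃ i : ℕ, i < ℓ ∧ a = pv ℓ u v r i ∧ b = pv ℓ u v r (i + 1)

/-- Membership in the family `F_ℓ` of `(ℓ−1)`-fold subdivisions of finite loopless
multigraphs. -/
def InFamilyF (ℓ : ℕ) {N : ℕ} (F : SimpleGraph (Fin N)) : Prop :=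
  ∃ (k m : ℕ) (u v : Fin m → Fin k), 1 ≤ k ∧ (∀ r, u r ≠ v r) ∧
    Nonempty (F ≃g multiSubdiv ℓ u v)

/-- The edges of a simple graph on `Fin k`, as ordered pairs `(i,j)` with `i < j`. -/
abbrev edgeIdx {k : ℕ} (F : SimpleGraph (Fin k)) : Type :=
  {q : Fin k × Fin k // q.1 < q.2 ∧ F.Adj q.1 q.2}

/-- The `i`-th vertex on the subdivision of the edge `e` (`t` steps). -/
def spv (t : ℕ) {k : ℕ} {F : SimpleGraph (Fin k)} (e : edgeIdx F) (i : ℕ) :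
    Fin k ⊕ (edgeIdx F × Fin (t - 1)) :=
  if h0 : i = 0 then Sum.inl e.1.1
  else if h : i < t then Sum.inr (e, ⟨i - 1, by omega⟩)
  else Sum.inl e.1.2

/-- The `t`-subdivision `Sub_t(F)` of a simple graph `F`: each edge is replaced by a
path of length `t` through `t−1` new internal vertices. -/
def subdiv (t : ℕ) {k : ℕ} (F : SimpleGraph (Fin k)) :
    SimpleGraph (Fin k ⊕ (edgeIdx F × Fin (t - 1))) :=
  SimpleGraph.fromRel fun a b =>
    ∃ e : edgeIdx F, ∃ i : ℕ, i < t ∧ a = spv t e i ∧ b = spv t e (i + 1)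

/-- The `t`-th power kernel `κ^t`. -/
def kpow (κ : ℝ → ℝ → ℝ) : ℕ → ℝ → ℝ → ℝ
  | 0 => fun _ _ => 0
  | 1 => κ
  | (n + 2) => fun x y => ∫ z in Icc (0:ℝ) 1, kpow κ (n + 1) x z * κ z y

/-- `φ : Fin ℓ → Fin n` is a homomorphism from `F` to `G`. -/
def IsHom {α β : Type*} (F : SimpleGraph α) (G : SimpleGraph β) (φ : α → β) : Prop :=
  ∀ i j, F.Adj i j → G.Adj (φ i) (φ j)

/-- `F` is flat over its induced subgraph `F'` on the first `ℓ` vertices, for the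
sequence `(G_n)` with normalizing function `p`. -/
def FlatOver (p : ℕ → ℝ) (G : ∀ n, SimpleGraph (Fin n)) {k ℓ : ℕ} (h : ℓ ≤ k)
    (F : SimpleGraph (Fin k)) : Prop :=
  ∀ ε > (0:ℝ), ∀ᶠ n in atTop,
    ((Finset.univ.filter (fun φ : Fin ℓ → Fin n =>
        IsHom (F.comap (Fin.castLE h)) (G n) φ ∧
        ε * ((n:ℝ) ^ (k - ℓ) * p n ^ (edgeCount F - edgeCount (F.comap (Fin.castLE h)))) <
          |((Finset.univ.filter (fun ψ : Fin k → Fin n =>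
              IsHom F (G n) ψ ∧ ψ ∘ Fin.castLE h = φ)).card : ℝ) -
            (n:ℝ) ^ (k - ℓ) * p n ^ (edgeCount F - edgeCount (F.comap (Fin.castLE h)))|)).card
      : ℝ)
      ≤ ε * ((Finset.univ.filter (fun φ : Fin ℓ → Fin n =>
          IsHom (F.comap (Fin.castLE h)) (G n) φ)).card : ℝ)

/-- The set of density matrices of balanced partitions of `V(G)` into `k` nonempty
parts. -/
def MsetG (k : ℕ) {n : ℕ} (p : ℝ) (G : SimpleGraph (Fin n)) : Set (Fin k → Fin k → ℝ) :=
  {M | ∃ c : Fin n → Fin k, Function.Surjective c ∧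
    (∀ a b, (fiber c a).card ≤ (fiber c b).card + 1) ∧
    M = fun a b => dDens p G (fiber c a) (fiber c b)}

/-- The closed set of density matrices of partitions of `[0,1]` into `k` parts of
measure `1/k`, for a kernel `κ`. -/
def MsetK (k : ℕ) (κ : ℝ → ℝ → ℝ) : Set (Fin k → Fin k → ℝ) :=
  closure {M | ∃ Q : Fin k → Set ℝ, (∀ a, MeasurableSet (Q a)) ∧
    (Pairwise fun a b => Disjoint (Q a) (Q b)) ∧ (⋃ a, Q a) = Icc 0 1 ∧
    (∀ a, volume (Q a) = 1 / (k : ℝ≥0∞)) ∧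
    M = fun a b => (k : ℝ)^2 * ∫ q in (Q a) ×ˢ (Q b), κ q.1 q.2}

end

section BoundedKernels

/-- A bounded measurable real-valued function. -/
structure BddMeas {α : Type*} [MeasurableSpace α] (f : α → ℝ) : Prop where
  measurable : Measurable f
  bdd : ∃ B : ℝ, ∀ x, |f x| ≤ B

namespace BddMeas

variable {α β : Type*} [MeasurableSpace α] [MeasurableSpace β] {f g : α → ℝ}

lemma of_bound (hf : Measurable f) (B : ℝ) (h : ∀ x, |f x| ≤ B) : BddMeas f := ⟨hf, B, h⟩

lemma const (c : ℝ) : BddMeas (fun _ : α => c) := ⟨measurable_const, |c|, fun _ => le_rfl⟩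

lemma integrable (hf : BddMeas f) (μ : Measure α) [IsFiniteMeasure μ] : Integrable f μ := by
  obtain ⟨B, hB⟩ := hf.bdd
  exact Integrable.of_bound hf.measurable.aestronglyMeasurable B
    (Eventually.of_forall fun x => by simpa using hB x)

lemma add (hf : BddMeas f) (hg : BddMeas g) : BddMeas (fun x => f x + g x) := by
  obtain ⟨A, hA⟩ := hf.bdd
  obtain ⟨B, hB⟩ := hg.bdd
  exact ⟨hf.measurable.add hg.measurable, A + B,
    fun x => (abs_add_le _ _).trans (add_le_add (hA x) (hB x))⟩

lemma neg (hf : BddMeas f) : BddMeas (fun x => - f x) := by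
  obtain ⟨A, hA⟩ := hf.bdd
  exact ⟨hf.measurable.neg, A, fun x => by simpa using hA x⟩

lemma sub (hf : BddMeas f) (hg : BddMeas g) : BddMeas (fun x => f x - g x) := by
  simpa [sub_eq_add_neg] using hf.add hg.neg

lemma mul (hf : BddMeas f) (hg : BddMeas g) : BddMeas (fun x => f x * g x) := by
  obtain ⟨A, hA⟩ := hf.bdd
  obtain ⟨B, hB⟩ := hg.bdd
  refine ⟨hf.measurable.mul hg.measurable, A * B, fun x => ?_⟩
  rw [abs_mul]
  exact mul_le_mul (hA x) (hB x) (abs_nonneg _) ((abs_nonneg _).trans (hA x))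

lemma abs (hf : BddMeas f) : BddMeas (fun x => |f x|) := by
  obtain ⟨A, hA⟩ := hf.bdd
  exact ⟨hf.measurable.abs, A, fun x => by simpa using hA x⟩

lemma pow (hf : BddMeas f) (k : ℕ) : BddMeas (fun x => f x ^ k) := by
  induction k with
  | zero => simpa using const 1
  | succ k ih => simpa [pow_succ] using ih.mul hf

lemma sum {ι : Type*} (s : Finset ι) {f : ι → α → ℝ} (h : ∀ i ∈ s, BddMeas (f i)) :
    BddMeas (fun x => ∑ i ∈ s, f i x) := by
  induction s using Finset.induction_on with
  | empty => simpa using const 0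
  | insert a s ha ih =>
    simp only [Finset.sum_insert ha]
    exact (h a (by simp)).add (ih fun i hi => h i (by simp [hi]))

lemma prod {ι : Type*} (s : Finset ι) {f : ι → α → ℝ} (h : ∀ i ∈ s, BddMeas (f i)) :
    BddMeas (fun x => ∏ i ∈ s, f i x) := by
  induction s using Finset.induction_on with
  | empty => simpa using const 1
  | insert a s ha ih =>
    simp only [Finset.prod_insert ha]
    exact (h a (by simp)).mul (ih fun i hi => h i (by simp [hi]))

lemma ite {P : α → Prop} (hP : MeasurableSet {x | P x}) (hf : BddMeas f) (hg : BddMeas g) :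
    BddMeas (fun x => if P x then f x else g x) := by
  obtain ⟨A, hA⟩ := hf.bdd
  obtain ⟨B, hB⟩ := hg.bdd
  refine ⟨Measurable.ite hP hf.measurable hg.measurable, max A B, fun x => ?_⟩
  split_ifs
  · exact (hA x).trans (le_max_left _ _)
  · exact (hB x).trans (le_max_right _ _)

lemma comp (hf : BddMeas f) {g : β → α} (hg : Measurable g) : BddMeas (fun x => f (g x)) := by
  obtain ⟨A, hA⟩ := hf.bdd
  exact ⟨hf.measurable.comp hg, A, fun x => hA _⟩

lemma comp₂ {γ δ : Type*} [MeasurableSpace γ] [MeasurableSpace δ] {K : γ → δ → ℝ}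
    (hK : BddMeas (fun q : γ × δ => K q.1 q.2)) {f : β → γ} {g : β → δ}
    (hf : Measurable f) (hg : Measurable g) : BddMeas (fun x => K (f x) (g x)) :=
  hK.comp (hf.prodMk hg)

lemma integral_right {γ δ : Type*} [MeasurableSpace γ] [MeasurableSpace δ] {K : γ → δ → ℝ}
    (hK : BddMeas (fun q : γ × δ => K q.1 q.2)) (ν : Measure δ) [IsFiniteMeasure ν] :
    BddMeas (fun x => ∫ y, K x y ∂ν) := by
  obtain ⟨B, hB⟩ := hK.bdd
  refine ⟨(hK.measurable.stronglyMeasurable.integral_prod_right).measurable,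
    B * ν.real univ, fun x => ?_⟩
  have := norm_integral_le_of_norm_le_const (μ := ν) (f := fun y => K x y) (C := B)
    (Eventually.of_forall fun y => by simpa using hB (x, y))
  simpa using this

lemma swap {γ δ : Type*} [MeasurableSpace γ] [MeasurableSpace δ] {K : γ → δ → ℝ}
    (hK : BddMeas (fun q : γ × δ => K q.1 q.2)) : BddMeas (fun q : δ × γ => K q.2 q.1) :=
  hK.comp₂ measurable_snd measurable_fst

lemma left {γ δ : Type*} [MeasurableSpace γ] [MeasurableSpace δ] {K : γ → δ → ℝ}
    (hK : BddMeas (fun q : γ × δ => K q.1 q.2)) (x : γ) : BddMeas (fun y => K x y) :=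
  hK.comp₂ measurable_const measurable_id

lemma right {γ δ : Type*} [MeasurableSpace γ] [MeasurableSpace δ] {K : γ → δ → ℝ}
    (hK : BddMeas (fun q : γ × δ => K q.1 q.2)) (y : δ) : BddMeas (fun x => K x y) :=
  hK.comp₂ measurable_id measurable_const

lemma integral_swap {γ δ : Type*} [MeasurableSpace γ] [MeasurableSpace δ] {K : γ → δ → ℝ}
    (hK : BddMeas (fun q : γ × δ => K q.1 q.2)) (μ : Measure γ) (ν : Measure δ)
    [IsFiniteMeasure μ] [IsFiniteMeasure ν] :
    ∫ x, ∫ y, K x y ∂ν ∂μ = ∫ y, ∫ x, K x y ∂μ ∂ν :=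
  integral_integral_swap (hK.integrable (μ.prod ν))

lemma integral_mono {μ : Measure α} [IsFiniteMeasure μ] (hf : BddMeas f) (hg : BddMeas g)
    (h : ∀ x, f x ≤ g x) : ∫ x, f x ∂μ ≤ ∫ x, g x ∂μ :=
  MeasureTheory.integral_mono (hf.integrable μ) (hg.integrable μ) h

end BddMeas

variable {Ω : Type*} [MeasurableSpace Ω] (μ : Measure Ω) [IsProbabilityMeasure μ]

lemma truncated_tail_le {a e m : ℝ} (ha : 0 ≤ a) (he : 0 ≤ e) (hm : 0 < m) :
    (if a ≤ m ^ 2 then 0 else a) * e ≤ (a ^ 2 + e ^ 4) / m := by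
  split_ifs with h
  · rw [zero_mul]; positivity
  · push Not at h
    rw [le_div_iff₀ hm]
    by_cases h2 : e ≤ m
    · have : a * e * m ≤ a * m * m := by gcongr
      nlinarith [pow_nonneg he 4]
    · push Not at h2
      have h3 : (m * e) ^ 2 ≤ e ^ 4 := by
        have : (m * e) ^ 2 ≤ (e * e) ^ 2 := by gcongr
        nlinarith
      nlinarith [sq_nonneg (a - m * e), mul_nonneg (mul_nonneg ha he) hm.le]

lemma mul_le_of_truncation {a b e m : ℝ} (ha : 0 ≤ a) (hb : 0 ≤ b) (hbe : b ≤ e) (hm : 0 < m) :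
    a * b ≤ m ^ 2 * b + (a ^ 2 + e ^ 4) / m := by
  have he : 0 ≤ e := hb.trans hbe
  have h0 := truncated_tail_le ha he hm
  split_ifs at h0 with h
  · have : a * b ≤ m ^ 2 * b := by gcongr
    linarith
  · have : a * b ≤ a * e := by gcongr
    have : 0 ≤ m ^ 2 * b := by positivity
    linarith

/-- `V` acts from `L^∞` to `L¹` with norm at most `ε`. -/
def OpSmall (V : Ω → Ω → ℝ) (ε : ℝ) : Prop :=
  ∀ h : Ω → ℝ, Measurable h → (∀ x, |h x| ≤ 1) → ∫ x, |∫ y, V x y * h y ∂μ| ∂μ ≤ ε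

variable {μ}

lemma OpSmall.scale {V : Ω → Ω → ℝ} {ε : ℝ} (hV : OpSmall μ V ε) {c : ℝ} (hc : 0 < c)
    {h : Ω → ℝ} (hh : Measurable h) (hb : ∀ x, |h x| ≤ c) :
    ∫ x, |∫ y, V x y * h y ∂μ| ∂μ ≤ c * ε := by
  have h1 := hV (fun x => c⁻¹ * h x) (hh.const_mul _) (fun x => by
    rw [abs_mul, abs_of_pos (inv_pos.2 hc), inv_mul_le_iff₀ hc]; simpa using hb x)
  have h2 : ∀ x, |∫ y, V x y * (c⁻¹ * h y) ∂μ| = c⁻¹ * |∫ y, V x y * h y ∂μ| := by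
    intro x
    rw [← abs_of_pos (inv_pos.2 hc), ← abs_mul, abs_of_pos (inv_pos.2 hc), ← integral_const_mul]
    congr 2
    ext y; ring
  simp only [h2, integral_const_mul] at h1
  rwa [inv_mul_le_iff₀ hc] at h1

/-- Truncation bound for the action of `V` on an unbounded profile. -/
lemma integral_abs_apply_le {V : Ω → Ω → ℝ} (hVm : BddMeas (fun q : Ω × Ω => V q.1 q.2))
    {ε : ℝ} (hV : OpSmall μ (fun x y => V y x) ε) {e : Ω → ℝ} (he : BddMeas e)
    (hVe : ∀ z, ∫ y, |V z y| ∂μ ≤ e z) {k : Ω → ℝ} (hk : BddMeas k) (hk0 : ∀ z, 0 ≤ k z)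
    {m : ℝ} (hm : 0 < m) :
    ∫ y, |∫ z, k z * V z y ∂μ| ∂μ ≤
      m ^ 2 * ε + (∫ z, k z ^ 2 ∂μ + ∫ z, e z ^ 4 ∂μ) / m := by
  set f : Ω → ℝ := fun z => if k z ≤ m ^ 2 then k z else 0 with hf
  set t : Ω → ℝ := fun z => if k z ≤ m ^ 2 then 0 else k z with ht
  have hset : MeasurableSet {z | k z ≤ m ^ 2} := measurableSet_le hk.measurable measurable_const
  have hfm : BddMeas f := BddMeas.ite hset hk (BddMeas.const 0)
  have htm : BddMeas t := BddMeas.ite hset (BddMeas.const 0) hk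
  have ht0 : ∀ z, 0 ≤ t z := fun z => by simp only [ht]; split_ifs <;> simp [hk0]
  have hsum : ∀ z, k z = f z + t z := fun z => by simp only [hf, ht]; split_ifs <;> simp
  have hfV : BddMeas (fun q : Ω × Ω => f q.2 * V q.2 q.1) :=
    (hfm.comp measurable_snd).mul hVm.swap
  have htV : BddMeas (fun q : Ω × Ω => t q.2 * |V q.2 q.1|) :=
    (htm.comp measurable_snd).mul hVm.swap.abs
  have htV' : BddMeas (fun q : Ω × Ω => t q.2 * V q.2 q.1) :=
    (htm.comp measurable_snd).mul hVm.swap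
  have hkV : BddMeas (fun q : Ω × Ω => k q.2 * V q.2 q.1) :=
    (hk.comp measurable_snd).mul hVm.swap
  have h1 : ∫ y, |∫ z, k z * V z y ∂μ| ∂μ ≤
      ∫ y, (|∫ z, f z * V z y ∂μ| + ∫ z, t z * |V z y| ∂μ) ∂μ := by
    refine BddMeas.integral_mono (hkV.integral_right (K := fun y z => k z * V z y) μ).abs
      (((hfV.integral_right (K := fun y z => f z * V z y) μ).abs).add
        (htV.integral_right (K := fun y z => t z * |V z y|) μ)) fun y => ?_
    have : ∫ z, k z * V z y ∂μ = ∫ z, f z * V z y ∂μ + ∫ z, t z * V z y ∂μ := by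
      rw [← integral_add ((hfV.left (K := fun y z => f z * V z y) y).integrable μ)
        ((htV'.left (K := fun y z => t z * V z y) y).integrable μ)]
      refine integral_congr_ae (Eventually.of_forall fun z => ?_)
      simp only [hsum z]; ring
    rw [this]
    refine (abs_add_le _ _).trans (add_le_add le_rfl ?_)
    refine (abs_integral_le_integral_abs).trans (le_of_eq ?_)
    refine integral_congr_ae (Eventually.of_forall fun z => ?_)
    simp [abs_mul, abs_of_nonneg (ht0 z)]
  have h2 : ∫ y, |∫ z, f z * V z y ∂μ| ∂μ ≤ m ^ 2 * ε := by
    have := hV.scale (c := m ^ 2) (by positivity) hfm.measurable (fun z => by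
      simp only [hf]; split_ifs with h
      · rwa [abs_of_nonneg (hk0 z)]
      · simpa using sq_nonneg m)
    simpa only [mul_comm] using this
  have h3 : ∫ y, ∫ z, t z * |V z y| ∂μ ∂μ ≤ (∫ z, k z ^ 2 ∂μ + ∫ z, e z ^ 4 ∂μ) / m := by
    rw [htV.integral_swap (K := fun y z => t z * |V z y|), ← integral_add
      ((hk.pow 2).integrable μ) ((he.pow 4).integrable μ), ← integral_div]
    simp only [integral_const_mul]
    refine BddMeas.integral_mono (htm.mul (hVm.abs.integral_right (K := fun x y => |V x y|) μ))
      (by simpa [div_eq_mul_inv] using ((hk.pow 2).add (he.pow 4)).mul (BddMeas.const m⁻¹))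
      fun z => ?_
    have he0 : 0 ≤ e z := (integral_nonneg fun y => abs_nonneg _).trans (hVe z)
    exact (mul_le_mul_of_nonneg_left (hVe z) (ht0 z)).trans (truncated_tail_le (hk0 z) he0 hm)
  rw [integral_add ((hfV.integral_right (K := fun y z => f z * V z y) μ).abs.integrable μ)
    ((htV.integral_right (K := fun y z => t z * |V z y|) μ).integrable μ)] at h1
  linarith

/-- Truncation bound for the weak action of a product `K ∘ V`. -/
lemma integral_abs_comp_apply_le {K V : Ω → Ω → ℝ}
    (hK : BddMeas (fun q : Ω × Ω => K q.1 q.2)) (hK0 : ∀ x y, 0 ≤ K x y)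
    (hVm : BddMeas (fun q : Ω × Ω => V q.1 q.2)) {ε : ℝ} (hV : OpSmall μ V ε)
    {e : Ω → ℝ} (he : BddMeas e) (hVe : ∀ z, ∫ y, |V z y| ∂μ ≤ e z)
    {h : Ω → ℝ} (hh : Measurable h) (hh1 : ∀ x, |h x| ≤ 1) {m : ℝ} (hm : 0 < m) :
    ∫ x, |∫ z, K x z * ∫ y, V z y * h y ∂μ ∂μ| ∂μ ≤
      m ^ 2 * ε + (∫ z, (∫ x, K x z ∂μ) ^ 2 ∂μ + ∫ z, e z ^ 4 ∂μ) / m := by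
  have hhb : BddMeas h := ⟨hh, 1, hh1⟩
  set ψ : Ω → ℝ := fun z => ∫ y, V z y * h y ∂μ with hψ
  have hψm : BddMeas ψ :=
    (hVm.mul (hhb.comp measurable_snd)).integral_right (K := fun z y => V z y * h y) μ
  have hψe : ∀ z, |ψ z| ≤ e z := fun z => by
    refine (abs_integral_le_integral_abs).trans (le_trans ?_ (hVe z))
    refine BddMeas.integral_mono ((hVm.left z).mul hhb).abs (hVm.left z).abs fun y => ?_
    rw [abs_mul]
    exact mul_le_of_le_one_right (abs_nonneg _) (hh1 y)
  set a : Ω → ℝ := fun z => ∫ x, K x z ∂μ with ha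
  have ham : BddMeas a := hK.swap.integral_right (K := fun z x => K x z) μ
  have ha0 : ∀ z, 0 ≤ a z := fun z => integral_nonneg fun x => hK0 x z
  have hKψ : BddMeas (fun q : Ω × Ω => K q.1 q.2 * ψ q.2) := hK.mul (hψm.comp measurable_snd)
  have hKψ' : BddMeas (fun q : Ω × Ω => K q.1 q.2 * |ψ q.2|) :=
    hK.mul (hψm.abs.comp measurable_snd)
  calc ∫ x, |∫ z, K x z * ψ z ∂μ| ∂μ ≤ ∫ x, ∫ z, K x z * |ψ z| ∂μ ∂μ := by
        refine BddMeas.integral_mono (hKψ.integral_right (K := fun x z => K x z * ψ z) μ).abs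
          (hKψ'.integral_right (K := fun x z => K x z * |ψ z|) μ) fun x => ?_
        refine (abs_integral_le_integral_abs).trans (le_of_eq ?_)
        refine integral_congr_ae (Eventually.of_forall fun z => ?_)
        simp [abs_mul, abs_of_nonneg (hK0 x z)]
    _ = ∫ z, a z * |ψ z| ∂μ := by
        rw [hKψ'.integral_swap (K := fun x z => K x z * |ψ z|)]
        simp only [integral_mul_const, ha]
    _ ≤ ∫ z, (m ^ 2 * |ψ z| + (a z ^ 2 + e z ^ 4) * m⁻¹) ∂μ := by
        refine BddMeas.integral_mono (ham.mul hψm.abs)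
          (((BddMeas.const _).mul hψm.abs).add
            (((ham.pow 2).add (he.pow 4)).mul (BddMeas.const m⁻¹))) fun z => ?_
        rw [← div_eq_mul_inv]
        exact mul_le_of_truncation (ha0 z) (abs_nonneg _) (hψe z) hm
    _ = m ^ 2 * ∫ z, |ψ z| ∂μ + (∫ z, a z ^ 2 ∂μ + ∫ z, e z ^ 4 ∂μ) / m := by
        rw [integral_add (((BddMeas.const _).mul hψm.abs).integrable μ)
          ((((ham.pow 2).add (he.pow 4)).mul (BddMeas.const m⁻¹)).integrable μ),
          integral_const_mul, integral_mul_const,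
          integral_add ((ham.pow 2).integrable μ) ((he.pow 4).integrable μ), div_eq_mul_inv]
    _ ≤ _ := by
        gcongr
        exact hV h hh hh1

end BoundedKernels

section WalkKernels

variable {Ω : Type*} [MeasurableSpace Ω]

/-- The kernel counting weighted walks of length `j + 1`, the `i`-th vertex of the walk having
weight `χ i`. -/
noncomputable def walkKer (μ : Measure Ω) (W : Ω → Ω → ℝ) (χ : ℕ → Ω → ℝ) : ℕ → Ω → Ω → ℝ
  | 0 => fun x y => χ 0 x * W x y * χ 1 y
  | j + 1 => fun x y => (∫ z, walkKer μ W χ j x z * W z y ∂μ) * χ (j + 2) y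

/-- A family of measurable weights with values in `[0,1]`. -/
structure IsWeight (χ : ℕ → Ω → ℝ) : Prop where
  measurable : ∀ i, Measurable (χ i)
  nonneg : ∀ i x, 0 ≤ χ i x
  le_one : ∀ i x, χ i x ≤ 1

lemma IsWeight.abs_le {χ : ℕ → Ω → ℝ} (h : IsWeight χ) (i : ℕ) (x : Ω) : |χ i x| ≤ 1 := by
  rw [abs_of_nonneg (h.nonneg i x)]; exact h.le_one i x

lemma IsWeight.bddMeas {χ : ℕ → Ω → ℝ} (h : IsWeight χ) (i : ℕ) : BddMeas (χ i) :=
  ⟨h.measurable i, 1, h.abs_le i⟩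

variable {μ : Measure Ω} [IsProbabilityMeasure μ] {W U : Ω → Ω → ℝ} {χ : ℕ → Ω → ℝ}

lemma walkKer_bddMeas (hW : BddMeas (fun q : Ω × Ω => W q.1 q.2)) (hχ : IsWeight χ) (j : ℕ) :
    BddMeas (fun q : Ω × Ω => walkKer μ W χ j q.1 q.2) := by
  induction j with
  | zero =>
    exact (((hχ.bddMeas 0).comp measurable_fst).mul hW).mul ((hχ.bddMeas 1).comp measurable_snd)
  | succ j ih =>
    refine BddMeas.mul ?_ ((hχ.bddMeas (j + 2)).comp measurable_snd)
    refine BddMeas.integral_right (K := fun (q : Ω × Ω) z => walkKer μ W χ j q.1 z * W z q.2) ?_ μ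
    exact (ih.comp₂ (by fun_prop) (by fun_prop)).mul (hW.comp₂ (by fun_prop) (by fun_prop))

lemma walkKer_nonneg (hW : ∀ x y, 0 ≤ W x y) (hχ : IsWeight χ) (j : ℕ) (x y : Ω) :
    0 ≤ walkKer μ W χ j x y := by
  induction j generalizing x y with
  | zero => exact mul_nonneg (mul_nonneg (hχ.nonneg _ _) (hW _ _)) (hχ.nonneg _ _)
  | succ j ih =>
    exact mul_nonneg (integral_nonneg fun z => mul_nonneg (ih _ _) (hW _ _)) (hχ.nonneg _ _)

lemma walkKer_le {C : ℝ} (hU : BddMeas (fun q : Ω × Ω => U q.1 q.2)) (hU0 : ∀ x y, 0 ≤ U x y)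
    (hUC : ∀ x y, U x y ≤ C) (hχ : IsWeight χ) (j : ℕ) (x y : Ω) :
    walkKer μ U χ j x y ≤ C ^ (j + 1) := by
  have hC : 0 ≤ C := (hU0 x x).trans (hUC x x)
  induction j generalizing x y with
  | zero =>
    have h1 : χ 0 x * U x y ≤ 1 * C :=
      mul_le_mul (hχ.le_one _ _) (hUC _ _) (hU0 _ _) zero_le_one
    have h2 := mul_le_mul h1 (hχ.le_one 1 y) (hχ.nonneg _ _) (by simpa using hC)
    simpa [walkKer] using h2
  | succ j ih =>
    have h1 : ∫ z, walkKer μ U χ j x z * U z y ∂μ ≤ ∫ _z, C ^ (j + 1) * C ∂μ := by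
      refine BddMeas.integral_mono (((walkKer_bddMeas hU hχ j).left x).mul (hU.right y))
        (BddMeas.const _) fun z => ?_
      exact mul_le_mul (ih _ _) (hUC _ _) (hU0 _ _) (by positivity)
    have h2 := mul_le_mul h1 (hχ.le_one (j + 2) y) (hχ.nonneg _ _)
      (by simpa using mul_nonneg (pow_nonneg hC (j + 1)) hC)
    simpa [walkKer, pow_succ] using h2

lemma integral_integral_walkKer_le {C : ℝ} (hU : BddMeas (fun q : Ω × Ω => U q.1 q.2))
    (hU0 : ∀ x y, 0 ≤ U x y) (hUC : ∀ x y, U x y ≤ C) (hχ : IsWeight χ) (j : ℕ) :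
    ∫ x, ∫ y, walkKer μ U χ j x y ∂μ ∂μ ≤ C ^ j * ∫ x, ∫ y, U x y ∂μ ∂μ := by
  have : Nonempty Ω := μ.nonempty_of_neZero
  obtain ⟨x₀⟩ := this
  have hC : 0 ≤ C := (hU0 x₀ x₀).trans (hUC x₀ x₀)
  cases j with
  | zero =>
    simp only [pow_zero, one_mul]
    refine BddMeas.integral_mono ((walkKer_bddMeas hU hχ 0).integral_right μ)
      (hU.integral_right μ) fun x => ?_
    refine BddMeas.integral_mono ((walkKer_bddMeas hU hχ 0).left x) (hU.left x) fun y => ?_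
    have h1 : χ 0 x * U x y ≤ U x y := mul_le_of_le_one_left (hU0 _ _) (hχ.le_one _ _)
    exact (mul_le_of_le_one_right (mul_nonneg (hχ.nonneg _ _) (hU0 _ _)) (hχ.le_one _ _)).trans h1
  | succ j =>
    have hWU : ∀ x, BddMeas (fun q : Ω × Ω => walkKer μ U χ j x q.2 * U q.2 q.1) := fun x =>
      (((walkKer_bddMeas hU hχ j).left x).comp measurable_snd).mul hU.swap
    have key : ∀ x, ∫ y, walkKer μ U χ (j + 1) x y ∂μ ≤ C ^ (j + 1) * ∫ x, ∫ y, U x y ∂μ ∂μ := by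
      intro x
      calc ∫ y, walkKer μ U χ (j + 1) x y ∂μ ≤ ∫ y, ∫ z, C ^ (j + 1) * U z y ∂μ ∂μ := by
            refine BddMeas.integral_mono ((walkKer_bddMeas hU hχ _).left x)
              (BddMeas.integral_right (K := fun y z => C ^ (j + 1) * U z y)
                ((BddMeas.const _).mul hU.swap) μ) fun y => ?_
            refine (mul_le_of_le_one_right (integral_nonneg fun z =>
              mul_nonneg (walkKer_nonneg hU0 hχ _ _ _) (hU0 _ _)) (hχ.le_one _ _)).trans ?_
            refine BddMeas.integral_mono (((walkKer_bddMeas hU hχ j).left x).mul (hU.right y))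
              ((BddMeas.const _).mul (hU.right y)) fun z => ?_
            exact mul_le_mul_of_nonneg_right (walkKer_le hU hU0 hUC hχ _ _ _) (hU0 _ _)
        _ = _ := by
            simp only [integral_const_mul]
            rw [hU.integral_swap]
    calc ∫ x, ∫ y, walkKer μ U χ (j + 1) x y ∂μ ∂μ
        ≤ ∫ _x, C ^ (j + 1) * ∫ x, ∫ y, U x y ∂μ ∂μ ∂μ :=
          BddMeas.integral_mono ((walkKer_bddMeas hU hχ _).integral_right μ) (BddMeas.const _) key
      _ = _ := by simp

lemma walkKer_sub_small_zero {ε : ℝ} (hε : OpSmall μ (fun x y => W x y - U x y) ε)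
    (h_int : ∀ h : Ω → ℝ, Measurable h → (∀ x, |h x| ≤ 1) →
      BddMeas (fun x => ∫ y, (W x y - U x y) * h y ∂μ)) (hχ : IsWeight χ) :
    OpSmall μ (fun x y => walkKer μ W χ 0 x y - walkKer μ U χ 0 x y) ε := by
  intro h hh hh1
  have hg : Measurable (fun y => χ 1 y * h y) := (hχ.measurable 1).mul hh
  have hg1 : ∀ y, |χ 1 y * h y| ≤ 1 := fun y => by
    rw [abs_mul]; exact mul_le_one₀ (hχ.abs_le _ _) (abs_nonneg _) (hh1 y)
  refine le_trans ?_ (hε _ hg hg1)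
  have heq : ∀ x, ∫ y, (walkKer μ W χ 0 x y - walkKer μ U χ 0 x y) * h y ∂μ =
      χ 0 x * ∫ y, (W x y - U x y) * (χ 1 y * h y) ∂μ := fun x => by
    rw [← integral_const_mul]
    refine integral_congr_ae (Eventually.of_forall fun y => ?_)
    simp only [walkKer]; ring
  simp only [heq]
  refine BddMeas.integral_mono ((hχ.bddMeas 0).mul (h_int _ hg hg1)).abs (h_int _ hg hg1).abs
    fun x => ?_
  rw [abs_mul]
  exact mul_le_of_le_one_left (abs_nonneg _) (hχ.abs_le _ _)

lemma walkKer_sub_small_succ {C ε η : ℝ} (hC : 0 < C)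
    (hW : BddMeas (fun q : Ω × Ω => W q.1 q.2)) (hW0 : ∀ x y, 0 ≤ W x y)
    (hU : BddMeas (fun q : Ω × Ω => U q.1 q.2)) (hU0 : ∀ x y, 0 ≤ U x y)
    (hUC : ∀ x y, U x y ≤ C) (hχ : IsWeight χ)
    (hε : OpSmall μ (fun x y => W x y - U x y) ε)
    {e : Ω → ℝ} (he : BddMeas e) (hVe : ∀ z, ∫ y, |W z y - U z y| ∂μ ≤ e z) (j : ℕ)
    (hη : OpSmall μ (fun x y => walkKer μ W χ j x y - walkKer μ U χ j x y) η)
    {m : ℝ} (hm : 0 < m) :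
    OpSmall μ (fun x y => walkKer μ W χ (j + 1) x y - walkKer μ U χ (j + 1) x y)
      (C * η + (m ^ 2 * ε +
        (∫ z, (∫ x, walkKer μ W χ j x z ∂μ) ^ 2 ∂μ + ∫ z, e z ^ 4 ∂μ) / m)) := by
  intro h hh hh1
  set g : Ω → ℝ := fun y => χ (j + 2) y * h y with hgdef
  have hg : Measurable g := (hχ.measurable _).mul hh
  have hg1 : ∀ y, |g y| ≤ 1 := fun y => by
    rw [hgdef, abs_mul]; exact mul_le_one₀ (hχ.abs_le _ _) (abs_nonneg _) (hh1 y)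
  have hgb : BddMeas g := ⟨hg, 1, hg1⟩
  have hK := walkKer_bddMeas (μ := μ) hW hχ j
  have hL := walkKer_bddMeas (μ := μ) hU hχ j
  have expand : ∀ {X : Ω → Ω → ℝ} (_ : BddMeas (fun q : Ω × Ω => X q.1 q.2)) (x : Ω),
      ∫ y, walkKer μ X χ (j + 1) x y * h y ∂μ =
        ∫ z, walkKer μ X χ j x z * ∫ y, X z y * g y ∂μ ∂μ := by
    intro X hX x
    have hX' := walkKer_bddMeas (μ := μ) hX hχ j
    have hb : BddMeas (fun q : Ω × Ω => walkKer μ X χ j x q.2 * X q.2 q.1 * g q.1) :=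
      ((hX'.comp₂ measurable_const measurable_snd).mul hX.swap).mul (hgb.comp measurable_fst)
    calc ∫ y, walkKer μ X χ (j + 1) x y * h y ∂μ
        = ∫ y, ∫ z, walkKer μ X χ j x z * X z y * g y ∂μ ∂μ := by
          refine integral_congr_ae (Eventually.of_forall fun y => ?_)
          simp only [walkKer, hgdef, integral_mul_const]; ring
      _ = ∫ z, ∫ y, walkKer μ X χ j x z * X z y * g y ∂μ ∂μ :=
          hb.integral_swap (K := fun y z => walkKer μ X χ j x z * X z y * g y) μ μ
      _ = _ := by
          refine integral_congr_ae (Eventually.of_forall fun z => ?_)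
          simp only [← integral_const_mul, mul_assoc]
  have hWg : BddMeas (fun z => ∫ y, W z y * g y ∂μ) :=
    (hW.mul (hgb.comp measurable_snd)).integral_right (K := fun z y => W z y * g y) μ
  have hUg : BddMeas (fun z => ∫ y, U z y * g y ∂μ) :=
    (hU.mul (hgb.comp measurable_snd)).integral_right (K := fun z y => U z y * g y) μ
  have hVg : BddMeas (fun z => ∫ y, (W z y - U z y) * g y ∂μ) :=
    ((hW.sub hU).mul (hgb.comp measurable_snd)).integral_right
      (K := fun z y => (W z y - U z y) * g y) μ
  have hVg' : ∀ z, ∫ y, (W z y - U z y) * g y ∂μ = ∫ y, W z y * g y ∂μ - ∫ y, U z y * g y ∂μ := by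
    intro z
    rw [← integral_sub (((hW.left z).mul hgb).integrable μ) (((hU.left z).mul hgb).integrable μ)]
    simp only [sub_mul]
  have split : ∀ x, ∫ y, (walkKer μ W χ (j + 1) x y - walkKer μ U χ (j + 1) x y) * h y ∂μ =
      ∫ z, walkKer μ W χ j x z * ∫ y, (W z y - U z y) * g y ∂μ ∂μ +
      ∫ z, (walkKer μ W χ j x z - walkKer μ U χ j x z) * ∫ y, U z y * g y ∂μ ∂μ := by
    intro x
    have hhb : BddMeas h := ⟨hh, 1, hh1⟩
    simp only [sub_mul]
    rw [integral_sub ((((walkKer_bddMeas hW hχ (j + 1)).left x).mul hhb).integrable μ)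
      ((((walkKer_bddMeas hU hχ (j + 1)).left x).mul hhb).integrable μ), expand hW, expand hU,
      integral_sub (((hK.left x).mul hUg).integrable μ) (((hL.left x).mul hUg).integrable μ)]
    simp only [← sub_mul, hVg', mul_sub]
    rw [integral_sub (((hK.left x).mul hWg).integrable μ) (((hK.left x).mul hUg).integrable μ)]
    ring
  have hA : BddMeas (fun x => ∫ z, walkKer μ W χ j x z * ∫ y, (W z y - U z y) * g y ∂μ ∂μ) :=
    (hK.mul (hVg.comp measurable_snd)).integral_right
      (K := fun x z => walkKer μ W χ j x z * ∫ y, (W z y - U z y) * g y ∂μ) μ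
  have hB : BddMeas (fun x => ∫ z, (walkKer μ W χ j x z - walkKer μ U χ j x z) *
      ∫ y, U z y * g y ∂μ ∂μ) :=
    ((hK.sub hL).mul (hUg.comp measurable_snd)).integral_right
      (K := fun x z => (walkKer μ W χ j x z - walkKer μ U χ j x z) * ∫ y, U z y * g y ∂μ) μ
  have hUgC : ∀ z, |∫ y, U z y * g y ∂μ| ≤ C := fun z => by
    refine (abs_integral_le_integral_abs).trans ?_
    calc ∫ y, |U z y * g y| ∂μ ≤ ∫ _y, C ∂μ := by
          refine BddMeas.integral_mono ((hU.left z).mul hgb).abs (BddMeas.const _) fun y => ?_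
          rw [abs_mul, abs_of_nonneg (hU0 z y)]
          exact (mul_le_of_le_one_right (hU0 z y) (hg1 y)).trans (hUC z y)
      _ = C := by simp
  have h1 := integral_abs_comp_apply_le hK (walkKer_nonneg hW0 hχ j) (hW.sub hU) hε he hVe hg hg1 hm
  have h2 := hη.scale hC hUg.measurable hUgC
  simp only [split]
  calc _ ≤ ∫ x, (|∫ z, walkKer μ W χ j x z * ∫ y, (W z y - U z y) * g y ∂μ ∂μ| +
        |∫ z, (walkKer μ W χ j x z - walkKer μ U χ j x z) * ∫ y, U z y * g y ∂μ ∂μ|) ∂μ :=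
        BddMeas.integral_mono (hA.add hB).abs (hA.abs.add hB.abs) fun x => abs_add_le _ _
    _ ≤ _ := by
        rw [integral_add (hA.abs.integrable μ) (hB.abs.integrable μ)]
        linarith

lemma integral_abs_walkKer_sub_le {C ε η : ℝ} (hC : 0 < C)
    (hW : BddMeas (fun q : Ω × Ω => W q.1 q.2)) (hW0 : ∀ x y, 0 ≤ W x y)
    (hWs : ∀ x y, W x y = W y x)
    (hU : BddMeas (fun q : Ω × Ω => U q.1 q.2)) (hU0 : ∀ x y, 0 ≤ U x y)
    (hUs : ∀ x y, U x y = U y x) (hUC : ∀ x y, U x y ≤ C) (hχ : IsWeight χ)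
    (hε : OpSmall μ (fun x y => W x y - U x y) ε)
    {e : Ω → ℝ} (he : BddMeas e) (hVe : ∀ z, ∫ y, |W z y - U z y| ∂μ ≤ e z) (j : ℕ)
    (hη : OpSmall μ (fun x y => walkKer μ W χ j x y - walkKer μ U χ j x y) η)
    {m : ℝ} (hm : 0 < m) :
    ∫ x, ∫ y, |walkKer μ W χ (j + 1) x y - walkKer μ U χ (j + 1) x y| ∂μ ∂μ ≤
      C * η + (m ^ 2 * ε +
        (∫ x, ∫ z, walkKer μ W χ j x z ^ 2 ∂μ ∂μ + ∫ z, e z ^ 4 ∂μ) / m) := by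
  have hK := walkKer_bddMeas (μ := μ) hW hχ j
  have hL := walkKer_bddMeas (μ := μ) hU hχ j
  set A : Ω → Ω → ℝ := fun x y => ∫ z, walkKer μ W χ j x z * (W z y - U z y) ∂μ with hA
  set B : Ω → Ω → ℝ := fun x y => ∫ z, (walkKer μ W χ j x z - walkKer μ U χ j x z) * U z y ∂μ
    with hB
  have hAm : BddMeas (fun q : Ω × Ω => A q.1 q.2) :=
    BddMeas.integral_right (K := fun (q : Ω × Ω) z => walkKer μ W χ j q.1 z * (W z q.2 - U z q.2))
      ((hK.comp₂ (by fun_prop) (by fun_prop)).mul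
        ((hW.sub hU).comp₂ (K := fun a b => W a b - U a b) (by fun_prop) (by fun_prop))) μ
  have hBm : BddMeas (fun q : Ω × Ω => B q.1 q.2) :=
    BddMeas.integral_right
      (K := fun (q : Ω × Ω) z => (walkKer μ W χ j q.1 z - walkKer μ U χ j q.1 z) * U z q.2)
      (((hK.sub hL).comp₂ (K := fun a b => walkKer μ W χ j a b - walkKer μ U χ j a b)
        (by fun_prop) (by fun_prop)).mul (hU.comp₂ (by fun_prop) (by fun_prop))) μ
  have hpt : ∀ x y, |walkKer μ W χ (j + 1) x y - walkKer μ U χ (j + 1) x y| ≤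
      |A x y| + |B x y| := by
    intro x y
    have : walkKer μ W χ (j + 1) x y - walkKer μ U χ (j + 1) x y =
        (A x y + B x y) * χ (j + 2) y := by
      simp only [walkKer, hA, hB, ← sub_mul]
      congr 1
      rw [← integral_sub (((hK.left x).mul (hW.right y)).integrable μ)
        (((hL.left x).mul (hU.right y)).integrable μ),
        ← integral_add (((hK.left x).mul ((hW.right y).sub (hU.right y))).integrable μ)
        ((((hK.left x).sub (hL.left x)).mul (hU.right y)).integrable μ)]
      refine integral_congr_ae (Eventually.of_forall fun z => ?_)
      simp only; ring
    rw [this, abs_mul]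
    exact (mul_le_of_le_one_right (abs_nonneg _) (hχ.abs_le _ _)).trans (abs_add_le _ _)
  have hε' : OpSmall μ (fun x y => (fun z w => W z w - U z w) y x) ε := by
    simpa only [hWs _, hUs _, OpSmall, fun x y => hWs y x, fun x y => hUs y x] using hε
  have hA1 : ∀ x, ∫ y, |A x y| ∂μ ≤ m ^ 2 * ε +
      (∫ z, walkKer μ W χ j x z ^ 2 ∂μ + ∫ z, e z ^ 4 ∂μ) * m⁻¹ := fun x => by
    rw [← div_eq_mul_inv]
    exact integral_abs_apply_le (hW.sub hU) hε' he hVe (hK.left x) (walkKer_nonneg hW0 hχ j x) hm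
  have hK2 : BddMeas (fun x => ∫ z, walkKer μ W χ j x z ^ 2 ∂μ) :=
    (hK.pow 2).integral_right (K := fun x z => walkKer μ W χ j x z ^ 2) μ
  have hA2 : ∫ x, ∫ y, |A x y| ∂μ ∂μ ≤ m ^ 2 * ε +
      (∫ x, ∫ z, walkKer μ W χ j x z ^ 2 ∂μ ∂μ + ∫ z, e z ^ 4 ∂μ) / m := by
    have hb := (hK2.add (BddMeas.const (∫ z, e z ^ 4 ∂μ))).mul (BddMeas.const m⁻¹)
    refine (BddMeas.integral_mono (hAm.abs.integral_right (K := fun x y => |A x y|) μ)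
      ((BddMeas.const _).add hb) hA1).trans (le_of_eq ?_)
    rw [integral_add ((BddMeas.const _).integrable μ) (hb.integrable μ), integral_const, integral_mul_const,
      integral_add (hK2.integrable μ) ((BddMeas.const _).integrable μ)]
    simp [div_eq_mul_inv]
  have hB2 : ∫ x, ∫ y, |B x y| ∂μ ∂μ ≤ C * η := by
    rw [hBm.abs.integral_swap (K := fun x y => |B x y|)]
    calc ∫ y, ∫ x, |B x y| ∂μ ∂μ ≤ ∫ _y, C * η ∂μ := by
          refine BddMeas.integral_mono
            ((hBm.abs.swap (K := fun x y => |B x y|)).integral_right (K := fun y x => |B x y|) μ) (BddMeas.const _) fun y => ?_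
          exact hη.scale hC (hU.right y).measurable (fun z => by
            rw [abs_of_nonneg (hU0 _ _)]; exact hUC _ _)
      _ = C * η := by simp
  have hd := ((walkKer_bddMeas (μ := μ) hW hχ (j + 1)).sub (walkKer_bddMeas (μ := μ) hU hχ (j + 1))).abs
  calc ∫ x, ∫ y, |walkKer μ W χ (j + 1) x y - walkKer μ U χ (j + 1) x y| ∂μ ∂μ
      ≤ ∫ x, (∫ y, |A x y| ∂μ + ∫ y, |B x y| ∂μ) ∂μ := by
        refine BddMeas.integral_mono (hd.integral_right
          (K := fun x y => |walkKer μ W χ (j + 1) x y - walkKer μ U χ (j + 1) x y|) μ)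
          ((hAm.abs.integral_right (K := fun x y => |A x y|) μ).add
            (hBm.abs.integral_right (K := fun x y => |B x y|) μ)) fun x => ?_
        rw [← integral_add ((hAm.left x).abs.integrable μ) ((hBm.left x).abs.integrable μ)]
        exact BddMeas.integral_mono
          (hd.left (K := fun x y => |walkKer μ W χ (j + 1) x y - walkKer μ U χ (j + 1) x y|) x)
          ((hAm.left x).abs.add (hBm.left x).abs) (hpt x)
    _ = ∫ x, ∫ y, |A x y| ∂μ ∂μ + ∫ x, ∫ y, |B x y| ∂μ ∂μ :=
        integral_add ((hAm.abs.integral_right (K := fun x y => |A x y|) μ).integrable μ)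
          ((hBm.abs.integral_right (K := fun x y => |B x y|) μ).integrable μ)
    _ ≤ _ := by linarith

end WalkKernels

section Moments

variable {Ω : Type*} [MeasurableSpace Ω] {μ : Measure Ω} [IsProbabilityMeasure μ]

lemma tangent_pow_le {a s : ℝ} (ha : 0 ≤ a) (hs : 0 ≤ s) (k : ℕ) :
    (k + 1) * s ^ k * a ≤ a ^ (k + 1) + k * s ^ (k + 1) := by
  induction k with
  | zero => simp
  | succ k ih =>
    have h1 : 0 ≤ (a - s) * (a ^ (k + 1) - s ^ (k + 1)) := by
      rcases le_total s a with h | h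
      · exact mul_nonneg (by linarith) (by linarith [pow_le_pow_left₀ hs h (k + 1)])
      · exact mul_nonneg_of_nonpos_of_nonpos (by linarith)
          (by linarith [pow_le_pow_left₀ ha h (k + 1)])
    have h2 := mul_le_mul_of_nonneg_right ih hs
    push_cast
    simp only [pow_succ] at *
    nlinarith

/-- Jensen's inequality for powers, with respect to the finite measure of density `w`. -/
lemma pow_integral_mul_le {a w : Ω → ℝ} (ha : BddMeas a) (ha0 : ∀ z, 0 ≤ a z) (hw : BddMeas w)
    (hw0 : ∀ z, 0 ≤ w z) (k : ℕ) :
    (∫ z, a z * w z ∂μ) ^ (k + 1) ≤ (∫ z, w z ∂μ) ^ k * ∫ z, a z ^ (k + 1) * w z ∂μ := by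
  have hD0 : 0 ≤ ∫ z, w z ∂μ := integral_nonneg hw0
  have hA0 : 0 ≤ ∫ z, a z * w z ∂μ := integral_nonneg fun z => mul_nonneg (ha0 z) (hw0 z)
  have hP0 : 0 ≤ ∫ z, a z ^ (k + 1) * w z ∂μ :=
    integral_nonneg fun z => mul_nonneg (pow_nonneg (ha0 z) _) (hw0 z)
  rcases hD0.eq_or_lt with hD | hD
  · obtain ⟨B, hB⟩ := ha.bdd
    have h1 : ∫ z, a z * w z ∂μ ≤ ∫ z, B * w z ∂μ :=
      BddMeas.integral_mono (ha.mul hw) ((BddMeas.const B).mul hw) fun z =>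
        mul_le_mul_of_nonneg_right ((le_abs_self _).trans (hB z)) (hw0 z)
    rw [integral_const_mul, ← hD, mul_zero] at h1
    rw [le_antisymm h1 hA0, zero_pow (Nat.succ_ne_zero k)]
    exact mul_nonneg (pow_nonneg hD0 k) hP0
  · set D := ∫ z, w z ∂μ
    set A := ∫ z, a z * w z ∂μ
    have hs : 0 ≤ A / D := div_nonneg hA0 hD0
    have h1 : ∫ z, (k + 1) * (A / D) ^ k * (a z * w z) ∂μ ≤
        ∫ z, (a z ^ (k + 1) * w z + k * (A / D) ^ (k + 1) * w z) ∂μ := by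
      refine BddMeas.integral_mono ((BddMeas.const _).mul (ha.mul hw))
        (((ha.pow _).mul hw).add ((BddMeas.const _).mul hw)) fun z => ?_
      have := mul_le_mul_of_nonneg_right (tangent_pow_le (ha0 z) hs k) (hw0 z)
      linarith
    rw [integral_add (((ha.pow _).mul hw).integrable μ) (((BddMeas.const _).mul hw).integrable μ),
      integral_const_mul, integral_const_mul] at h1
    have hAD : A = A / D * D := by field_simp
    have h2 : (A / D) ^ (k + 1) * D ≤ ∫ z, a z ^ (k + 1) * w z ∂μ := by
      have h3 : (k + 1) * (A / D) ^ k * A = (k + 1) * ((A / D) ^ (k + 1) * D) := by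
        calc (k + 1) * (A / D) ^ k * A = (k + 1) * (A / D) ^ k * (A / D * D) := by rw [← hAD]
          _ = _ := by ring
      change (k + 1) * (A / D) ^ k * A ≤ _ + k * (A / D) ^ (k + 1) * D at h1
      rw [h3] at h1
      linarith
    calc A ^ (k + 1) = D ^ k * ((A / D) ^ (k + 1) * D) := by
          conv_lhs => rw [hAD]
          rw [mul_pow]; ring
      _ ≤ _ := mul_le_mul_of_nonneg_left h2 (by positivity)

lemma integral_pow_apply_le {W : Ω → Ω → ℝ} (hW : BddMeas (fun q : Ω × Ω => W q.1 q.2))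
    (hW0 : ∀ x y, 0 ≤ W x y) (hWs : ∀ x y, W x y = W y x) {a : Ω → ℝ} (ha : BddMeas a)
    (ha0 : ∀ z, 0 ≤ a z) (k : ℕ) :
    ∫ y, (∫ z, a z * W z y ∂μ) ^ (k + 1) ∂μ ≤
      ∫ y, (∫ z, W z y ∂μ) ^ (2 * k + 1) ∂μ +
        (∫ z, a z ^ (4 * k + 4) ∂μ + ∫ y, (∫ z, W z y ∂μ) ^ 2 ∂μ) := by
  set d : Ω → ℝ := fun y => ∫ z, W z y ∂μ with hd
  have hdm : BddMeas d := hW.swap.integral_right (K := fun y z => W z y) μ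
  have hd0 : ∀ y, 0 ≤ d y := fun y => integral_nonneg fun z => hW0 z y
  have hd' : ∀ z, ∫ y, W z y ∂μ = d z := fun z => by simp only [hd, hWs z]
  have hb1 : BddMeas (fun q : Ω × Ω => d q.1 ^ (2 * k) * W q.2 q.1) :=
    ((hdm.pow _).comp measurable_fst).mul hW.swap
  have hb2 : BddMeas (fun q : Ω × Ω => a q.2 ^ (2 * k + 2) * W q.2 q.1) :=
    ((ha.pow _).comp measurable_snd).mul hW.swap
  have hb3 : BddMeas (fun q : Ω × Ω => a q.2 * W q.2 q.1) :=
    (ha.comp measurable_snd).mul hW.swap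
  have i1 := hb1.integral_right (K := fun y z => d y ^ (2 * k) * W z y) μ
  have i2 := hb2.integral_right (K := fun y z => a z ^ (2 * k + 2) * W z y) μ
  calc ∫ y, (∫ z, a z * W z y ∂μ) ^ (k + 1) ∂μ
      ≤ ∫ y, (∫ z, d y ^ (2 * k) * W z y ∂μ + ∫ z, a z ^ (2 * k + 2) * W z y ∂μ) ∂μ := by
        refine BddMeas.integral_mono ((hb3.integral_right (K := fun y z => a z * W z y) μ).pow _)
          (i1.add i2) fun y => ?_
        refine (pow_integral_mul_le ha ha0 (hW.right y) (fun z => hW0 z y) k).trans ?_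
        rw [← integral_const_mul, ← integral_add
          (((BddMeas.const _).mul (hW.right y)).integrable μ)
          (((ha.pow _).mul (hW.right y)).integrable μ)]
        refine BddMeas.integral_mono ((BddMeas.const _).mul ((ha.pow _).mul (hW.right y)))
          (((BddMeas.const _).mul (hW.right y)).add ((ha.pow _).mul (hW.right y))) fun z => ?_
        have h1 : d y ^ k * a z ^ (k + 1) ≤ d y ^ (2 * k) + a z ^ (2 * k + 2) := by
          have e1 : d y ^ (2 * k) = (d y ^ k) ^ 2 := by rw [← pow_mul, mul_comm]
          have e2 : a z ^ (2 * k + 2) = (a z ^ (k + 1)) ^ 2 := by rw [← pow_mul]; ring_nf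
          rw [e1, e2]
          nlinarith [sq_nonneg (d y ^ k - a z ^ (k + 1)), sq_nonneg (d y ^ k),
            sq_nonneg (a z ^ (k + 1))]
        have := mul_le_mul_of_nonneg_right h1 (hW0 z y)
        calc _ = d y ^ k * a z ^ (k + 1) * W z y := by ring
          _ ≤ _ := this
          _ = _ := by ring
    _ = ∫ y, d y ^ (2 * k + 1) ∂μ + ∫ z, a z ^ (2 * k + 2) * d z ∂μ := by
        rw [integral_add (i1.integrable μ) (i2.integrable μ),
          hb2.integral_swap (K := fun y z => a z ^ (2 * k + 2) * W z y)]
        simp only [integral_const_mul, hd', pow_succ]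
        rfl
    _ ≤ _ := by
        gcongr
        rw [← integral_add ((ha.pow _).integrable μ) ((hdm.pow _).integrable μ)]
        refine BddMeas.integral_mono ((ha.pow _).mul hdm) ((ha.pow _).add (hdm.pow _)) fun z => ?_
        have e2 : a z ^ (4 * k + 4) = (a z ^ (2 * k + 2)) ^ 2 := by rw [← pow_mul]; ring_nf
        rw [e2]
        nlinarith [sq_nonneg (a z ^ (2 * k + 2) - d z), sq_nonneg (a z ^ (2 * k + 2)),
          sq_nonneg (d z)]

variable {ι : Type*} {l : Filter ι} {W U : ι → Ω → Ω → ℝ} {χ : ι → ℕ → Ω → ℝ}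

lemma walkKer_column_moments (hW : ∀ n, BddMeas (fun q : Ω × Ω => W n q.1 q.2))
    (hW0 : ∀ n x y, 0 ≤ W n x y) (hWs : ∀ n x y, W n x y = W n y x)
    (hχ : ∀ n, IsWeight (χ n))
    (hd : ∀ k : ℕ, ∃ B : ℝ, ∀ᶠ n in l, ∫ y, (∫ z, W n z y ∂μ) ^ k ∂μ ≤ B) (j k : ℕ) :
    ∃ B : ℝ, ∀ᶠ n in l, ∫ y, (∫ x, walkKer μ (W n) (χ n) j x y ∂μ) ^ (k + 1) ∂μ ≤ B := by
  have hK : ∀ n j, BddMeas (fun q : Ω × Ω => walkKer μ (W n) (χ n) j q.2 q.1) :=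
    fun n j => (walkKer_bddMeas (μ := μ) (hW n) (hχ n) j).swap
  have ha : ∀ n j, BddMeas (fun y => ∫ x, walkKer μ (W n) (χ n) j x y ∂μ) :=
    fun n j => (hK n j).integral_right (K := fun y x => walkKer μ (W n) (χ n) j x y) μ
  have ha0 : ∀ n j y, 0 ≤ ∫ x, walkKer μ (W n) (χ n) j x y ∂μ :=
    fun n j y => integral_nonneg fun x => walkKer_nonneg (hW0 n) (hχ n) j x y
  induction j generalizing k with
  | zero =>
    obtain ⟨B, hB⟩ := hd (k + 1)
    refine ⟨B, hB.mono fun n hn => le_trans ?_ hn⟩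
    refine BddMeas.integral_mono ((ha n 0).pow _)
      (((hW n).swap.integral_right (K := fun y z => W n z y) μ).pow _) fun y => ?_
    refine pow_le_pow_left₀ (ha0 n 0 y) ?_ _
    refine BddMeas.integral_mono ((walkKer_bddMeas (μ := μ) (hW n) (hχ n) 0).right y)
      ((hW n).right y) fun x => ?_
    have h1 : χ n 0 x * W n x y ≤ W n x y :=
      mul_le_of_le_one_left (hW0 n _ _) ((hχ n).le_one _ _)
    exact (mul_le_of_le_one_right (mul_nonneg ((hχ n).nonneg _ _) (hW0 n _ _))
      ((hχ n).le_one _ _)).trans h1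
  | succ j ih =>
    obtain ⟨B₁, h₁⟩ := hd (2 * k + 1)
    obtain ⟨B₂, h₂⟩ := ih (4 * k + 3)
    obtain ⟨B₃, h₃⟩ := hd 2
    refine ⟨B₁ + (B₂ + B₃), ?_⟩
    filter_upwards [h₁, h₂, h₃] with n h₁ h₂ h₃
    refine le_trans ?_ ((integral_pow_apply_le (hW n) (hW0 n) (hWs n) (ha n j) (ha0 n j) k).trans
      (add_le_add h₁ (add_le_add h₂ h₃)))
    have hb : BddMeas (fun q : Ω × Ω => (∫ x, walkKer μ (W n) (χ n) j x q.2 ∂μ) * W n q.2 q.1) :=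
      ((ha n j).comp measurable_snd).mul (hW n).swap
    refine BddMeas.integral_mono ((ha n (j + 1)).pow _) ((hb.integral_right
      (K := fun y z => (∫ x, walkKer μ (W n) (χ n) j x z ∂μ) * W n z y) μ).pow _) fun y => ?_
    refine pow_le_pow_left₀ (ha0 n (j + 1) y) ?_ _
    have hb' : BddMeas (fun q : Ω × Ω => walkKer μ (W n) (χ n) j q.1 q.2 * W n q.2 y) :=
      (walkKer_bddMeas (hW n) (hχ n) j).mul (((hW n).right y).comp measurable_snd)
    calc ∫ x, walkKer μ (W n) (χ n) (j + 1) x y ∂μ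
        ≤ ∫ x, ∫ z, walkKer μ (W n) (χ n) j x z * W n z y ∂μ ∂μ := by
          refine BddMeas.integral_mono ((walkKer_bddMeas (μ := μ) (hW n) (hχ n) (j + 1)).right y)
            (hb'.integral_right (K := fun x z => walkKer μ (W n) (χ n) j x z * W n z y) μ)
            fun x => ?_
          exact mul_le_of_le_one_right (integral_nonneg fun z =>
            mul_nonneg (walkKer_nonneg (hW0 n) (hχ n) _ _ _) (hW0 n _ _)) ((hχ n).le_one _ _)
      _ = _ := by
          rw [hb'.integral_swap (K := fun x z => walkKer μ (W n) (χ n) j x z * W n z y)]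
          simp only [integral_mul_const]

lemma exists_truncation_parameters {C δ B : ℝ} (hC : 0 < C) (hδ : 0 < δ) :
    ∃ m > 0, ∃ ε > 0, ∃ η > 0, ∀ X ≤ B, C * η + (m ^ 2 * ε + X / m) ≤ δ := by
  have hB : 0 < |B| + 1 := by positivity
  refine ⟨3 * (|B| + 1) / δ, by positivity, δ / 3 / (3 * (|B| + 1) / δ) ^ 2, by positivity,
    δ / 3 / C, by positivity, fun X hX => ?_⟩
  have h1 : C * (δ / 3 / C) = δ / 3 := by field_simp
  have h2 : (3 * (|B| + 1) / δ) ^ 2 * (δ / 3 / (3 * (|B| + 1) / δ) ^ 2) = δ / 3 := by field_simp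
  have h3 : X / (3 * (|B| + 1) / δ) ≤ δ / 3 := by
    rw [div_le_iff₀ (by positivity)]
    have : δ / 3 * (3 * (|B| + 1) / δ) = |B| + 1 := by field_simp
    rw [this]
    linarith [le_abs_self B]
  linarith

lemma integral_abs_sub_le_degree {C : ℝ} {W U : Ω → Ω → ℝ}
    (hW : BddMeas (fun q : Ω × Ω => W q.1 q.2)) (hW0 : ∀ x y, 0 ≤ W x y)
    (hWs : ∀ x y, W x y = W y x) (hU : BddMeas (fun q : Ω × Ω => U q.1 q.2))
    (hU0 : ∀ x y, 0 ≤ U x y) (hUC : ∀ x y, U x y ≤ C) (z : Ω) :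
    ∫ y, |W z y - U z y| ∂μ ≤ ∫ w, W w z ∂μ + C := by
  calc ∫ y, |W z y - U z y| ∂μ ≤ ∫ y, (W y z + C) ∂μ := by
        refine BddMeas.integral_mono ((hW.left z).sub (hU.left z)).abs
          ((hW.right z).add (BddMeas.const C)) fun y => ?_
        rw [abs_le, hWs y z]
        constructor <;> linarith [hW0 z y, hU0 z y, hUC z y]
    _ = _ := by
        rw [integral_add ((hW.right z).integrable μ) ((BddMeas.const C).integrable μ)]
        simp

lemma degree_fourth_moment {C : ℝ} (hC : 0 < C)
    (hW : ∀ n, BddMeas (fun q : Ω × Ω => W n q.1 q.2)) (hW0 : ∀ n x y, 0 ≤ W n x y)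
    (hd : ∀ k : ℕ, ∃ B : ℝ, ∀ᶠ n in l, ∫ y, (∫ z, W n z y ∂μ) ^ k ∂μ ≤ B) :
    ∃ B : ℝ, ∀ᶠ n in l, ∫ y, (∫ z, W n z y ∂μ + C) ^ 4 ∂μ ≤ B := by
  obtain ⟨B, hB⟩ := hd 4
  refine ⟨8 * (B + C ^ 4), hB.mono fun n hn => ?_⟩
  have hdm : BddMeas (fun y => ∫ z, W n z y ∂μ) :=
    (hW n).swap.integral_right (K := fun y z => W n z y) μ
  calc ∫ y, (∫ z, W n z y ∂μ + C) ^ 4 ∂μ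
      ≤ ∫ y, 8 * ((∫ z, W n z y ∂μ) ^ 4 + C ^ 4) ∂μ := by
        refine BddMeas.integral_mono ((hdm.add (BddMeas.const C)).pow 4)
          ((BddMeas.const 8).mul ((hdm.pow 4).add (BddMeas.const _))) fun y => ?_
        have := add_pow_le (integral_nonneg (μ := μ) fun z => hW0 n z y) hC.le 4
        norm_num at this ⊢; exact this
    _ = 8 * (∫ y, (∫ z, W n z y ∂μ) ^ 4 ∂μ + C ^ 4) := by
        rw [integral_const_mul, integral_add ((hdm.pow 4).integrable μ)
          ((BddMeas.const _).integrable μ)]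
        simp
    _ ≤ _ := by linarith

lemma walkKer_sub_opSmall {C : ℝ} (hC : 0 < C)
    (hW : ∀ n, BddMeas (fun q : Ω × Ω => W n q.1 q.2)) (hW0 : ∀ n x y, 0 ≤ W n x y)
    (hWs : ∀ n x y, W n x y = W n y x) (hU : ∀ n, BddMeas (fun q : Ω × Ω => U n q.1 q.2))
    (hU0 : ∀ n x y, 0 ≤ U n x y) (hUC : ∀ n x y, U n x y ≤ C)
    (hχ : ∀ n, IsWeight (χ n))
    (hd : ∀ k : ℕ, ∃ B : ℝ, ∀ᶠ n in l, ∫ y, (∫ z, W n z y ∂μ) ^ k ∂μ ≤ B)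
    (hop : ∀ δ > 0, ∀ᶠ n in l, OpSmall μ (fun x y => W n x y - U n x y) δ) (j : ℕ) :
    ∀ δ > 0, ∀ᶠ n in l, OpSmall μ
      (fun x y => walkKer μ (W n) (χ n) j x y - walkKer μ (U n) (χ n) j x y) δ := by
  induction j with
  | zero =>
    intro δ hδ
    filter_upwards [hop δ hδ] with n hn
    refine walkKer_sub_small_zero hn (fun h hh hh1 => ?_) (hχ n)
    exact (((hW n).sub (hU n)).mul ((BddMeas.of_bound hh 1 hh1).comp measurable_snd)).integral_right
      (K := fun x y => (W n x y - U n x y) * h y) μ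
  | succ j ih =>
    intro δ hδ
    obtain ⟨B₁, h₁⟩ := walkKer_column_moments hW hW0 hWs hχ hd j 1
    obtain ⟨B₂, h₂⟩ := degree_fourth_moment hC hW hW0 hd
    obtain ⟨m, hm, ε, hε, η, hη, hX⟩ := exists_truncation_parameters (B := B₁ + B₂) hC hδ
    filter_upwards [h₁, h₂, hop ε hε, ih η hη] with n h₁ h₂ hop ih
    have := walkKer_sub_small_succ hC (hW n) (hW0 n) (hU n) (hU0 n) (hUC n) (hχ n) hop
      (((hW n).swap.integral_right (K := fun y z => W n z y) μ).add (BddMeas.const C))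
      (integral_abs_sub_le_degree (hW n) (hW0 n) (hWs n) (hU n) (hU0 n) (hUC n)) j ih hm
    exact fun h hh hh1 => (this h hh hh1).trans (hX _ (add_le_add h₁ h₂))

/-- `L¹`-closeness of the walk kernels of two kernels that are close in cut norm. -/
lemma walkKer_sub_integral_small {C : ℝ} (hC : 0 < C)
    (hW : ∀ n, BddMeas (fun q : Ω × Ω => W n q.1 q.2)) (hW0 : ∀ n x y, 0 ≤ W n x y)
    (hWs : ∀ n x y, W n x y = W n y x) (hU : ∀ n, BddMeas (fun q : Ω × Ω => U n q.1 q.2))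
    (hU0 : ∀ n x y, 0 ≤ U n x y) (hUs : ∀ n x y, U n x y = U n y x)
    (hUC : ∀ n x y, U n x y ≤ C) (hχ : ∀ n, IsWeight (χ n))
    (hd : ∀ k : ℕ, ∃ B : ℝ, ∀ᶠ n in l, ∫ y, (∫ z, W n z y ∂μ) ^ k ∂μ ≤ B)
    (hop : ∀ δ > 0, ∀ᶠ n in l, OpSmall μ (fun x y => W n x y - U n x y) δ) (j : ℕ)
    (h2 : ∃ B : ℝ, ∀ᶠ n in l, ∫ x, ∫ z, walkKer μ (W n) (χ n) j x z ^ 2 ∂μ ∂μ ≤ B) :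
    ∀ δ > 0, ∀ᶠ n in l, ∫ x, ∫ y, |walkKer μ (W n) (χ n) (j + 1) x y -
      walkKer μ (U n) (χ n) (j + 1) x y| ∂μ ∂μ ≤ δ := by
  intro δ hδ
  obtain ⟨B₁, h₁⟩ := h2
  obtain ⟨B₂, h₂⟩ := degree_fourth_moment hC hW hW0 hd
  obtain ⟨m, hm, ε, hε, η, hη, hX⟩ := exists_truncation_parameters (B := B₁ + B₂) hC hδ
  filter_upwards [h₁, h₂, hop ε hε,
    walkKer_sub_opSmall hC hW hW0 hWs hU hU0 hUC hχ hd hop j η hη] with n h₁ h₂ hop ih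
  exact (integral_abs_walkKer_sub_le hC (hW n) (hW0 n) (hWs n) (hU n) (hU0 n) (hUs n) (hUC n)
    (hχ n) hop (((hW n).swap.integral_right (K := fun y z => W n z y) μ).add (BddMeas.const C))
    (integral_abs_sub_le_degree (hW n) (hW0 n) (hWs n) (hU n) (hU0 n) (hUC n)) j ih hm).trans
    (hX _ (add_le_add h₁ h₂))

end Moments

section UnitInterval

/-- Lebesgue measure on `[0,1]`. -/
noncomputable abbrev unitMeasure : Measure ℝ := volume.restrict (Icc 0 1)

instance : IsProbabilityMeasure unitMeasure := ⟨by simp [unitMeasure]⟩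

section CutNorm

variable {Ω : Type*} [MeasurableSpace Ω] {μ : Measure Ω} [IsProbabilityMeasure μ]

lemma integral_abs_le_of_setIntegral {f : Ω → ℝ} (hf : BddMeas f) {ε : ℝ}
    (h : ∀ T, MeasurableSet T → |∫ y in T, f y ∂μ| ≤ ε) : ∫ y, |f y| ∂μ ≤ 2 * ε := by
  have hT : MeasurableSet {y | 0 ≤ f y} := measurableSet_le measurable_const hf.measurable
  have h1 : ∫ y in {y | 0 ≤ f y}, |f y| ∂μ = ∫ y in {y | 0 ≤ f y}, f y ∂μ :=
    setIntegral_congr_fun hT fun y hy => abs_of_nonneg hy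
  have h2 : ∫ y in {y | 0 ≤ f y}ᶜ, |f y| ∂μ = - ∫ y in {y | 0 ≤ f y}ᶜ, f y ∂μ := by
    rw [← integral_neg]
    exact setIntegral_congr_fun hT.compl fun y hy => abs_of_neg (not_le.1 hy)
  rw [← integral_add_compl hT (hf.abs.integrable μ), h1, h2]
  linarith [le_abs_self (∫ y in {y | 0 ≤ f y}, f y ∂μ),
    neg_abs_le (∫ y in {y | 0 ≤ f y}ᶜ, f y ∂μ), h _ hT, h _ hT.compl]

lemma opSmall_of_setIntegral {V : Ω → Ω → ℝ} (hV : BddMeas (fun q : Ω × Ω => V q.1 q.2)) {ε : ℝ}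
    (h : ∀ S T, MeasurableSet S → MeasurableSet T → |∫ x in S, ∫ y in T, V x y ∂μ ∂μ| ≤ ε) :
    OpSmall μ V (4 * ε) := by
  intro g hg hg1
  have hgb : BddMeas g := ⟨hg, 1, hg1⟩
  have hVg : BddMeas (fun q : Ω × Ω => V q.1 q.2 * g q.2) := hV.mul (hgb.comp measurable_snd)
  have key := integral_abs_le_of_setIntegral (μ := μ) (ε := 2 * ε)
    (hVg.integral_right (K := fun x y => V x y * g y) μ) fun S hS => by
      have hφ : BddMeas (fun y => ∫ x in S, V x y ∂μ) :=
        hV.swap.integral_right (K := fun y x => V x y) _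
      rw [hVg.integral_swap (K := fun x y => V x y * g y)]
      simp only [integral_mul_const]
      refine abs_integral_le_integral_abs.trans ((BddMeas.integral_mono (hφ.mul hgb).abs hφ.abs
        fun y => ?_).trans (integral_abs_le_of_setIntegral hφ fun T hT => ?_))
      · rw [abs_mul]
        exact mul_le_of_le_one_right (abs_nonneg _) (hg1 y)
      · rw [← hV.integral_swap]
        exact h S T hS hT
  linarith

end CutNorm

lemma setIntegral_prod_unit {K : ℝ → ℝ → ℝ} (hK : BddMeas (fun q : ℝ × ℝ => K q.1 q.2))
    {S T : Set ℝ} (hS : MeasurableSet S) (hT : MeasurableSet T) :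
    ∫ q in (S ∩ Icc 0 1) ×ˢ (T ∩ Icc 0 1), K q.1 q.2 =
      ∫ x in S, ∫ y in T, K x y ∂unitMeasure ∂unitMeasure := by
  rw [Measure.volume_eq_prod, ← Measure.prod_restrict, ← Measure.restrict_restrict hS,
    ← Measure.restrict_restrict hT, integral_prod _ (hK.integrable _)]

lemma abs_setIntegral_le_cutNorm {K : ℝ → ℝ → ℝ} (hK : BddMeas (fun q : ℝ × ℝ => K q.1 q.2))
    {S T : Set ℝ} (hS : MeasurableSet S) (hT : MeasurableSet T) :
    |∫ x in S, ∫ y in T, K x y ∂unitMeasure ∂unitMeasure| ≤ cutNorm K := by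
  rw [← setIntegral_prod_unit hK hS hT]
  obtain ⟨B, hB⟩ := hK.bdd
  refine le_csSup ⟨B, ?_⟩ ⟨S ∩ Icc 0 1, T ∩ Icc 0 1, hS.inter measurableSet_Icc,
    hT.inter measurableSet_Icc, inter_subset_right, inter_subset_right, rfl⟩
  rintro r ⟨S, T, hS, hT, hS1, hT1, rfl⟩
  have e1 : S ∩ Icc 0 1 = S := inter_eq_left.2 hS1
  have e2 : T ∩ Icc 0 1 = T := inter_eq_left.2 hT1
  have hvol : volume (S ×ˢ T) ≤ 1 := by
    rw [Measure.volume_eq_prod, Measure.prod_prod]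
    have h1 : volume S ≤ 1 := (measure_mono hS1).trans (by simp)
    have h2 : volume T ≤ 1 := (measure_mono hT1).trans (by simp)
    exact mul_le_one' h1 h2
  have := norm_setIntegral_le_of_norm_le_const (μ := volume) (s := S ×ˢ T)
    (f := fun q : ℝ × ℝ => K q.1 q.2) (C := B) (hvol.trans_lt ENNReal.one_lt_top)
    (fun q _ => by simpa using hB q)
  refine this.trans ?_
  have hB0 : 0 ≤ B := (abs_nonneg _).trans (hB (0, 0))
  refine mul_le_of_le_one_right hB0 ?_
  exact ENNReal.toReal_le_of_le_ofReal zero_le_one (by simpa using hvol)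

/-- The vertex of a graph on `Fin n` corresponding to a point of `[0,1]`. -/
noncomputable def idxFin (n : ℕ) [NeZero n] (x : ℝ) : Fin n :=
  ⟨min (idx n x) (n - 1), by have := NeZero.pos n; omega⟩

variable {n : ℕ} [NeZero n]

lemma measurable_idx (n : ℕ) : Measurable (idx n) :=
  (measurable_from_top (f := fun k : ℕ => k - 1)).comp
    (Nat.measurable_ceil.comp (measurable_id.mul_const _))

lemma measurable_idxFin : Measurable (idxFin n) := by
  refine measurable_to_countable' fun i => ?_
  have : idxFin n ⁻¹' {i} = (fun x => min (idx n x) (n - 1)) ⁻¹' {(i : ℕ)} := by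
    ext x; simp [idxFin, Fin.ext_iff]
  rw [this]
  exact ((measurable_from_top (f := fun k : ℕ => min k (n - 1))).comp (measurable_idx n))
    (measurableSet_singleton _)

lemma idx_lt_of_mem {x : ℝ} (hx : x ∈ Ioc (0:ℝ) 1) : idx n x < n := by
  have h1 : ⌈x * n⌉₊ ≤ n := by
    rw [Nat.ceil_le]
    exact mul_le_of_le_one_left (Nat.cast_nonneg n) hx.2
  have := NeZero.pos n
  unfold idx
  omega

lemma idxFin_eq_iff {x : ℝ} (hx : x ∈ Ioc (0:ℝ) 1) (i : Fin n) :
    idxFin n x = i ↔ x ∈ Ioc ((i : ℝ) / n) (((i : ℝ) + 1) / n) := by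
  have hn : (0:ℝ) < n := by exact_mod_cast NeZero.pos n
  have h0 : 0 < ⌈x * n⌉₊ := Nat.ceil_pos.2 (mul_pos hx.1 hn)
  have h1 := idx_lt_of_mem (n := n) hx
  have h2 : idxFin n x = i ↔ ⌈x * n⌉₊ = (i : ℕ) + 1 := by
    simp only [idxFin, Fin.ext_iff]
    unfold idx at *
    omega
  rw [h2, Nat.ceil_eq_iff (Nat.succ_ne_zero _), mem_Ioc, div_lt_iff₀ hn, le_div_iff₀ hn]
  push_cast
  simp

lemma unit_ae_mem_Ioc : ∀ᵐ x ∂unitMeasure, x ∈ Ioc (0:ℝ) 1 := by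
  have : unitMeasure = volume.restrict (Ioc (0:ℝ) 1) := (restrict_Ioc_eq_restrict_Icc).symm
  rw [this]
  exact ae_restrict_mem measurableSet_Ioc

/-- The uniform probability measure on `Fin n`. -/
noncomputable def uniformFin (n : ℕ) : Measure (Fin n) := (n : ℝ≥0∞)⁻¹ • Measure.count

lemma uniformFin_singleton (i : Fin n) : uniformFin n {i} = (n : ℝ≥0∞)⁻¹ := by
  simp [uniformFin]

instance : IsProbabilityMeasure (uniformFin n) := ⟨by
  have : (n : ℝ≥0∞) ≠ 0 := by simpa using NeZero.ne n
  simp [uniformFin, ENNReal.inv_mul_cancel this]⟩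

lemma measurePreserving_idxFin : MeasurePreserving (idxFin n) unitMeasure (uniformFin n) := by
  refine ⟨measurable_idxFin, ?_⟩
  have hn : (0:ℝ) < n := by exact_mod_cast NeZero.pos n
  refine Measure.ext_of_singleton fun i => ?_
  rw [Measure.map_apply measurable_idxFin (measurableSet_singleton _), uniformFin_singleton]
  have h1 : unitMeasure (idxFin n ⁻¹' {i}) =
      unitMeasure (Ioc ((i : ℝ) / n) (((i : ℝ) + 1) / n)) := by
    refine measure_congr ?_
    filter_upwards [unit_ae_mem_Ioc] with x hx
    exact propext (idxFin_eq_iff hx i)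
  have hi : (i : ℝ) + 1 ≤ n := by exact_mod_cast i.2
  have h2 : Ioc ((i : ℝ) / n) (((i : ℝ) + 1) / n) ∩ Icc 0 1 =
      Ioc ((i : ℝ) / n) (((i : ℝ) + 1) / n) := by
    refine inter_eq_left.2 fun x hx => ⟨?_, hx.2.trans ?_⟩
    · exact (by positivity : (0:ℝ) ≤ (i : ℝ) / n).trans hx.1.le
    · rwa [div_le_one hn]
  rw [h1, Measure.restrict_apply measurableSet_Ioc, h2, Real.volume_Ioc]
  rw [← sub_div, add_sub_cancel_left, one_div, ENNReal.ofReal_inv_of_pos hn]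
  simp

/-- Integrals of step functions are normalized sums. -/
lemma integral_pi_idxFin {ι : Type*} [Fintype ι] [DecidableEq ι] (f : (ι → Fin n) → ℝ) :
    ∫ x, f (fun i => idxFin n (x i)) ∂(Measure.pi fun _ : ι => unitMeasure) =
      (∑ φ : ι → Fin n, f φ) / (n : ℝ) ^ Fintype.card ι := by
  have hmp : MeasurePreserving (fun (x : ι → ℝ) i => idxFin n (x i))
      (Measure.pi fun _ : ι => unitMeasure) (Measure.pi fun _ : ι => uniformFin n) :=
    measurePreserving_pi (fun _ : ι => unitMeasure) (fun _ : ι => uniformFin n)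
      fun _ => measurePreserving_idxFin
  have hf : Measurable f := measurable_of_finite f
  rw [← integral_map (f := f) hmp.measurable.aemeasurable hf.aestronglyMeasurable, hmp.map_eq,
    integral_fintype (Integrable.of_finite)]
  simp only [Measure.real, Measure.pi_singleton, uniformFin_singleton, Finset.prod_const,
    Finset.card_univ, ENNReal.toReal_pow, ENNReal.toReal_inv, ENNReal.toReal_natCast, smul_eq_mul,
    ← Finset.mul_sum, inv_pow]
  rw [div_eq_inv_mul]

lemma integral_idxFin (f : Fin n → ℝ) :
    ∫ x, f (idxFin n x) ∂unitMeasure = (∑ i, f i) / n := by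
  rw [← integral_map (f := f) measurable_idxFin.aemeasurable
    (measurable_of_finite f).aestronglyMeasurable, measurePreserving_idxFin.map_eq,
    integral_fintype (Integrable.of_finite)]
  simp only [Measure.real, uniformFin_singleton, ENNReal.toReal_inv, ENNReal.toReal_natCast,
    smul_eq_mul, ← Finset.mul_sum]
  rw [div_eq_inv_mul]

lemma integral_integral_idxFin (f : Fin n → Fin n → ℝ) :
    ∫ x, ∫ y, f (idxFin n x) (idxFin n y) ∂unitMeasure ∂unitMeasure =
      (∑ i, ∑ j, f i j) / (n : ℝ) ^ 2 := by
  simp only [integral_idxFin (f _)]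
  rw [integral_idxFin (fun i => (∑ j, f i j) / n), ← Finset.sum_div, div_div, sq]

/-- The kernel of a graph as a step function on all of `ℝ`. -/
noncomputable def stepKer (p : ℝ) (G : SimpleGraph (Fin n)) (x y : ℝ) : ℝ :=
  if G.Adj (idxFin n x) (idxFin n y) then 1 / p else 0

variable {p : ℝ} {G : SimpleGraph (Fin n)}

lemma bddMeas_idxFin (f : Fin n → ℝ) : BddMeas (fun x => f (idxFin n x)) := by
  refine ⟨(measurable_of_finite f).comp measurable_idxFin, ∑ i, |f i|, fun x => ?_⟩
  exact Finset.single_le_sum (f := fun i => |f i|) (fun i _ => abs_nonneg _) (Finset.mem_univ _)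

lemma bddMeas_idxFin₂ (f : Fin n → Fin n → ℝ) :
    BddMeas (fun q : ℝ × ℝ => f (idxFin n q.1) (idxFin n q.2)) := by
  refine ⟨(measurable_of_finite (fun q : Fin n × Fin n => f q.1 q.2)).comp
    ((measurable_idxFin.comp measurable_fst).prodMk (measurable_idxFin.comp measurable_snd)),
    ∑ q : Fin n × Fin n, |f q.1 q.2|, fun q => ?_⟩
  exact Finset.single_le_sum (f := fun q : Fin n × Fin n => |f q.1 q.2|)
    (fun i _ => abs_nonneg _) (Finset.mem_univ (idxFin n q.1, idxFin n q.2))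

lemma stepKer_bddMeas : BddMeas (fun q : ℝ × ℝ => stepKer p G q.1 q.2) :=
  bddMeas_idxFin₂ fun u v => if G.Adj u v then 1 / p else 0

lemma stepKer_nonneg (hp : 0 < p) (x y : ℝ) : 0 ≤ stepKer p G x y := by
  unfold stepKer; split_ifs <;> positivity

lemma stepKer_symm (x y : ℝ) : stepKer p G x y = stepKer p G y x := by
  simp only [stepKer, G.adj_comm]

lemma graphKernel_eq_stepKer {x y : ℝ} (hx : x ∈ Ioc (0:ℝ) 1) (hy : y ∈ Ioc (0:ℝ) 1) :
    graphKernel p G x y = stepKer p G x y := by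
  have h1 := idx_lt_of_mem (n := n) hx
  have h2 := idx_lt_of_mem (n := n) hy
  have e1 : idxFin n x = ⟨idx n x, h1⟩ := by simp [idxFin]; omega
  have e2 : idxFin n y = ⟨idx n y, h2⟩ := by simp [idxFin]; omega
  simp only [graphKernel, stepKer, hx, hy, h1, h2, and_self, dite_true, e1, e2]

lemma cutNorm_graphKernel_sub (U : ℝ → ℝ → ℝ) :
    cutNorm (fun x y => graphKernel p G x y - U x y) =
      cutNorm (fun x y => stepKer p G x y - U x y) := by
  have key : ∀ S T : Set ℝ, MeasurableSet S → MeasurableSet T → S ⊆ Icc 0 1 → T ⊆ Icc 0 1 →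
      ∫ q in S ×ˢ T, (graphKernel p G q.1 q.2 - U q.1 q.2) =
        ∫ q in S ×ˢ T, (stepKer p G q.1 q.2 - U q.1 q.2) := by
    intro S T hS hT hS1 hT1
    refine integral_congr_ae ?_
    have hle : (volume : Measure (ℝ × ℝ)).restrict (S ×ˢ T) ≤ unitMeasure.prod unitMeasure := by
      rw [Measure.volume_eq_prod, unitMeasure, Measure.prod_restrict]
      exact Measure.restrict_mono (prod_mono hS1 hT1) le_rfl
    refine ae_mono hle ?_
    have h1 : ∀ᵐ q ∂(unitMeasure.prod unitMeasure), q.1 ∈ Ioc (0:ℝ) 1 :=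
      Measure.quasiMeasurePreserving_fst.ae unit_ae_mem_Ioc
    have h2 : ∀ᵐ q ∂(unitMeasure.prod unitMeasure), q.2 ∈ Ioc (0:ℝ) 1 :=
      Measure.quasiMeasurePreserving_snd.ae unit_ae_mem_Ioc
    filter_upwards [h1, h2] with q h1 h2
    rw [graphKernel_eq_stepKer h1 h2]
  unfold cutNorm
  congr 1
  ext r
  constructor
  · rintro ⟨S, T, hS, hT, hS1, hT1, rfl⟩
    exact ⟨S, T, hS, hT, hS1, hT1, by rw [key S T hS hT hS1 hT1]⟩
  · rintro ⟨S, T, hS, hT, hS1, hT1, rfl⟩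
    exact ⟨S, T, hS, hT, hS1, hT1, by rw [key S T hS hT hS1 hT1]⟩

lemma exists_rearrangement (κ : ℝ → ℝ → ℝ) (hκ : BddMeas (fun q : ℝ × ℝ => κ q.1 q.2))
    {δ : ℝ} (hδ : cutDist (graphKernel p G) κ < δ) :
    ∃ τ : ℝ → ℝ, MPBij τ ∧ ∀ S T : Set ℝ, MeasurableSet S → MeasurableSet T →
      |∫ x in S, ∫ y in T, (stepKer p G x y - κ (τ x) (τ y)) ∂unitMeasure ∂unitMeasure| ≤ δ := by
  have hne : {r | ∃ τ : ℝ → ℝ, MPBij τ ∧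
      r = cutNorm (fun x y => graphKernel p G x y - κ (τ x) (τ y))}.Nonempty :=
    ⟨_, id, ⟨MeasurePreserving.id _, bijOn_id _⟩, rfl⟩
  obtain ⟨r, ⟨τ, hτ, rfl⟩, hr⟩ := exists_lt_of_csInf_lt hne hδ
  refine ⟨τ, hτ, fun S T hS hT => ?_⟩
  rw [cutNorm_graphKernel_sub] at hr
  have hτm : Measurable τ := hτ.1.measurable
  refine (abs_setIntegral_le_cutNorm (K := fun x y => stepKer p G x y - κ (τ x) (τ y))
    (stepKer_bddMeas.sub (hκ.comp₂ (hτm.comp measurable_fst) (hτm.comp measurable_snd)))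
    hS hT).trans hr.le

end UnitInterval

section PathIntegral

/-- The `i`-th vertex of the walk from `x` to `y` with inner vertices `z`. -/
def walkVertex {α : Type*} {j : ℕ} (x : α) (z : Fin j → α) (y : α) (i : ℕ) : α :=
  if _h0 : i = 0 then x else if h : i < j + 1 then z ⟨i - 1, by omega⟩ else y

lemma walkVertex_comp {α β : Type*} (f : α → β) {j : ℕ} (x : α) (z : Fin j → α) (y : α) (i : ℕ) :
    walkVertex (f x) (fun t => f (z t)) (f y) i = f (walkVertex x z y i) := by
  unfold walkVertex; split_ifs <;> rfl

lemma walkVertex_snoc {α : Type*} {j : ℕ} (x : α) (z : Fin j → α) (z' y : α) {i : ℕ}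
    (hi : i < j + 2) :
    walkVertex x (Fin.snoc z z' : Fin (j + 1) → α) y i = walkVertex x z z' i := by
  unfold walkVertex
  by_cases h0 : i = 0
  · simp [h0]
  · by_cases h1 : i < j + 1
    · have h2 : i - 1 < j := by omega
      simp [h0, h1, hi, Fin.snoc, h2]
    · have h2 : ¬ i - 1 < j := by omega
      simp [h0, h1, hi, Fin.snoc, h2]

lemma walkVertex_last {α : Type*} {j : ℕ} (x : α) (z : Fin j → α) (y : α) :
    walkVertex x z y (j + 1) = y := by
  simp [walkVertex]

lemma walkVertex_zero {α : Type*} {j : ℕ} (x : α) (z : Fin j → α) (y : α) :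
    walkVertex x z y 0 = x := by
  simp [walkVertex]

variable {Ω : Type*} [MeasurableSpace Ω] {μ : Measure Ω} [IsProbabilityMeasure μ]

lemma measurable_walkVertex {β : Type*} [MeasurableSpace β] {j : ℕ} {x y : β → Ω}
    {z : β → Fin j → Ω} (hx : Measurable x) (hz : Measurable z) (hy : Measurable y) (i : ℕ) :
    Measurable (fun b => walkVertex (x b) (z b) (y b) i) := by
  unfold walkVertex
  split_ifs
  · exact hx
  · exact (measurable_pi_apply _).comp hz
  · exact hy

lemma integral_pi_snoc {j : ℕ} {F : (Fin (j + 1) → Ω) → ℝ} (hF : BddMeas F) :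
    ∫ z, F z ∂(Measure.pi fun _ : Fin (j + 1) => μ) =
      ∫ z', ∫ z, F (Fin.snoc z z') ∂(Measure.pi fun _ : Fin j => μ) ∂μ := by
  have hmp := (measurePreserving_piFinSuccAbove (fun _ : Fin (j + 1) => μ) (Fin.last j)).symm
  rw [← hmp.integral_comp' F, integral_prod _ ((hF.comp hmp.measurable).integrable _)]
  simp [MeasurableEquiv.piFinSuccAbove_symm_apply]
  rfl

/-- The weight of a walk. -/
def walkWeight (W : Ω → Ω → ℝ) (χ : ℕ → Ω → ℝ) (j : ℕ) (w : ℕ → Ω) : ℝ :=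
  (∏ i ∈ Finset.range (j + 1), W (w i) (w (i + 1))) * ∏ i ∈ Finset.range (j + 2), χ i (w i)

lemma walkWeight_bddMeas {W : Ω → Ω → ℝ} {χ : ℕ → Ω → ℝ}
    (hW : BddMeas (fun q : Ω × Ω => W q.1 q.2)) (hχ : IsWeight χ) {β : Type*} [MeasurableSpace β]
    {w : β → ℕ → Ω} (hw : ∀ i, Measurable (fun b => w b i)) (j : ℕ) :
    BddMeas (fun b => walkWeight W χ j (w b)) :=
  (BddMeas.prod _ fun i _ => hW.comp₂ (hw i) (hw (i + 1))).mul
    (BddMeas.prod _ fun i _ => (hχ.bddMeas i).comp (hw i))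

lemma walkKer_eq_integral {W : Ω → Ω → ℝ} {χ : ℕ → Ω → ℝ}
    (hW : BddMeas (fun q : Ω × Ω => W q.1 q.2)) (hχ : IsWeight χ) (j : ℕ) (x y : Ω) :
    walkKer μ W χ j x y =
      ∫ z, walkWeight W χ j (walkVertex x z y) ∂(Measure.pi fun _ : Fin j => μ) := by
  induction j generalizing y with
  | zero =>
    simp only [walkWeight, Finset.prod_range_succ, Finset.prod_range_zero, walkKer]
    simp [walkVertex]
    ring
  | succ j ih =>
    rw [integral_pi_snoc (walkWeight_bddMeas hW hχ (w := fun z => walkVertex x z y)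
      (measurable_walkVertex measurable_const measurable_id measurable_const) (j + 1))]
    simp only [walkKer, ← integral_mul_const, ih]
    refine integral_congr_ae (Eventually.of_forall fun z' => ?_)
    refine integral_congr_ae (Eventually.of_forall fun z => ?_)
    simp only [walkWeight]
    rw [Finset.prod_range_succ (fun i => W (walkVertex x (Fin.snoc z z' : Fin (j + 1) → Ω) y i)
        (walkVertex x (Fin.snoc z z' : Fin (j + 1) → Ω) y (i + 1))) (j + 1),
      Finset.prod_range_succ _ (j + 2),
      walkVertex_snoc x z z' y (by omega : j + 1 < j + 2), walkVertex_last, walkVertex_last]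
    have e1 : ∀ i ∈ Finset.range (j + 1), W (walkVertex x (Fin.snoc z z' : Fin (j + 1) → Ω) y i)
        (walkVertex x (Fin.snoc z z' : Fin (j + 1) → Ω) y (i + 1)) =
        W (walkVertex x z z' i) (walkVertex x z z' (i + 1)) := fun i hi => by
      have := Finset.mem_range.1 hi
      rw [walkVertex_snoc x z z' y (by omega), walkVertex_snoc x z z' y (by omega)]
    have e2 : ∀ i ∈ Finset.range (j + 2), χ i (walkVertex x (Fin.snoc z z' : Fin (j + 1) → Ω) y i) =
        χ i (walkVertex x z z' i) := fun i hi => by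
      rw [walkVertex_snoc x z z' y (Finset.mem_range.1 hi)]
    rw [Finset.prod_congr rfl e1, Finset.prod_congr rfl e2]
    ring

end PathIntegral

section PathCounts

variable {n : ℕ} [NeZero n] {p : ℝ} {G : SimpleGraph (Fin n)}

/-- Indicator weights of a partial colouring of the vertices of a graph. -/
noncomputable def colourWeight {γ : Type*} (col : Fin n → γ) (c : γ) (x : ℝ) : ℝ :=
  if col (idxFin n x) = c then 1 else 0

lemma colourWeight_isWeight {γ : Type*} (col : Fin n → γ) (c : ℕ → γ) :
    IsWeight (fun i => colourWeight col (c i)) where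
  measurable i := (bddMeas_idxFin (fun v => if col v = c i then (1:ℝ) else 0)).measurable
  nonneg i x := by unfold colourWeight; split_ifs <;> simp
  le_one i x := by unfold colourWeight; split_ifs <;> simp

/-- Properly rainbow-coloured walks are paths. -/
lemma walkKer_stepKer_le_pathCount {γ : Type*} (hp : 0 < p) (col : Fin n → γ) (c : ℕ → γ) (j : ℕ)
    (hc : ∀ a b, a < j + 2 → b < j + 2 → c a = c b → a = b) (x y : ℝ) :
    walkKer unitMeasure (stepKer p G) (fun i => colourWeight col (c i)) j x y ≤
      pathCount G (j + 1) (idxFin n x) (idxFin n y) / ((n : ℝ) ^ j * p ^ (j + 1)) := by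
  have hn : (0:ℝ) < n := by exact_mod_cast NeZero.pos n
  set u := idxFin n x
  set v := idxFin n y
  set f : (Fin j → Fin n) → ℝ := fun φ =>
    if (∀ i < j + 1, G.Adj (walkVertex u φ v i) (walkVertex u φ v (i + 1))) ∧
      ∀ i < j + 2, col (walkVertex u φ v i) = c i then (1 / p) ^ (j + 1) else 0 with hf
  have h1 : walkKer unitMeasure (stepKer p G) (fun i => colourWeight col (c i)) j x y =
      (∑ φ, f φ) / (n : ℝ) ^ j := by
    rw [walkKer_eq_integral stepKer_bddMeas (colourWeight_isWeight col c)]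
    have := integral_pi_idxFin f
    rw [Fintype.card_fin] at this
    rw [← this]
    refine integral_congr_ae (Eventually.of_forall fun z => ?_)
    simp only [walkWeight, stepKer, colourWeight, ← walkVertex_comp (idxFin n), hf,
      Finset.prod_ite_zero, Finset.prod_const, Finset.card_range, Finset.mem_range, one_pow]
    rw [ite_and]
    split_ifs <;> simp
  have h2 : ∑ φ, f φ ≤ pathCount G (j + 1) u v * (1 / p) ^ (j + 1) := by
    rw [hf, Finset.sum_ite, Finset.sum_const_zero, add_zero, Finset.sum_const, nsmul_eq_mul]
    refine mul_le_mul_of_nonneg_right ?_ (by positivity)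
    rw [pathCount, ← Fintype.card_subtype, ← Nat.card_eq_fintype_card]
    norm_cast
    refine Nat.card_le_card_of_injective (fun φ => ⟨fun i => walkVertex u φ.1 v i,
      ?_, ?_, ?_, ?_⟩) ?_
    · simp [walkVertex_zero]
    · simp [walkVertex_last]
    · intro a b hab
      have ha := φ.2.2 a a.2
      have hb := φ.2.2 b b.2
      simp only at hab
      rw [hab, hb] at ha
      exact Fin.ext (hc a b a.2 b.2 ha.symm)
    · intro i
      have := φ.2.1 i i.2
      simpa using this
    · intro φ ψ h
      simp only [Subtype.mk.injEq] at h
      refine Subtype.ext (funext fun t => ?_)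
      have := congrFun h ⟨t + 1, by omega⟩
      simpa [walkVertex] using this
  rw [h1, div_le_div_iff₀ (by positivity) (by positivity)]
  calc (∑ φ, f φ) * ((n : ℝ) ^ j * p ^ (j + 1))
      ≤ (pathCount G (j + 1) u v * (1 / p) ^ (j + 1)) * ((n : ℝ) ^ j * p ^ (j + 1)) :=
        mul_le_mul_of_nonneg_right h2 (by positivity)
    _ = _ := by
        rw [one_div, inv_pow]
        field_simp

lemma pathCount_self (t : ℕ) (u : Fin n) : pathCount G (t + 1) u u = 0 := by
  rw [pathCount, Nat.card_eq_zero]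
  left
  refine ⟨fun w => ?_⟩
  have := w.2.2.2.1 (w.2.1.trans w.2.2.1.symm)
  exact absurd this (by simp [Fin.ext_iff])

/-- Moments of rainbow walk kernels are bounded by path moments. -/
lemma integral_walkKer_pow_le {γ : Type*} (hp : 0 < p) (col : Fin n → γ) (c : ℕ → γ) (j k : ℕ)
    (hk : k ≠ 0) (hc : ∀ a b, a < j + 2 → b < j + 2 → c a = c b → a = b) {D : ℝ}
    (hD : (∑ u : Fin n, ∑ v : Fin n,
      if v ≠ u then (pathCount G (j + 1) u v : ℝ) ^ k else 0) ≤
        D * (n : ℝ) ^ (2 + k * j) * p ^ (k * (j + 1))) :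
    ∫ x, ∫ y, walkKer unitMeasure (stepKer p G) (fun i => colourWeight col (c i)) j x y ^ k
      ∂unitMeasure ∂unitMeasure ≤ D := by
  have hn : (0:ℝ) < n := by exact_mod_cast NeZero.pos n
  have hK := (walkKer_bddMeas (μ := unitMeasure) (W := stepKer p G) stepKer_bddMeas
    (colourWeight_isWeight col c) j).pow k
  set A : Fin n → Fin n → ℝ := fun u v =>
    ((pathCount G (j + 1) u v : ℝ) / ((n : ℝ) ^ j * p ^ (j + 1))) ^ k with hA
  have hAm := bddMeas_idxFin₂ A
  calc _ ≤ ∫ x, ∫ y, A (idxFin n x) (idxFin n y) ∂unitMeasure ∂unitMeasure := by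
        refine BddMeas.integral_mono (hK.integral_right (K := fun x y => walkKer unitMeasure
          (stepKer p G) (fun i => colourWeight col (c i)) j x y ^ k) _) (hAm.integral_right
          (K := fun x y => A (idxFin n x) (idxFin n y)) _) fun x => ?_
        refine BddMeas.integral_mono (hK.left (K := fun x y => walkKer unitMeasure
          (stepKer p G) (fun i => colourWeight col (c i)) j x y ^ k) x) (hAm.left
          (K := fun x y => A (idxFin n x) (idxFin n y)) x) fun y => ?_
        exact pow_le_pow_left₀ (walkKer_nonneg (stepKer_nonneg hp) (colourWeight_isWeight col c)
          _ _ _) (walkKer_stepKer_le_pathCount hp col c j hc x y) k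
    _ = (∑ u, ∑ v, A u v) / (n : ℝ) ^ 2 := integral_integral_idxFin A
    _ = (∑ u : Fin n, ∑ v : Fin n,
          if v ≠ u then (pathCount G (j + 1) u v : ℝ) ^ k else 0) /
          ((n : ℝ) ^ j * p ^ (j + 1)) ^ k / (n : ℝ) ^ 2 := by
        simp only [Finset.sum_div]
        refine Finset.sum_congr rfl fun u _ => Finset.sum_congr rfl fun v _ => ?_
        by_cases h : v = u
        · subst h
          simp [hA, pathCount_self, hk]
        · simp [hA, h, div_pow]
    _ ≤ _ := by
        rw [div_div, div_le_iff₀ (by positivity)]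
        refine hD.trans (le_of_eq ?_)
        rw [mul_pow, ← pow_mul, ← pow_mul]
        ring

end PathCounts

section Degrees

lemma edgeCount_starGraph (k : ℕ) : edgeCount (SimpleGraph.starGraph (0 : Fin (k + 1))) = k := by
  have h := (SimpleGraph.isTree_starGraph (0 : Fin (k + 1))).card_edgeFinset
  rw [Fintype.card_fin] at h
  rw [edgeCount, Nat.card_eq_fintype_card, ← SimpleGraph.edgeFinset_card]
  omega

lemma sum_descFactorial_degree_le_embCount {n : ℕ} (G : SimpleGraph (Fin n)) (k : ℕ) :
    ∑ v, (G.degree v).descFactorial k ≤ embCount (SimpleGraph.starGraph (0 : Fin (k + 1))) G := by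
  have h1 : ∑ v, (G.degree v).descFactorial k = Nat.card (Σ v, (Fin k ↪ G.neighborSet v)) := by
    rw [Nat.card_eq_fintype_card, Fintype.card_sigma]
    refine Finset.sum_congr rfl fun v _ => ?_
    rw [Fintype.card_embedding_eq, Fintype.card_fin, SimpleGraph.card_neighborSet_eq_degree]
  rw [h1, embCount]
  let Φ : (Σ v, (Fin k ↪ G.neighborSet v)) →
      {φ : SimpleGraph.starGraph (0 : Fin (k + 1)) →g G // Function.Injective φ} := fun s =>
    ⟨⟨Fin.cons s.1 (fun i => (s.2 i : Fin n)), by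
      intro a b hab
      rw [SimpleGraph.starGraph_adj] at hab
      obtain ⟨hne, rfl | rfl⟩ := hab
      · obtain ⟨i, rfl⟩ := Fin.exists_succ_eq.2 (Ne.symm hne)
        simp only [Fin.cons_zero, Fin.cons_succ]
        exact (s.2 i).2
      · obtain ⟨i, rfl⟩ := Fin.exists_succ_eq.2 hne
        simpa using (s.2 i).2.symm⟩, by
      change Function.Injective (Fin.cons s.1 (fun i => (s.2 i : Fin n)) : Fin (k + 1) → Fin n)
      rw [Fin.cons_injective_iff]
      refine ⟨?_, Subtype.val_injective.comp s.2.injective⟩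
      rintro ⟨i, hi⟩
      exact (s.2 i).2.ne hi.symm⟩
  refine Nat.card_le_card_of_injective Φ ?_
  rintro ⟨v, f⟩ ⟨w, g⟩ h
  have hfun : (Fin.cons v (fun i => (f i : Fin n)) : Fin (k + 1) → Fin n) =
      Fin.cons w (fun i => (g i : Fin n)) :=
    congrArg (fun φ : {φ : SimpleGraph.starGraph (0 : Fin (k + 1)) →g G //
      Function.Injective φ} => (φ.1 : Fin (k + 1) → Fin n)) h
  obtain ⟨rfl, hfg⟩ := Fin.cons_inj.1 hfun
  congr 1
  ext i
  exact congrArg Fin.val (congrFun hfg i)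

lemma pow_le_descFactorial_add (d k : ℕ) :
    (d : ℝ) ^ k ≤ 2 ^ k * d.descFactorial k + (2 * k) ^ k := by
  by_cases h : d ≤ 2 * k
  · have h1 : (d : ℝ) ^ k ≤ (2 * k) ^ k := by
      have : (d : ℝ) ≤ 2 * k := by exact_mod_cast h
      gcongr
    have : (0 : ℝ) ≤ 2 ^ k * d.descFactorial k := by positivity
    linarith
  · have h1 := Nat.pow_sub_le_descFactorial d k
    have h2 : d ^ k ≤ 2 ^ k * d.descFactorial k := by
      calc d ^ k ≤ (2 * (d + 1 - k)) ^ k := Nat.pow_le_pow_left (by omega) k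
        _ = 2 ^ k * (d + 1 - k) ^ k := mul_pow _ _ _
        _ ≤ _ := Nat.mul_le_mul_left _ h1
    have h3 : (d : ℝ) ^ k ≤ 2 ^ k * d.descFactorial k := by exact_mod_cast h2
    have : (0 : ℝ) ≤ (2 * k : ℝ) ^ k := by positivity
    linarith

variable {n : ℕ} {p : ℝ} {G : SimpleGraph (Fin n)}

lemma embCount_star_le {M : ℝ} (hp : 0 < p) (k : ℕ) (hn : k + 1 ≤ n)
    (hM : sDen p (SimpleGraph.starGraph (0 : Fin (k + 1))) G ≤ M) :
    (embCount (SimpleGraph.starGraph (0 : Fin (k + 1))) G : ℝ) ≤ |M| * (p ^ k * n ^ (k + 1)) := by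
  rw [sDen, edgeCount_starGraph, Fintype.card_fin, Fintype.card_fin] at hM
  have h0 : 0 < n.descFactorial (k + 1) := Nat.descFactorial_pos.2 hn
  have hpos : 0 < p ^ k * (n.descFactorial (k + 1) : ℝ) := by positivity
  rw [div_le_iff₀ hpos] at hM
  have h1 : (n.descFactorial (k + 1) : ℝ) ≤ n ^ (k + 1) := by
    exact_mod_cast Nat.descFactorial_le_pow n (k + 1)
  calc (embCount (SimpleGraph.starGraph (0 : Fin (k + 1))) G : ℝ) ≤ M * (p ^ k * n.descFactorial (k + 1)) := hM
    _ ≤ |M| * (p ^ k * n.descFactorial (k + 1)) := by gcongr; exact le_abs_self M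
    _ ≤ _ := by gcongr

variable [NeZero n]

lemma integral_stepKer_left (p : ℝ) (G : SimpleGraph (Fin n)) (y : ℝ) :
    ∫ z, stepKer p G z y ∂unitMeasure = G.degree (idxFin n y) / (n * p) := by
  have := integral_idxFin (n := n) (fun i => if G.Adj i (idxFin n y) then 1 / p else 0)
  simp only [stepKer]
  rw [this, ← Finset.sum_filter, Finset.sum_const, nsmul_eq_mul]
  have h : (Finset.univ.filter fun i => G.Adj i (idxFin n y)).card = G.degree (idxFin n y) := by
    rw [← SimpleGraph.card_neighborFinset_eq_degree]
    congr 1; ext i; simp [G.adj_comm]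
  rw [h]
  have : (n : ℝ) ≠ 0 := by exact_mod_cast NeZero.ne n
  rw [mul_one_div, div_div, mul_comm p]

lemma integral_degree_pow_le {M : ℝ} (hp : 0 < p) (hnp : 1 ≤ n * p) (k : ℕ) (hn : k + 1 ≤ n)
    (hM : sDen p (SimpleGraph.starGraph (0 : Fin (k + 1))) G ≤ M) :
    ∫ y, (∫ z, stepKer p G z y ∂unitMeasure) ^ k ∂unitMeasure ≤ 2 ^ k * |M| + (2 * k) ^ k := by
  simp only [integral_stepKer_left]
  rw [integral_idxFin (fun i => ((G.degree i : ℝ) / (n * p)) ^ k)]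
  have hn0 : (0 : ℝ) < n := by exact_mod_cast NeZero.pos n
  rw [div_le_iff₀ hn0]
  have hk : (1 : ℝ) ≤ (n * p) ^ k := one_le_pow₀ hnp
  have h1 : ∑ i, (G.degree i : ℝ) ^ k ≤ 2 ^ k * (|M| * (p ^ k * n ^ (k + 1))) + n * (2 * k) ^ k := by
    calc ∑ i, (G.degree i : ℝ) ^ k
        ≤ ∑ i, (2 ^ k * ((G.degree i).descFactorial k : ℝ) + (2 * k) ^ k) :=
          Finset.sum_le_sum fun i _ => pow_le_descFactorial_add _ k
      _ = 2 ^ k * ((∑ i, (G.degree i).descFactorial k : ℕ) : ℝ) + n * (2 * k) ^ k := by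
          rw [Finset.sum_add_distrib, ← Finset.mul_sum]; simp
      _ ≤ 2 ^ k * embCount (SimpleGraph.starGraph (0 : Fin (k + 1))) G + n * (2 * k) ^ k := by
          gcongr; exact sum_descFactorial_degree_le_embCount G k
      _ ≤ _ := by gcongr; exact embCount_star_le hp k hn hM
  simp only [div_pow]
  rw [← Finset.sum_div, div_le_iff₀ (by positivity)]
  refine h1.trans ?_
  have h2 : (n : ℝ) * (2 * k) ^ k * 1 ≤ n * (2 * k) ^ k * (n * p) ^ k := by gcongr
  have h3 : (2 ^ k * |M| + (2 * k) ^ k) * n * (n * p) ^ k =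
      2 ^ k * (|M| * (p ^ k * n ^ (k + 1))) + n * (2 * k) ^ k * (n * p) ^ k := by
    rw [mul_pow (n : ℝ) p, pow_succ]; ring
  linarith

lemma sum_degree_le {M : ℝ} (hp : 0 < p) (hn : 2 ≤ n)
    (hM : sDen p (SimpleGraph.starGraph (0 : Fin 2)) G ≤ M) :
    ∑ v, (G.degree v : ℝ) ≤ |M| * (p * n ^ 2) := by
  have h := embCount_star_le hp 1 hn hM
  have h2 := sum_descFactorial_degree_le_embCount G 1
  simp only [Nat.descFactorial_one] at h2
  rw [pow_one] at h
  refine le_trans ?_ h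
  exact_mod_cast h2

end Degrees

section VerySparse

/-- Partition of `Fin n` into residue classes modulo `m`. -/
def residueColour (n m : ℕ) [NeZero m] (v : Fin n) : Fin m :=
  ⟨v % m, Nat.mod_lt _ (NeZero.pos m)⟩

lemma card_residueColour_le (n m : ℕ) [NeZero m] (i : Fin m) :
    ((Finset.univ.filter fun v : Fin n => residueColour n m v = i).card : ℝ) ≤ n / m + 1 := by
  have h : (Finset.univ.filter fun v : Fin n => residueColour n m v = i).card ≤ n / m + 1 := by
    rw [← Finset.card_range (n / m + 1)]
    refine Finset.card_le_card_of_injOn (fun v => (v : ℕ) / m) ?_ ?_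
    · intro v _
      simp only [Finset.coe_range, mem_Iio]
      exact Nat.lt_succ_of_le (Nat.div_le_div_right v.2.le)
    · intro v hv w hw hvw
      simp only [Finset.coe_filter, Finset.mem_univ, true_and, Set.mem_ofPred_eq, residueColour,
        Fin.ext_iff] at hv hw
      ext
      rw [← Nat.div_add_mod (v : ℕ) m, ← Nat.div_add_mod (w : ℕ) m, hv, hw]
      exact congrArg (fun q => m * q + (i : ℕ)) hvw
  calc _ ≤ ((n / m + 1 : ℕ) : ℝ) := by exact_mod_cast h
    _ ≤ _ := by push_cast; gcongr; exact Nat.cast_div_le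

lemma setIntegral_setIntegral_eq {Ω : Type*} [MeasurableSpace Ω] {μ : Measure Ω} {S T : Set Ω}
    (hS : MeasurableSet S) (hT : MeasurableSet T) (U : Ω → Ω → ℝ) :
    ∫ x in S, ∫ y in T, U x y ∂μ ∂μ =
      ∫ x, ∫ y, (if x ∈ S ∧ y ∈ T then 1 else 0) * U x y ∂μ ∂μ := by
  rw [← integral_indicator hS]
  congr 1; ext x
  by_cases hx : x ∈ S
  · rw [indicator_of_mem hx, ← integral_indicator hT]
    congr 1; ext y
    by_cases hy : y ∈ T <;> simp [hx, hy]
  · simp [hx]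

variable {n : ℕ} [NeZero n] {p : ℝ} {G : SimpleGraph (Fin n)}

lemma integral_le_of_sparse {C M δ : ℝ} {U : ℝ → ℝ → ℝ} (hC : 0 < C)
    (hU : BddMeas (fun q : ℝ × ℝ => U q.1 q.2)) (hUC : ∀ x y, U x y ≤ C)
    (hcut : ∀ S T : Set ℝ, MeasurableSet S → MeasurableSet T →
      |∫ x in S, ∫ y in T, (stepKer p G x y - U x y) ∂unitMeasure ∂unitMeasure| ≤ δ)
    (hM : 0 ≤ M) (hdeg : ∑ v, (G.degree v : ℝ) ≤ M * (p * n ^ 2)) (hnp : n * p ≤ 1)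
    (m : ℕ) [NeZero m] :
    ∫ x, ∫ y, U x y ∂unitMeasure ∂unitMeasure ≤ m * δ + C * M * (1 / m + 1 / n) := by
  have hn0 : (0 : ℝ) < n := by exact_mod_cast NeZero.pos n
  have hm0 : (0 : ℝ) < m := by exact_mod_cast NeZero.pos m
  let S : Fin m → Set ℝ := fun i => {x | residueColour n m (idxFin n x) = i}
  let T : Fin m → Set ℝ := fun i =>
    {y | ∀ z, G.Adj (idxFin n y) z → residueColour n m z ≠ i}
  have hS : ∀ i, MeasurableSet (S i) := fun i =>
    measurable_idxFin (MeasurableSet.of_discrete (s := {v | residueColour n m v = i}))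
  have hT : ∀ i, MeasurableSet (T i) := fun i =>
    measurable_idxFin (MeasurableSet.of_discrete
      (s := {v | ∀ z, G.Adj v z → residueColour n m z ≠ i}))
  let A : Fin m → ℝ → ℝ → ℝ := fun i x y => (if x ∈ S i ∧ y ∈ T i then 1 else 0) * U x y
  let g : Fin n → Fin n → ℝ := fun u v =>
    ∑ z, if G.Adj v z ∧ residueColour n m z = residueColour n m u then 1 else 0
  have hA : ∀ i, BddMeas (fun q : ℝ × ℝ => A i q.1 q.2) := fun i => by
    convert (BddMeas.ite (P := fun q : ℝ × ℝ => q.1 ∈ S i ∧ q.2 ∈ T i)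
      ((measurable_fst (hS i)).inter (measurable_snd (hT i)))
      (BddMeas.const 1) (BddMeas.const 0)).mul hU using 1
    ext q
    simp only [A]
    congr
  have hg := bddMeas_idxFin₂ g
  have hR : BddMeas (fun q : ℝ × ℝ => (∑ i, A i q.1 q.2) +
      C * g (idxFin n q.1) (idxFin n q.2)) :=
    (BddMeas.sum _ fun i _ => hA i).add ((BddMeas.const C).mul hg)
  have hpt : ∀ x y, U x y ≤ (∑ i, A i x y) + C * g (idxFin n x) (idxFin n y) := by
    intro x y
    have hg0 : 0 ≤ g (idxFin n x) (idxFin n y) :=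
      Finset.sum_nonneg fun z _ => by split_ifs <;> norm_num
    have hsum : ∑ i, A i x y = A (residueColour n m (idxFin n x)) x y := by
      refine Finset.sum_eq_single _ (fun i _ hi => ?_) (by simp)
      have : x ∉ S i := fun h => hi (by simpa [S] using h.symm)
      simp [A, this]
    rw [hsum]
    by_cases hy : y ∈ T (residueColour n m (idxFin n x))
    · have hx : x ∈ S (residueColour n m (idxFin n x)) := by simp [S]
      simp only [A, hx, hy, and_self, if_true, one_mul]
      have := mul_nonneg hC.le hg0
      linarith
    · simp only [A, hy, and_false, if_false, zero_mul, zero_add]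
      simp only [T, Set.mem_ofPred_eq, not_forall, not_not] at hy
      obtain ⟨z, hz, hzc⟩ := hy
      have h1 : (1 : ℝ) ≤ g (idxFin n x) (idxFin n y) := by
        have := Finset.single_le_sum (f := fun z => if G.Adj (idxFin n y) z ∧
          residueColour n m z = residueColour n m (idxFin n x) then (1 : ℝ) else 0)
          (fun z _ => by split_ifs <;> norm_num) (Finset.mem_univ z)
        simp only [hz, hzc, and_self, if_true] at this
        exact this
      nlinarith [hUC x y]
  have hmono : ∫ x, ∫ y, U x y ∂unitMeasure ∂unitMeasure ≤
      ∫ x, ∫ y, ((∑ i, A i x y) + C * g (idxFin n x) (idxFin n y)) ∂unitMeasure ∂unitMeasure :=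
    BddMeas.integral_mono (hU.integral_right (K := U) _)
      (hR.integral_right (K := fun x y => (∑ i, A i x y) + C * g (idxFin n x) (idxFin n y)) _)
      fun x => BddMeas.integral_mono (hU.left (K := U) x)
        (hR.left (K := fun x y => (∑ i, A i x y) + C * g (idxFin n x) (idxFin n y)) x) (hpt x)
  have hsplit : ∫ x, ∫ y, ((∑ i, A i x y) + C * g (idxFin n x) (idxFin n y))
      ∂unitMeasure ∂unitMeasure = (∑ i, ∫ x, ∫ y, A i x y ∂unitMeasure ∂unitMeasure) +
        C * ((∑ u, ∑ v, g u v) / n ^ 2) := by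
    rw [← integral_integral_idxFin g, ← integral_const_mul, ← integral_finsetSum _
      (fun i _ => ((hA i).integral_right (K := A i) _).integrable unitMeasure), ← integral_add
      ((BddMeas.sum _ fun i _ => (hA i).integral_right (K := A i) _).integrable unitMeasure)
      (((BddMeas.const C).mul (hg.integral_right
        (K := fun x y => g (idxFin n x) (idxFin n y)) _)).integrable unitMeasure)]
    refine integral_congr_ae (Eventually.of_forall fun x => ?_)
    dsimp only
    rw [integral_add ((BddMeas.sum _ fun i _ => (hA i).left (K := A i) x).integrable unitMeasure)
      (((BddMeas.const C).mul (hg.left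
        (K := fun x y => g (idxFin n x) (idxFin n y)) x)).integrable unitMeasure),
      integral_finsetSum _ (fun i _ => ((hA i).left (K := A i) x).integrable unitMeasure),
      integral_const_mul]
  have hAi : ∀ i, ∫ x, ∫ y, A i x y ∂unitMeasure ∂unitMeasure ≤ δ := by
    intro i
    have h := hcut (S i) (T i) (hS i) (hT i)
    rw [setIntegral_setIntegral_eq (hS i) (hT i)] at h
    have h2 : ∀ x y, (if x ∈ S i ∧ y ∈ T i then (1 : ℝ) else 0) * (stepKer p G x y - U x y) =
        - A i x y := by
      intro x y
      by_cases hxy : x ∈ S i ∧ y ∈ T i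
      · have hW : stepKer p G x y = 0 := by
          rw [stepKer, if_neg]
          intro hadj
          exact hxy.2 _ hadj.symm hxy.1
        simp [A, hxy, hW]
      · simp [A, hxy]
    have h3 : (∫ x, ∫ y, - A i x y ∂unitMeasure ∂unitMeasure) = _ :=
      integral_congr_ae (Eventually.of_forall fun x =>
        integral_congr_ae (Eventually.of_forall fun y => (h2 x y).symm))
    replace h : |∫ x, ∫ y, - A i x y ∂unitMeasure ∂unitMeasure| ≤ δ := by
      rw [h3]; convert h
    simp only [integral_neg, abs_neg] at h
    exact (le_abs_self _).trans h
  have hgsum : ∑ u, ∑ v, g u v ≤ M * (p * n ^ 2) * (n / m + 1) := by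
    have h1 : ∑ u, ∑ v, g u v = ∑ v, ∑ z, if G.Adj v z then
        ((Finset.univ.filter fun u : Fin n =>
          residueColour n m u = residueColour n m z).card : ℝ) else 0 := by
      rw [Finset.sum_comm]
      refine Finset.sum_congr rfl fun v _ => ?_
      rw [Finset.sum_comm]
      refine Finset.sum_congr rfl fun z _ => ?_
      by_cases hvz : G.Adj v z
      · simp only [hvz, true_and, if_true]
        rw [Finset.sum_boole]
        simp only [eq_comm]
      · simp [hvz]
    rw [h1]
    calc _ ≤ ∑ v, ∑ z, if G.Adj v z then ((n : ℝ) / m + 1) else 0 := by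
          refine Finset.sum_le_sum fun v _ => Finset.sum_le_sum fun z _ => ?_
          split_ifs
          · exact card_residueColour_le n m _
          · exact le_rfl
      _ = (∑ v, (G.degree v : ℝ)) * (n / m + 1) := by
          rw [Finset.sum_mul]
          refine Finset.sum_congr rfl fun v _ => ?_
          rw [← Finset.sum_filter, Finset.sum_const, nsmul_eq_mul,
            ← SimpleGraph.card_neighborFinset_eq_degree, SimpleGraph.neighborFinset_eq_filter]
      _ ≤ _ := by gcongr
  have hfin : C * ((∑ u, ∑ v, g u v) / n ^ 2) ≤ C * M * (1 / m + 1 / n) := by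
    have : (∑ u, ∑ v, g u v) / n ^ 2 ≤ M * (1 / m + 1 / n) := by
      rw [div_le_iff₀ (by positivity)]
      refine hgsum.trans ?_
      have e1 : M * (p * n ^ 2) * (n / m + 1) = (n * p) * (M * n * (n / m + 1)) := by ring
      have e2 : M * (1 / m + 1 / n) * n ^ 2 = 1 * (M * n * (n / m + 1)) := by field_simp
      rw [e1, e2]
      gcongr
    calc _ ≤ C * (M * (1 / m + 1 / n)) := by gcongr
      _ = _ := by ring
  calc _ ≤ _ := hmono
    _ = _ := hsplit
    _ ≤ (∑ _i : Fin m, δ) + C * M * (1 / m + 1 / n) :=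
        add_le_add (Finset.sum_le_sum fun i _ => hAi i) hfin
    _ = _ := by simp

end VerySparse

section Closeness

/-- A sequence of sparse graphs satisfying the path-count conditions for paths of length `j + 1`
and `j + 2`, together with bounded kernels that are asymptotically close to it in cut norm. -/
structure SparseApprox (C : ℝ) (j : ℕ) (p : ℕ → ℝ) (G : ∀ n, SimpleGraph (Fin (n + 1)))
    (U : ℕ → ℝ → ℝ → ℝ) : Prop where
  C_pos : 0 < C
  p_pos : ∀ n, 0 < p n
  star : ∀ k : ℕ, ∃ M : ℝ, ∀ n, sDen (p n) (SimpleGraph.starGraph (0 : Fin (k + 1))) (G n) ≤ M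
  path_sq : ∃ D : ℝ, ∀ n, (∑ u, ∑ v,
    if v ≠ u then (pathCount (G n) (j + 1) u v : ℝ) ^ 2 else 0) ≤
      D * ((n + 1 : ℕ) : ℝ) ^ (2 + 2 * j) * p n ^ (2 * (j + 1))
  path_pow : ∀ k : ℕ, 1 ≤ k → ∃ D : ℝ, ∀ n, (∑ u, ∑ v,
    if v ≠ u then (pathCount (G n) (j + 2) u v : ℝ) ^ k else 0) ≤
      D * ((n + 1 : ℕ) : ℝ) ^ (2 + k * (j + 1)) * p n ^ (k * (j + 2))
  meas : ∀ n, BddMeas (fun q : ℝ × ℝ => U n q.1 q.2)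
  nonneg : ∀ n x y, 0 ≤ U n x y
  symm : ∀ n x y, U n x y = U n y x
  le : ∀ n x y, U n x y ≤ C
  cut : ∀ δ > 0, ∀ᶠ n in atTop, ∀ S T : Set ℝ, MeasurableSet S → MeasurableSet T →
    |∫ x in S, ∫ y in T, (stepKer (p n) (G n) x y - U n x y) ∂unitMeasure ∂unitMeasure| ≤ δ

namespace SparseApprox

variable {C : ℝ} {j : ℕ} {p : ℕ → ℝ} {G : ∀ n, SimpleGraph (Fin (n + 1))} {U : ℕ → ℝ → ℝ → ℝ}
  {γ : Type*}

lemma close_of_dense (h : SparseApprox C j p G U) (col : ∀ n, Fin (n + 1) → γ) (c : ℕ → γ)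
    (hc : ∀ a b, a < j + 3 → b < j + 3 → c a = c b → a = b) {δ : ℝ} (hδ : 0 < δ) :
    ∀ᶠ n in atTop, 1 ≤ ((n + 1 : ℕ) : ℝ) * p n → ∫ x, ∫ y,
      |walkKer unitMeasure (stepKer (p n) (G n)) (fun i => colourWeight (col n) (c i)) (j + 1) x y -
        walkKer unitMeasure (U n) (fun i => colourWeight (col n) (c i)) (j + 1) x y|
          ∂unitMeasure ∂unitMeasure ≤ δ := by
  have key := walkKer_sub_integral_small (μ := unitMeasure)
    (l := atTop ⊓ 𝓟 {n : ℕ | 1 ≤ ((n + 1 : ℕ) : ℝ) * p n}) (W := fun n => stepKer (p n) (G n))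
    (U := U) (χ := fun n i => colourWeight (col n) (c i)) h.C_pos (fun n => stepKer_bddMeas)
    (fun n => stepKer_nonneg (h.p_pos n)) (fun n => stepKer_symm) h.meas h.nonneg h.symm h.le
    (fun n => colourWeight_isWeight (col n) c) ?_ ?_ j ?_ δ hδ
  · exact eventually_inf_principal.1 key
  · intro k
    obtain ⟨M, hM⟩ := h.star k
    refine ⟨2 ^ k * |M| + (2 * k) ^ k, eventually_inf_principal.2 ?_⟩
    filter_upwards [eventually_ge_atTop k] with n hn hnp
    exact integral_degree_pow_le (h.p_pos n) hnp k (by omega) (hM n)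
  · intro δ hδ
    refine Filter.Eventually.filter_mono inf_le_left ?_
    filter_upwards [h.cut (δ / 4) (by positivity)] with n hn
    have := opSmall_of_setIntegral (V := fun x y => stepKer (p n) (G n) x y - U n x y)
      (stepKer_bddMeas.sub (h.meas n)) hn
    rwa [mul_div_cancel₀ δ (by norm_num : (4 : ℝ) ≠ 0)] at this
  · obtain ⟨D, hD⟩ := h.path_sq
    refine ⟨D, Eventually.of_forall fun n => ?_⟩
    exact integral_walkKer_pow_le (h.p_pos n) (col n) c j 2 two_ne_zero
      (fun a b ha hb => hc a b (by omega) (by omega)) (hD n)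

lemma integral_walkKer_le_of_sparse {n : ℕ} [NeZero n] {p : ℝ} {G : SimpleGraph (Fin n)}
    (hp : 0 < p) (hnp : n * p ≤ 1) (col : Fin n → γ) (c : ℕ → γ) (j : ℕ)
    (hc : ∀ a b, a < j + 3 → b < j + 3 → c a = c b → a = b) {D : ℝ}
    (hD : (∑ u, ∑ v, if v ≠ u then (pathCount G (j + 2) u v : ℝ) ^ 2 else 0) ≤
      D * (n : ℝ) ^ (2 + 2 * (j + 1)) * p ^ (2 * (j + 2))) :
    ∫ x, ∫ y, walkKer unitMeasure (stepKer p G) (fun i => colourWeight col (c i)) (j + 1) x y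
      ∂unitMeasure ∂unitMeasure ≤ |D| / n := by
  have hn0 : (0 : ℝ) < n := by exact_mod_cast NeZero.pos n
  have := integral_walkKer_pow_le (D := |D| / n) (G := G) hp col c (j + 1) 1 one_ne_zero hc ?_
  · simpa only [pow_one] using this
  calc _ ≤ ∑ u, ∑ v, (if v ≠ u then (pathCount G (j + 2) u v : ℝ) ^ 2 else 0) := by
        refine Finset.sum_le_sum fun u _ => Finset.sum_le_sum fun v _ => ?_
        split_ifs
        · have : pathCount G (j + 2) u v ≤ pathCount G (j + 2) u v ^ 2 :=
            Nat.le_self_pow two_ne_zero _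
          rw [pow_one]
          exact_mod_cast this
        · exact le_rfl
    _ ≤ _ := hD
    _ = D * (n * p) ^ (2 * (j + 2)) := by rw [mul_pow]; ring
    _ ≤ |D| * (n * p) ^ (j + 2) := by
        refine mul_le_mul (le_abs_self D) (pow_le_pow_of_le_one (by positivity) hnp (by omega))
          (by positivity) (abs_nonneg D)
    _ = _ := by
        rw [mul_pow]
        field_simp
        ring

lemma close_of_sparse (h : SparseApprox C j p G U) (col : ∀ n, Fin (n + 1) → γ) (c : ℕ → γ)
    (hc : ∀ a b, a < j + 3 → b < j + 3 → c a = c b → a = b) {δ : ℝ} (hδ : 0 < δ) :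
    ∀ᶠ n in atTop, ((n + 1 : ℕ) : ℝ) * p n ≤ 1 → ∫ x, ∫ y,
      |walkKer unitMeasure (stepKer (p n) (G n)) (fun i => colourWeight (col n) (c i)) (j + 1) x y -
        walkKer unitMeasure (U n) (fun i => colourWeight (col n) (c i)) (j + 1) x y|
          ∂unitMeasure ∂unitMeasure ≤ δ := by
  obtain ⟨D, hD⟩ := h.path_pow 2 (by norm_num)
  obtain ⟨M, hM⟩ := h.star 1
  have hCp := h.C_pos
  have hinv : Tendsto (fun n : ℕ => 1 / ((n + 1 : ℕ) : ℝ)) atTop (nhds 0) := by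
    simpa using tendsto_one_div_add_atTop_nhds_zero_nat (𝕜 := ℝ)
  set B : ℝ := C ^ (j + 1) with hB
  have hB0 : 0 < B := by positivity
  have hlim : Tendsto (fun n : ℕ => B * (C * |M| * (1 / ((n + 1 : ℕ) : ℝ)))) atTop (nhds 0) := by
    simpa using (hinv.const_mul (C * |M|)).const_mul B
  obtain ⟨m, hm⟩ := (hlim.eventually_lt_const (show (0 : ℝ) < δ / 4 by positivity)).exists
  have e1 : ∀ᶠ n : ℕ in atTop, |D| * (1 / ((n + 1 : ℕ) : ℝ)) < δ / 4 :=
    Tendsto.eventually_lt_const (v := 0) (by positivity) (by simpa using hinv.const_mul |D|)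
  filter_upwards [e1, hlim.eventually_lt_const (show (0 : ℝ) < δ / 4 by positivity),
    h.cut (δ / (4 * B * ((m + 1 : ℕ) : ℝ))) (by positivity), eventually_ge_atTop 1]
    with n h1 h2 h3 hn1 hnp
  have hK := integral_walkKer_le_of_sparse (h.p_pos n) hnp (col n) c j hc (hD n)
  have hχ := colourWeight_isWeight (col n) c
  have hL := integral_integral_walkKer_le (μ := unitMeasure) (h.meas n) (h.nonneg n) (h.le n) hχ
    (j + 1)
  have hU := integral_le_of_sparse hCp (h.meas n) (h.le n) h3 (abs_nonneg M)
    (sum_degree_le (h.p_pos n) (by omega) (hM n)) hnp (m + 1)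
  have hKm := walkKer_bddMeas (μ := unitMeasure) (W := stepKer (p n) (G n)) stepKer_bddMeas hχ
    (j + 1)
  have hLm := walkKer_bddMeas (μ := unitMeasure) (h.meas n) hχ (j + 1)
  set K := walkKer unitMeasure (stepKer (p n) (G n)) (fun i => colourWeight (col n) (c i)) (j + 1)
  set L := walkKer unitMeasure (U n) (fun i => colourWeight (col n) (c i)) (j + 1)
  have hK0 : ∀ x y, 0 ≤ K x y := walkKer_nonneg (stepKer_nonneg (h.p_pos n)) hχ (j + 1)
  have hL0 : ∀ x y, 0 ≤ L x y := walkKer_nonneg (h.nonneg n) hχ (j + 1)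
  have hsum : ∫ x, ∫ y, |K x y - L x y| ∂unitMeasure ∂unitMeasure ≤
      ∫ x, ∫ y, K x y ∂unitMeasure ∂unitMeasure + ∫ x, ∫ y, L x y ∂unitMeasure ∂unitMeasure := by
    rw [← integral_add ((hKm.integral_right (K := K) _).integrable _)
      ((hLm.integral_right (K := L) _).integrable _)]
    refine BddMeas.integral_mono ((hKm.sub hLm).abs.integral_right
      (K := fun x y => |K x y - L x y|) _)
      ((hKm.integral_right (K := K) _).add (hLm.integral_right (K := L) _)) fun x => ?_
    rw [← integral_add ((hKm.left (K := K) x).integrable _) ((hLm.left (K := L) x).integrable _)]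
    refine BddMeas.integral_mono ((hKm.sub hLm).abs.left (K := fun x y => |K x y - L x y|) x)
      ((hKm.left (K := K) x).add (hLm.left (K := L) x)) fun y => ?_
    rw [abs_le]
    constructor <;> linarith [hK0 x y, hL0 x y]
  refine hsum.trans ?_
  have e4 : B * (((m + 1 : ℕ) : ℝ) * (δ / (4 * B * ((m + 1 : ℕ) : ℝ)))) = δ / 4 := by
    field_simp
  have e5 : B * ∫ x, ∫ y, U n x y ∂unitMeasure ∂unitMeasure ≤ 3 * (δ / 4) := by
    calc _ ≤ B * (((m + 1 : ℕ) : ℝ) * (δ / (4 * B * ((m + 1 : ℕ) : ℝ))) +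
          C * |M| * (1 / ((m + 1 : ℕ) : ℝ) + 1 / ((n + 1 : ℕ) : ℝ))) := by gcongr
      _ = δ / 4 + B * (C * |M| * (1 / ((m + 1 : ℕ) : ℝ))) +
          B * (C * |M| * (1 / ((n + 1 : ℕ) : ℝ))) := by rw [mul_add, e4]; ring
      _ ≤ _ := by linarith
  have e6 : |D| / ((n + 1 : ℕ) : ℝ) < δ / 4 := by rwa [mul_one_div] at h1
  linarith

/-- The coloured walk kernels of the graphs and of the approximating kernels are close in `L¹`. -/
lemma close (h : SparseApprox C j p G U) (col : ∀ n, Fin (n + 1) → γ) (c : ℕ → γ)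
    (hc : ∀ a b, a < j + 3 → b < j + 3 → c a = c b → a = b) {δ : ℝ} (hδ : 0 < δ) :
    ∀ᶠ n in atTop, ∫ x, ∫ y,
      |walkKer unitMeasure (stepKer (p n) (G n)) (fun i => colourWeight (col n) (c i)) (j + 1) x y -
        walkKer unitMeasure (U n) (fun i => colourWeight (col n) (c i)) (j + 1) x y|
          ∂unitMeasure ∂unitMeasure ≤ δ := by
  filter_upwards [h.close_of_dense col c hc hδ, h.close_of_sparse col c hc hδ] with n h1 h2
  exact (le_total 1 _).elim h1 h2

lemma moments (h : SparseApprox C j p G U) (col : ∀ n, Fin (n + 1) → γ) (c : ℕ → γ)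
    (hc : ∀ a b, a < j + 3 → b < j + 3 → c a = c b → a = b) (k : ℕ) :
    ∃ B : ℝ, ∀ n, ∫ x, ∫ y,
      walkKer unitMeasure (stepKer (p n) (G n)) (fun i => colourWeight (col n) (c i)) (j + 1) x y
        ^ (k + 1) ∂unitMeasure ∂unitMeasure ≤ B := by
  obtain ⟨D, hD⟩ := h.path_pow (k + 1) (by omega)
  exact ⟨D, fun n => integral_walkKer_pow_le (h.p_pos n) (col n) c (j + 1) (k + 1) (by omega) hc
    (hD n)⟩

end SparseApprox

end Closeness

section Products

lemma abs_prod_sub_prod_le {ι : Type*} (s : Finset ι) {a b : ι → ℝ} {Z : ℝ} (hZ : 1 ≤ Z)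
    (ha : ∀ i ∈ s, 0 ≤ a i) (haZ : ∀ i ∈ s, a i ≤ Z) (hb : ∀ i ∈ s, 0 ≤ b i)
    (hbZ : ∀ i ∈ s, b i ≤ Z) :
    |∏ i ∈ s, a i - ∏ i ∈ s, b i| ≤ (∑ i ∈ s, |a i - b i|) * Z ^ s.card := by
  induction s using Finset.induction_on with
  | empty => simp
  | insert i s hi ih =>
    simp only [Finset.mem_insert, forall_eq_or_imp] at ha haZ hb hbZ
    rw [Finset.prod_insert hi, Finset.prod_insert hi, Finset.sum_insert hi,
      Finset.card_insert_of_notMem hi]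
    have h0 := ih ha.2 haZ.2 hb.2 hbZ.2
    have hP : ∏ i ∈ s, a i ≤ Z ^ s.card := by
      calc _ ≤ ∏ _i ∈ s, Z := Finset.prod_le_prod ha.2 haZ.2
        _ = _ := by simp
    have hP0 : 0 ≤ ∏ i ∈ s, a i := Finset.prod_nonneg ha.2
    have e : a i * ∏ i ∈ s, a i - b i * ∏ i ∈ s, b i =
        (a i - b i) * ∏ i ∈ s, a i + b i * (∏ i ∈ s, a i - ∏ i ∈ s, b i) := by ring
    rw [e]
    refine (abs_add_le _ _).trans ?_
    rw [abs_mul, abs_mul, abs_of_nonneg hP0, abs_of_nonneg hb.1, add_mul]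
    have hpow : Z ^ s.card ≤ Z ^ (s.card + 1) := pow_le_pow_right₀ hZ (by omega)
    have hs0 : 0 ≤ ∑ i ∈ s, |a i - b i| := Finset.sum_nonneg fun _ _ => abs_nonneg _
    refine add_le_add (mul_le_mul_of_nonneg_left (hP.trans hpow) (abs_nonneg _)) ?_
    calc b i * |∏ i ∈ s, a i - ∏ i ∈ s, b i| ≤ Z * ((∑ i ∈ s, |a i - b i|) * Z ^ s.card) :=
          mul_le_mul hbZ.1 h0 (abs_nonneg _) (by linarith)
      _ = _ := by ring

lemma mul_pow_le_truncation {d Z M : ℝ} (hd : 0 ≤ d) (hdZ : d ≤ Z) (hM : 0 < M) (m : ℕ) :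
    d * Z ^ m ≤ M * d + Z ^ (2 * m + 1) / M := by
  have hZ : 0 ≤ Z := hd.trans hdZ
  rcases le_total (Z ^ m) M with h | h
  · have : 0 ≤ Z ^ (2 * m + 1) / M := by positivity
    nlinarith
  · have : d * Z ^ m ≤ Z ^ (2 * m + 1) / M := by
      rw [le_div_iff₀ hM]
      calc d * Z ^ m * M ≤ Z * Z ^ m * Z ^ m := by gcongr
        _ = _ := by ring
    nlinarith

lemma pow_const_add_sum_le {ι : Type*} (s : Finset ι) {a : ι → ℝ} {Q : ℝ} (hQ : 0 ≤ Q)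
    (ha : ∀ i ∈ s, 0 ≤ a i) (q : ℕ) :
    (Q + ∑ i ∈ s, a i) ^ (q + 1) ≤
      2 ^ q * (Q ^ (q + 1) + s.card ^ q * ∑ i ∈ s, a i ^ (q + 1)) := by
  refine (add_pow_le hQ (Finset.sum_nonneg ha) (q + 1)).trans ?_
  rw [Nat.add_sub_cancel]
  gcongr
  rcases s.eq_empty_or_nonempty with rfl | hs
  · simp
  · have h := pow_sum_div_card_le_sum_pow ha q
    have : (0 : ℝ) < (s.card : ℝ) ^ q := by
      have := hs.card_pos
      positivity
    rw [div_le_iff₀ this] at h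
    linarith

variable {Ω : Type*} [MeasurableSpace Ω] {μ : Measure Ω} [IsProbabilityMeasure μ]

lemma integral_pi_pair {V : Type*} [Fintype V] {u v : V} (huv : u ≠ v) {f : Ω → Ω → ℝ}
    (hf : BddMeas (fun q : Ω × Ω => f q.1 q.2)) :
    ∫ x : V → Ω, f (x u) (x v) ∂(Measure.pi fun _ => μ) = ∫ x, ∫ y, f x y ∂μ ∂μ := by
  have hind : ProbabilityTheory.iIndepFun (fun (i : V) (ω : V → Ω) => ω i)
      (Measure.pi fun _ => μ) :=
    ProbabilityTheory.iIndepFun_pi (X := fun _ x => x) fun _ => aemeasurable_id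
  have hmap := (ProbabilityTheory.indepFun_iff_map_prod_eq_prod_map_map
    (measurable_pi_apply u).aemeasurable (measurable_pi_apply v).aemeasurable).1
    (hind.indepFun huv)
  have hu : Measure.map (fun ω : V → Ω => ω u) (Measure.pi fun _ => μ) = μ :=
    (measurePreserving_eval (fun _ : V => μ) u).map_eq
  have hv : Measure.map (fun ω : V → Ω => ω v) (Measure.pi fun _ => μ) = μ :=
    (measurePreserving_eval (fun _ : V => μ) v).map_eq
  have e := integral_prod _ (hf.integrable (μ.prod μ))
  rw [← e]
  rw [hu, hv] at hmap
  rw [← hmap, integral_map]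
  · exact ((measurable_pi_apply u).prodMk (measurable_pi_apply v)).aemeasurable
  · exact hf.1.aestronglyMeasurable

lemma BddMeas.pair {V : Type*} {f : Ω → Ω → ℝ} (hf : BddMeas (fun q : Ω × Ω => f q.1 q.2))
    (u v : V) : BddMeas (fun x : V → Ω => f (x u) (x v)) :=
  hf.comp₂ (measurable_pi_apply u) (measurable_pi_apply v)

/-- Products of kernels along the edges of a multigraph depend continuously on the kernels, in the
`L¹` sense, provided all moments stay bounded. -/
lemma integral_prod_close {ι : Type*} {l : Filter ι} {V E : Type*} [Fintype V] [Fintype E]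
    (u v : E → V) (huv : ∀ r, u r ≠ v r) {K L : ι → E → Ω → Ω → ℝ} {B : ℝ} {g : ι → (V → Ω) → ℝ}
    (hK : ∀ n r, BddMeas (fun q : Ω × Ω => K n r q.1 q.2)) (hK0 : ∀ n r x y, 0 ≤ K n r x y)
    (hL : ∀ n r, BddMeas (fun q : Ω × Ω => L n r q.1 q.2)) (hL0 : ∀ n r x y, 0 ≤ L n r x y)
    (hLB : ∀ n r x y, L n r x y ≤ B) (hB : 0 ≤ B)
    (hg : ∀ n, BddMeas (g n)) (hg1 : ∀ n x, |g n x| ≤ 1)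
    (hmom : ∀ r q, ∃ D : ℝ, ∀ n, ∫ x, ∫ y, K n r x y ^ (q + 1) ∂μ ∂μ ≤ D)
    (hclose : ∀ r, ∀ δ > 0, ∀ᶠ n in l, ∫ x, ∫ y, |K n r x y - L n r x y| ∂μ ∂μ ≤ δ) :
    ∀ δ > 0, ∀ᶠ n in l,
      |∫ x : V → Ω, (∏ r, K n r (x (u r)) (x (v r))) * g n x ∂(Measure.pi fun _ => μ) -
        ∫ x : V → Ω, (∏ r, L n r (x (u r)) (x (v r))) * g n x ∂(Measure.pi fun _ => μ)| ≤ δ := by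
  intro δ hδ
  set m := Fintype.card E with hm
  set q := 2 * m with hq
  choose D hD using fun r => hmom r q
  set Q : ℝ := 1 + B with hQ
  have hQ1 : 1 ≤ Q := by linarith
  set H : ℝ := 2 ^ q * (Q ^ (q + 1) + (m : ℝ) ^ q * ∑ r, |D r|) with hH
  have hH0 : 0 < H := by positivity
  set M : ℝ := 2 * (m + 1) * H / δ with hM
  have hM0 : 0 < M := by positivity
  have hev : ∀ᶠ n in l, ∀ r, ∫ x, ∫ y, |K n r x y - L n r x y| ∂μ ∂μ ≤ δ / (2 * (m + 1) * M) :=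
    eventually_all.2 fun r => hclose r _ (by positivity)
  filter_upwards [hev] with n hn
  have hKp := BddMeas.prod Finset.univ fun r (_ : r ∈ Finset.univ) => (hK n r).pair (u r) (v r)
  have hLp := BddMeas.prod Finset.univ fun r (_ : r ∈ Finset.univ) => (hL n r).pair (u r) (v r)
  rw [← integral_sub ((hKp.mul (hg n)).integrable _) ((hLp.mul (hg n)).integrable _)]
  refine (abs_integral_le_integral_abs).trans ?_
  have hd : ∀ r, BddMeas (fun x : V → Ω => |K n r (x (u r)) (x (v r)) - L n r (x (u r)) (x (v r))|) :=
    fun r => (((hK n r).pair (u r) (v r)).sub ((hL n r).pair (u r) (v r))).abs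
  have hKq : ∀ r, BddMeas (fun x : V → Ω => K n r (x (u r)) (x (v r)) ^ (q + 1)) :=
    fun r => ((hK n r).pair (u r) (v r)).pow _
  have hpt : ∀ x : V → Ω, |(∏ r, K n r (x (u r)) (x (v r))) * g n x -
      (∏ r, L n r (x (u r)) (x (v r))) * g n x| ≤
      (∑ r, M * |K n r (x (u r)) (x (v r)) - L n r (x (u r)) (x (v r))|) +
        m * (2 ^ q * (Q ^ (q + 1) + m ^ q * ∑ r, K n r (x (u r)) (x (v r)) ^ (q + 1)) / M) := by
    intro x
    set Z : ℝ := Q + ∑ r, K n r (x (u r)) (x (v r)) with hZ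
    have hs0 : 0 ≤ ∑ r, K n r (x (u r)) (x (v r)) := Finset.sum_nonneg fun r _ => hK0 n r _ _
    have hKs : ∀ r, K n r (x (u r)) (x (v r)) ≤ ∑ r, K n r (x (u r)) (x (v r)) := fun r =>
      Finset.single_le_sum (f := fun r => K n r (x (u r)) (x (v r)))
        (fun r _ => hK0 n r _ _) (Finset.mem_univ r)
    have hKZ : ∀ r, K n r (x (u r)) (x (v r)) ≤ Z := fun r => by linarith [hKs r]
    have hLZ : ∀ r, L n r (x (u r)) (x (v r)) ≤ Z := fun r => by
      linarith [hLB n r (x (u r)) (x (v r))]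
    have h1 := abs_prod_sub_prod_le Finset.univ (Z := Z) (by linarith)
      (fun r _ => hK0 n r (x (u r)) (x (v r))) (fun r _ => hKZ r)
      (fun r _ => hL0 n r (x (u r)) (x (v r))) (fun r _ => hLZ r)
    rw [← sub_mul, abs_mul]
    calc _ ≤ |∏ r, K n r (x (u r)) (x (v r)) - ∏ r, L n r (x (u r)) (x (v r))| * 1 :=
          mul_le_mul_of_nonneg_left (hg1 n x) (abs_nonneg _)
      _ ≤ (∑ r, |K n r (x (u r)) (x (v r)) - L n r (x (u r)) (x (v r))|) * Z ^ m := by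
          rw [mul_one]; exact h1
      _ = ∑ r, |K n r (x (u r)) (x (v r)) - L n r (x (u r)) (x (v r))| * Z ^ m :=
          Finset.sum_mul _ _ _
      _ ≤ ∑ r, (M * |K n r (x (u r)) (x (v r)) - L n r (x (u r)) (x (v r))| +
            2 ^ q * (Q ^ (q + 1) + m ^ q * ∑ r, K n r (x (u r)) (x (v r)) ^ (q + 1)) / M) := by
          refine Finset.sum_le_sum fun r _ => ?_
          have hdZ : |K n r (x (u r)) (x (v r)) - L n r (x (u r)) (x (v r))| ≤ Z := by
            rw [abs_le]
            constructor <;> linarith [hKZ r, hLZ r, hK0 n r (x (u r)) (x (v r)),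
              hL0 n r (x (u r)) (x (v r))]
          refine (mul_pow_le_truncation (abs_nonneg _) hdZ hM0 m).trans ?_
          gcongr
          exact pow_const_add_sum_le Finset.univ (by linarith)
            (fun r _ => hK0 n r (x (u r)) (x (v r))) q
      _ = _ := by
          rw [Finset.sum_add_distrib, Finset.sum_const, nsmul_eq_mul, Finset.card_univ]
  have hR1 := BddMeas.sum Finset.univ fun r (_ : r ∈ Finset.univ) => (BddMeas.const M).mul (hd r)
  have hR2 : BddMeas (fun x : V → Ω => Q ^ (q + 1) +
      (m : ℝ) ^ q * ∑ r, K n r (x (u r)) (x (v r)) ^ (q + 1)) :=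
    (BddMeas.const _).add ((BddMeas.const _).mul (BddMeas.sum _ fun r _ => hKq r))
  have hR3 : BddMeas (fun x : V → Ω => (m : ℝ) * (2 ^ q * (Q ^ (q + 1) + m ^ q *
      ∑ r, K n r (x (u r)) (x (v r)) ^ (q + 1)) / M)) := by
    simp only [div_eq_mul_inv]
    exact (BddMeas.const _).mul (((BddMeas.const _).mul hR2).mul (BddMeas.const _))
  refine (BddMeas.integral_mono ((hKp.mul (hg n)).sub (hLp.mul (hg n))).abs (hR1.add hR3)
    hpt).trans ?_
  rw [integral_add (hR1.integrable _) (hR3.integrable _), integral_finsetSum _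
    (fun r _ => ((BddMeas.const M).mul (hd r)).integrable _)]
  have hI1 : ∀ r, ∫ x : V → Ω, M * |K n r (x (u r)) (x (v r)) - L n r (x (u r)) (x (v r))|
      ∂(Measure.pi fun _ => μ) ≤ M * (δ / (2 * (m + 1) * M)) := by
    intro r
    rw [integral_const_mul]
    refine mul_le_mul_of_nonneg_left ?_ hM0.le
    rw [integral_pi_pair (huv r) (f := fun x y => |K n r x y - L n r x y|)
      ((hK n r).sub (hL n r)).abs]
    exact hn r
  have hI2 : ∫ x : V → Ω, ((m : ℝ) * (2 ^ q * (Q ^ (q + 1) + m ^ q *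
      ∑ r, K n r (x (u r)) (x (v r)) ^ (q + 1)) / M)) ∂(Measure.pi fun _ => μ) ≤ m * (H / M) := by
    rw [integral_const_mul, integral_div, integral_const_mul, integral_add (integrable_const _)
      (((BddMeas.const _).mul (BddMeas.sum _ fun r _ => hKq r)).integrable _), integral_const_mul,
      integral_finsetSum _ (fun r _ => (hKq r).integrable _), integral_const]
    simp only [probReal_univ, one_smul]
    rw [hH]
    gcongr with r _
    rw [integral_pi_pair (huv r) (f := fun x y => K n r x y ^ (q + 1)) ((hK n r).pow _)]
    exact (hD r n).trans (le_abs_self _)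
  calc _ ≤ (∑ _r : E, M * (δ / (2 * (m + 1) * M))) + m * (H / M) :=
        add_le_add (Finset.sum_le_sum fun r _ => hI1 r) hI2
    _ = m / (m + 1) * δ := by
        rw [Finset.sum_const, nsmul_eq_mul, Finset.card_univ, ← hm, hM]
        field_simp
        ring
    _ ≤ 1 * δ := by
        gcongr
        rw [div_le_one (by positivity)]
        linarith
    _ = δ := one_mul δ

end Products

section SubdivisionIntegral

variable {Ω : Type*} [MeasurableSpace Ω] {μ : Measure Ω} [IsProbabilityMeasure μ]

lemma integral_pi_prod_rows {E J : Type*} [Fintype E] [Fintype J]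
    (f : E → (J → Ω) → ℝ) (hf : ∀ r, Measurable (f r)) :
    ∫ z : E × J → Ω, ∏ r, f r (fun t => z (r, t)) ∂(Measure.pi fun _ => μ) =
      ∏ r, ∫ w, f r w ∂(Measure.pi fun _ => μ) := by
  have hmap := Measure.infinitePi_map_curry (ι := E) (κ := J) (X := Ω) (μ := fun _ _ => μ)
  simp only [Measure.infinitePi_eq_pi] at hmap
  rw [← integral_fintype_prod_eq_prod, ← hmap, integral_map]
  · rfl
  · exact (MeasurableEquiv.measurable _).aemeasurable
  · refine Measurable.aestronglyMeasurable ?_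
    exact Finset.measurable_prod _ fun r _ => (hf r).comp (measurable_pi_apply r)

lemma apply_pv {α : Type*} {k m J : ℕ} (u v : Fin m → Fin k)
    (x : Fin k ⊕ (Fin m × Fin (J + 1 - 1)) → α) (r : Fin m) (i : ℕ) :
    x (pv (J + 1) u v r i) = walkVertex (j := J) (x (Sum.inl (u r)))
      (fun t => x (Sum.inr (r, t))) (x (Sum.inl (v r))) i := by
  unfold pv walkVertex
  split_ifs <;> rfl

lemma subdivision_weight_eq {Ω : Type*} {k m J : ℕ} (u v : Fin m → Fin k) (W : Ω → Ω → ℝ)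
    (χ : Fin k ⊕ (Fin m × Fin (J + 1 - 1)) → Ω → ℝ) (hχ : ∀ a x, χ a x = 0 ∨ χ a x = 1)
    (x : Fin k ⊕ (Fin m × Fin (J + 1 - 1)) → Ω) :
    (∏ r, ∏ i ∈ Finset.range (J + 1), W (x (pv (J + 1) u v r i)) (x (pv (J + 1) u v r (i + 1)))) *
      ∏ a, χ a (x a) =
    (∏ r, walkWeight W (fun i => χ (pv (J + 1) u v r i)) J (walkVertex (j := J) (x (Sum.inl (u r)))
      (fun t => x (Sum.inr (r, t))) (x (Sum.inl (v r))))) *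
      ∏ a, χ (Sum.inl a) (x (Sum.inl a)) := by
  simp only [walkWeight, ← apply_pv, Finset.prod_mul_distrib, mul_assoc]
  congr 1
  by_cases h : ∀ a, χ a (x a) = 1
  · simp [h]
  · push Not at h
    obtain ⟨a, ha⟩ := h
    have ha0 := (hχ a (x a)).resolve_right ha
    rw [Finset.prod_eq_zero (Finset.mem_univ a) ha0]
    rcases a with a | ⟨r, t⟩
    · rw [Finset.prod_eq_zero (Finset.mem_univ a) ha0, mul_zero]
    · have hpv : pv (J + 1) u v r (t + 1) = Sum.inr (r, t) := by
        have : (t : ℕ) + 1 < J + 1 := by have := t.2; omega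
        simp [pv, this]
      have : ∏ i ∈ Finset.range (J + 2), χ (pv (J + 1) u v r i) (x (pv (J + 1) u v r i)) = 0 := by
        refine Finset.prod_eq_zero (i := (t : ℕ) + 1) ?_ ?_
        · have := t.2
          rw [Finset.mem_range]; omega
        · rw [hpv]; exact ha0
      rw [Finset.prod_eq_zero (Finset.mem_univ r) this, zero_mul]

/-- Integrating out the internal vertices of the subdivided edges. -/
lemma integral_subdivision_eq {k m J : ℕ} (u v : Fin m → Fin k) {W : Ω → Ω → ℝ}
    (hW : BddMeas (fun q : Ω × Ω => W q.1 q.2))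
    {χ : Fin k ⊕ (Fin m × Fin (J + 1 - 1)) → Ω → ℝ} (hχm : ∀ a, Measurable (χ a))
    (hχ : ∀ a x, χ a x = 0 ∨ χ a x = 1) :
    ∫ x : Fin k ⊕ (Fin m × Fin (J + 1 - 1)) → Ω,
      (∏ r, ∏ i ∈ Finset.range (J + 1),
        W (x (pv (J + 1) u v r i)) (x (pv (J + 1) u v r (i + 1)))) *
        ∏ a, χ a (x a) ∂(Measure.pi fun _ => μ) =
    ∫ y : Fin k → Ω, (∏ r, walkKer μ W (fun i => χ (pv (J + 1) u v r i)) J (y (u r)) (y (v r))) *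
      ∏ a, χ (Sum.inl a) (y a) ∂(Measure.pi fun _ => μ) := by
  have hw : ∀ r, IsWeight (fun i => χ (pv (J + 1) u v r i)) := fun r =>
    ⟨fun i => hχm _, fun i x => by rcases hχ (pv (J + 1) u v r i) x with h | h <;> rw [h] <;>
      norm_num, fun i x => by rcases hχ (pv (J + 1) u v r i) x with h | h <;> rw [h] <;> norm_num⟩
  have hχb : ∀ a, BddMeas (χ a) := fun a => BddMeas.of_bound (hχm a) 1 fun x => by
    rcases hχ a x with h | h <;> rw [h] <;> norm_num
  simp only [subdivision_weight_eq u v W χ hχ]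
  set Φ : (Fin k → Ω) × (Fin m × Fin J → Ω) → ℝ := fun q =>
    (∏ r, walkWeight W (fun i => χ (pv (J + 1) u v r i)) J (walkVertex (j := J) (q.1 (u r))
      (fun t => q.2 (r, t)) (q.1 (v r)))) * ∏ a, χ (Sum.inl a) (q.1 a) with hΦ
  have hΦm : BddMeas Φ := by
    refine (BddMeas.prod _ fun r _ => ?_).mul (BddMeas.prod _ fun a _ =>
      (hχb (Sum.inl a)).comp ((measurable_pi_apply a).comp measurable_fst))
    refine walkWeight_bddMeas hW (hw r) (fun i => ?_) J
    have hz : Measurable (fun (q : (Fin k → Ω) × (Fin m × Fin J → Ω)) (t : Fin J) => q.2 (r, t)) :=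
      measurable_pi_lambda _ fun t => (measurable_pi_apply (r, t)).comp measurable_snd
    exact measurable_walkVertex ((measurable_pi_apply (u r)).comp measurable_fst) hz
      ((measurable_pi_apply (v r)).comp measurable_fst) i
  have hmp := measurePreserving_sumPiEquivProdPi
    (X := fun _ : Fin k ⊕ (Fin m × Fin J) => Ω) (fun _ => μ)
  have e1 := hmp.integral_comp' Φ
  refine Eq.trans (b := ∫ q, Φ q ∂((Measure.pi fun _ => μ).prod (Measure.pi fun _ => μ))) e1 ?_
  rw [integral_prod _ (hΦm.integrable _)]
  refine integral_congr_ae (Eventually.of_forall fun y => ?_)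
  simp only [hΦ]
  rw [integral_mul_const]
  congr 1
  rw [integral_pi_prod_rows (fun r w => walkWeight W (fun i => χ (pv (J + 1) u v r i)) J
    (walkVertex (j := J) (y (u r)) w (y (v r))))]
  · refine Finset.prod_congr rfl fun r _ => ?_
    rw [walkKer_eq_integral hW (hw r)]
  · intro r
    refine (walkWeight_bddMeas hW (hw r) (fun i => ?_) J).1
    exact measurable_walkVertex measurable_const measurable_id measurable_const i

end SubdivisionIntegral

section Rainbow

lemma pv_injOn {k m J : ℕ} {u v : Fin m → Fin k} (huv : ∀ r, u r ≠ v r) (r : Fin m) {a b : ℕ}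
    (ha : a < J + 2) (hb : b < J + 2) (hab : pv (J + 1) u v r a = pv (J + 1) u v r b) : a = b := by
  unfold pv at hab
  split_ifs at hab
  all_goals first
    | omega
    | (simp only [Sum.inr.injEq, Prod.mk.injEq, Fin.mk.injEq, true_and] at hab; omega)
    | exact absurd (Sum.inl.inj hab) (huv r)
    | exact absurd (Sum.inl.inj hab).symm (huv r)

/-- The product of `W` over the edges of a subdivided multigraph. -/
def subdivWeight {α : Type*} {k m : ℕ} (J : ℕ) (u v : Fin m → Fin k) (W : α → α → ℝ)
    (x : Fin k ⊕ (Fin m × Fin (J + 1 - 1)) → α) : ℝ :=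
  ∏ r, ∏ i ∈ Finset.range (J + 1), W (x (pv (J + 1) u v r i)) (x (pv (J + 1) u v r (i + 1)))

lemma subdivWeight_bddMeas {Ω : Type*} [MeasurableSpace Ω] {k m : ℕ} (J : ℕ) (u v : Fin m → Fin k)
    {W : Ω → Ω → ℝ} (hW : BddMeas (fun q : Ω × Ω => W q.1 q.2)) :
    BddMeas (subdivWeight J u v W) :=
  BddMeas.prod _ fun _ _ => BddMeas.prod _ fun _ _ => hW.pair _ _

lemma subdivWeight_nonneg {α : Type*} {k m : ℕ} (J : ℕ) (u v : Fin m → Fin k)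
    {W : α → α → ℝ} (hW : ∀ x y, 0 ≤ W x y) (x) : 0 ≤ subdivWeight J u v W x :=
  Finset.prod_nonneg fun _ _ => Finset.prod_nonneg fun _ _ => hW _ _

lemma subdivWeight_le {α : Type*} {k m : ℕ} (J : ℕ) (u v : Fin m → Fin k)
    {W : α → α → ℝ} {C : ℝ} (hW : ∀ x y, 0 ≤ W x y) (hC : ∀ x y, W x y ≤ C) (x) :
    subdivWeight J u v W x ≤ C ^ (m * (J + 1)) := by
  calc subdivWeight J u v W x ≤ ∏ _r : Fin m, ∏ _i ∈ Finset.range (J + 1), C :=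
        Finset.prod_le_prod (fun _ _ => Finset.prod_nonneg fun _ _ => hW _ _) fun r _ =>
          Finset.prod_le_prod (fun _ _ => hW _ _) fun i _ => hC _ _
    _ = _ := by simp [pow_mul, pow_right_comm]

lemma colourWeight_eq_zero_or_one {n : ℕ} [NeZero n] {γ : Type*} (col : Fin n → γ) (c : γ) (x : ℝ) :
    colourWeight col c x = 0 ∨ colourWeight col c x = 1 := by
  unfold colourWeight
  split_ifs <;> simp

lemma measurable_colourWeight {n : ℕ} [NeZero n] {γ : Type*} (col : Fin n → γ) (c : γ) :
    Measurable (colourWeight col c) :=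
  (bddMeas_idxFin fun i => if col i = c then (1 : ℝ) else 0).1

/-- Indicator of injectivity. -/
noncomputable def injInd {V γ : Type*} (f : V → γ) : ℝ := if Function.Injective f then 1 else 0

lemma injInd_eq_zero_or_one {V γ : Type*} (f : V → γ) : injInd f = 0 ∨ injInd f = 1 := by
  unfold injInd
  split_ifs <;> simp

lemma injInd_nonneg {V γ : Type*} (f : V → γ) : 0 ≤ injInd f := by
  rcases injInd_eq_zero_or_one f with h | h <;> simp [h]

lemma injInd_le_one {V γ : Type*} (f : V → γ) : injInd f ≤ 1 := by
  rcases injInd_eq_zero_or_one f with h | h <;> simp [h]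

/-- Indicator that the colours of the vertices of a map are distinct. -/
noncomputable def rainbow {V : Type*} {n : ℕ} [NeZero n] {γ : Type*} (col : Fin n → γ)
    (x : V → ℝ) : ℝ :=
  injInd fun a => col (idxFin n (x a))

lemma rainbow_eq_sum {V : Type*} [Fintype V] [DecidableEq V] {n : ℕ} [NeZero n] {γ : Type*}
    [Fintype γ] (col : Fin n → γ) (x : V → ℝ) :
    rainbow col x = ∑ c : V → γ, if Function.Injective c then ∏ a, colourWeight col (c a) (x a)
      else 0 := by
  rw [Finset.sum_eq_single fun a => col (idxFin n (x a))]
  · simp [rainbow, injInd, colourWeight]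
  · intro c _ hc
    split_ifs
    · obtain ⟨a, ha⟩ := Function.ne_iff.1 hc
      exact Finset.prod_eq_zero (Finset.mem_univ a) (by simp [colourWeight, ha.symm])
    · rfl
  · simp

lemma rainbow_bddMeas {V : Type*} [Fintype V] {n : ℕ} [NeZero n] {γ : Type*} (col : Fin n → γ) :
    BddMeas (fun x : V → ℝ => rainbow col x) := by
  refine BddMeas.of_bound ?_ 1 fun x => ?_
  · have h : Measurable fun (x : V → ℝ) (a : V) => idxFin n (x a) :=
      measurable_pi_lambda _ fun a => measurable_idxFin.comp (measurable_pi_apply a)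
    exact (measurable_of_finite fun φ : V → Fin n => injInd fun a => col (φ a)).comp h
  · rw [rainbow, abs_of_nonneg (injInd_nonneg _)]
    exact injInd_le_one _

namespace SparseApprox

variable {C : ℝ} {j : ℕ} {p : ℕ → ℝ} {G : ∀ n, SimpleGraph (Fin (n + 1))} {U : ℕ → ℝ → ℝ → ℝ}

lemma coloured_close (h : SparseApprox C j p G U) {k m : ℕ} {u v : Fin m → Fin k}
    (huv : ∀ r, u r ≠ v r) {γ : Type*} (col : ∀ n, Fin (n + 1) → γ)
    {c : Fin k ⊕ (Fin m × Fin (j + 1 + 1 - 1)) → γ} (hc : Function.Injective c) {δ : ℝ}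
    (hδ : 0 < δ) :
    ∀ᶠ n in atTop, |∫ x, subdivWeight (j + 1) u v (stepKer (p n) (G n)) x *
        ∏ a, colourWeight (col n) (c a) (x a) ∂(Measure.pi fun _ => unitMeasure) -
      ∫ x, subdivWeight (j + 1) u v (U n) x *
        ∏ a, colourWeight (col n) (c a) (x a) ∂(Measure.pi fun _ => unitMeasure)| ≤ δ := by
  have hinj : ∀ r a b, a < j + 3 → b < j + 3 → c (pv (j + 1 + 1) u v r a) =
      c (pv (j + 1 + 1) u v r b) → a = b := fun r a b ha hb hab =>
    pv_injOn huv r ha hb (hc hab)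
  have hχ : ∀ n r, IsWeight (fun i => colourWeight (col n) (c (pv (j + 1 + 1) u v r i))) :=
    fun n r => colourWeight_isWeight (col n) fun i => c (pv (j + 1 + 1) u v r i)
  have key := integral_prod_close (μ := unitMeasure) (l := atTop) u v huv (B := C ^ (j + 2))
    (K := fun n r => walkKer unitMeasure (stepKer (p n) (G n))
      (fun i => colourWeight (col n) (c (pv (j + 1 + 1) u v r i))) (j + 1))
    (L := fun n r => walkKer unitMeasure (U n)
      (fun i => colourWeight (col n) (c (pv (j + 1 + 1) u v r i))) (j + 1))
    (g := fun n y => ∏ a, colourWeight (col n) (c (Sum.inl a)) (y a))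
    (fun n r => walkKer_bddMeas stepKer_bddMeas (hχ n r) _)
    (fun n r => walkKer_nonneg (stepKer_nonneg (h.p_pos n)) (hχ n r) _)
    (fun n r => walkKer_bddMeas (h.meas n) (hχ n r) _)
    (fun n r => walkKer_nonneg (h.nonneg n) (hχ n r) _)
    (fun n r => walkKer_le (h.meas n) (h.nonneg n) (h.le n) (hχ n r) (j + 1))
    (pow_nonneg h.C_pos.le _)
    (fun n => BddMeas.prod _ fun a _ => (BddMeas.of_bound (measurable_colourWeight _ _) 1
      fun x => by rcases colourWeight_eq_zero_or_one (col n) (c (Sum.inl a)) x with h | h <;>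
        rw [h] <;> norm_num).comp (measurable_pi_apply a)) ?_
    (fun r q => h.moments col (fun i => c (pv (j + 1 + 1) u v r i)) (hinj r) q)
    (fun r δ hδ => h.close col (fun i => c (pv (j + 1 + 1) u v r i)) (hinj r) hδ) δ hδ
  · filter_upwards [key] with n hn
    have e := fun (W : ℝ → ℝ → ℝ) (hW : BddMeas (fun q : ℝ × ℝ => W q.1 q.2)) =>
      integral_subdivision_eq (μ := unitMeasure) (J := j + 1) u v hW
        (χ := fun a => colourWeight (col n) (c a)) (fun a => measurable_colourWeight _ _)
        (fun a => colourWeight_eq_zero_or_one _ _)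
    simp only [subdivWeight]
    rw [e _ stepKer_bddMeas, e _ (h.meas n)]
    exact hn
  · intro n x
    rw [Finset.abs_prod]
    refine Finset.prod_le_one (fun a _ => abs_nonneg _) fun a _ => ?_
    rcases colourWeight_eq_zero_or_one (col n) (c (Sum.inl a)) (x a) with h | h <;>
        rw [h] <;> norm_num

lemma rainbow_close (h : SparseApprox C j p G U) {k m : ℕ} {u v : Fin m → Fin k}
    (huv : ∀ r, u r ≠ v r) {γ : Type*} [Fintype γ] (col : ∀ n, Fin (n + 1) → γ) {δ : ℝ}
    (hδ : 0 < δ) :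
    ∀ᶠ n in atTop, |∫ x, subdivWeight (j + 1) u v (stepKer (p n) (G n)) x * rainbow (col n) x
        ∂(Measure.pi fun _ => unitMeasure) -
      ∫ x, subdivWeight (j + 1) u v (U n) x * rainbow (col n) x
        ∂(Measure.pi fun _ => unitMeasure)| ≤ δ := by
  set N := Fintype.card (Fin k ⊕ (Fin m × Fin (j + 1 + 1 - 1)) → γ) with hN
  have hev : ∀ᶠ n in atTop, ∀ c : Fin k ⊕ (Fin m × Fin (j + 1 + 1 - 1)) → γ,
      Function.Injective c → |∫ x, subdivWeight (j + 1) u v (stepKer (p n) (G n)) x *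
        ∏ a, colourWeight (col n) (c a) (x a) ∂(Measure.pi fun _ => unitMeasure) -
      ∫ x, subdivWeight (j + 1) u v (U n) x *
        ∏ a, colourWeight (col n) (c a) (x a) ∂(Measure.pi fun _ => unitMeasure)| ≤
          δ / (N + 1) := by
    refine eventually_all.2 fun c => ?_
    by_cases hc : Function.Injective c
    · filter_upwards [h.coloured_close huv col hc (show 0 < δ / (N + 1) by positivity)] with n hn _
      exact hn
    · exact Eventually.of_forall fun n hc' => absurd hc' hc
  filter_upwards [hev] with n hn
  have hcb : ∀ c : Fin k ⊕ (Fin m × Fin (j + 1 + 1 - 1)) → γ,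
      BddMeas (fun x : Fin k ⊕ (Fin m × Fin (j + 1 + 1 - 1)) → ℝ =>
        ∏ a, colourWeight (col n) (c a) (x a)) := fun c =>
    BddMeas.prod _ fun a _ => (BddMeas.of_bound (measurable_colourWeight _ _) 1
      fun x => by rcases colourWeight_eq_zero_or_one (col n) (c a) x with h | h <;>
        rw [h] <;> norm_num).comp (measurable_pi_apply a)
  have e : ∀ W : ℝ → ℝ → ℝ, BddMeas (fun q : ℝ × ℝ => W q.1 q.2) →
      ∫ x, subdivWeight (j + 1) u v W x * rainbow (col n) x
        ∂(Measure.pi fun _ => unitMeasure) = ∑ c : Fin k ⊕ (Fin m × Fin (j + 1 + 1 - 1)) → γ,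
      if Function.Injective c then ∫ x, subdivWeight (j + 1) u v W x *
        ∏ a, colourWeight (col n) (c a) (x a) ∂(Measure.pi fun _ => unitMeasure) else 0 := by
    intro W hW
    have hWb := subdivWeight_bddMeas (j + 1) u v hW
    simp only [rainbow_eq_sum, Finset.mul_sum]
    rw [integral_finsetSum]
    · refine Finset.sum_congr rfl fun c _ => ?_
      split_ifs <;> simp
    · intro c _
      split_ifs
      · exact (hWb.mul (hcb c)).integrable _
      · exact (hWb.mul (BddMeas.const 0)).integrable _
  rw [e _ stepKer_bddMeas, e _ (h.meas n), ← Finset.sum_sub_distrib]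
  calc _ ≤ ∑ _c : Fin k ⊕ (Fin m × Fin (j + 1 + 1 - 1)) → γ, δ / (N + 1) := by
        refine (Finset.abs_sum_le_sum_abs _ _).trans (Finset.sum_le_sum fun c _ => ?_)
        split_ifs with hc
        · exact hn c hc
        · simp; positivity
    _ = N / (N + 1) * δ := by
        rw [Finset.sum_const, nsmul_eq_mul, Finset.card_univ, ← hN]; ring
    _ ≤ 1 * δ := by
        gcongr
        rw [div_le_one (by positivity)]
        linarith
    _ = δ := one_mul δ

end SparseApprox

end Rainbow

section Counting

lemma mul_card_eq_apply_le {n R : ℕ} {x y : Fin n} (hxy : x ≠ y) :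
    (∑ col : Fin n → Fin R, if col x = col y then (1 : ℝ) else 0) * R ≤ (R : ℝ) ^ n := by
  have h := Fintype.card_le_of_injective
    (fun q : {col : Fin n → Fin R // col x = col y} × Fin R => Function.update q.1.1 x q.2) ?_
  · rw [Fintype.card_prod, Fintype.card_subtype, Fintype.card_fun, Fintype.card_fin,
      Fintype.card_fin] at h
    rw [Finset.sum_boole]
    exact_mod_cast h
  · rintro ⟨⟨f, hf⟩, a⟩ ⟨⟨g, hg⟩, b⟩ h
    simp only at h
    have hoff : ∀ z, z ≠ x → f z = g z := fun z hz => by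
      simpa [hz] using congrFun h z
    have hab : a = b := by simpa using congrFun h x
    refine Prod.ext (Subtype.ext (funext fun z => ?_)) hab
    by_cases hz : z = x
    · change f z = g z
      rw [hz, hf, hg, hoff y hxy.symm]
    · exact hoff z hz

/-- Indicator that two distinct points have the same image. -/
noncomputable def collision {V γ : Type*} (f : V → γ) (a b : V) : ℝ :=
  if a ≠ b ∧ f a = f b then 1 else 0

lemma collision_nonneg {V γ : Type*} (f : V → γ) (a b : V) : 0 ≤ collision f a b := by
  unfold collision
  split_ifs <;> norm_num

lemma one_sub_injInd_le {V γ : Type*} [Fintype V] (f : V → γ) :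
    1 - injInd f ≤ ∑ a : V, ∑ b : V, collision f a b := by
  by_cases hf : Function.Injective f
  · rw [injInd, if_pos hf, sub_self]
    exact Finset.sum_nonneg fun a _ => Finset.sum_nonneg fun b _ => collision_nonneg f a b
  · rw [injInd, if_neg hf, sub_zero]
    simp only [Function.Injective, not_forall] at hf
    obtain ⟨a, b, hab, hne⟩ := hf
    calc (1 : ℝ) = collision f a b := (if_pos ⟨hne, hab⟩).symm
      _ ≤ ∑ b : V, collision f a b :=
          Finset.single_le_sum (fun b _ => collision_nonneg f a b) (Finset.mem_univ b)
      _ ≤ _ := Finset.single_le_sum (f := fun a => ∑ b : V, collision f a b)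
            (fun a _ => Finset.sum_nonneg fun b _ => collision_nonneg f a b) (Finset.mem_univ a)

lemma sum_collision_comp_le {V : Type*} {n R : ℕ} (hR : 0 < R) {φ : V → Fin n}
    (hφ : Function.Injective φ) (a b : V) :
    ∑ col : Fin n → Fin R, collision (fun a => col (φ a)) a b ≤ (R : ℝ) ^ n / R := by
  have hR' : (0 : ℝ) < R := by exact_mod_cast hR
  by_cases hab : a = b
  · simp only [collision, hab, ne_eq, not_true_eq_false, false_and, if_false,
      Finset.sum_const_zero]
    positivity
  · rw [le_div_iff₀ hR']
    refine le_trans (le_of_eq ?_) (mul_card_eq_apply_le (R := R) (hφ.ne hab))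
    simp only [collision, ne_eq, hab, not_false_eq_true, true_and]

lemma le_sum_injInd_comp {V : Type*} [Fintype V] {n R : ℕ} (hR : 0 < R) {φ : V → Fin n}
    (hφ : Function.Injective φ) :
    (1 - (Fintype.card V : ℝ) ^ 2 / R) * (R : ℝ) ^ n ≤
      ∑ col : Fin n → Fin R, injInd fun a => col (φ a) := by
  have h1 : ∑ col : Fin n → Fin R, (1 - injInd fun a => col (φ a)) ≤
      (Fintype.card V : ℝ) ^ 2 / R * (R : ℝ) ^ n := by
    calc _ ≤ ∑ col : Fin n → Fin R, ∑ a : V, ∑ b : V, collision (fun a => col (φ a)) a b :=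
          Finset.sum_le_sum fun col _ => one_sub_injInd_le _
      _ = ∑ a : V, ∑ b : V, ∑ col : Fin n → Fin R, collision (fun a => col (φ a)) a b := by
          rw [Finset.sum_comm]
          exact Finset.sum_congr rfl fun a _ => Finset.sum_comm
      _ ≤ ∑ a : V, ∑ b : V, (R : ℝ) ^ n / R :=
          Finset.sum_le_sum fun a _ => Finset.sum_le_sum fun b _ =>
            sum_collision_comp_le hR hφ a b
      _ = _ := by
          simp only [Finset.sum_const, Finset.card_univ, nsmul_eq_mul]
          ring
  rw [Finset.sum_sub_distrib] at h1
  simp only [Finset.sum_const, Finset.card_univ, Fintype.card_fun, Fintype.card_fin, nsmul_eq_mul,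
    mul_one, Nat.cast_pow] at h1
  linarith

/-- Indicator of adjacency. -/
noncomputable def adjInd {α : Type*} (G : SimpleGraph α) (a b : α) : ℝ :=
  if G.Adj a b then 1 else 0

lemma adjInd_nonneg {α : Type*} (G : SimpleGraph α) (a b : α) : 0 ≤ adjInd G a b := by
  unfold adjInd
  split_ifs <;> norm_num

/-- The number of injective maps of a subdivision into a graph which are compatible with `col`. -/
noncomputable def rainbowCount {n k m : ℕ} {γ : Type*} (J : ℕ) (u v : Fin m → Fin k)
    (G : SimpleGraph (Fin n)) (col : Fin n → γ) : ℝ :=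
  ∑ φ : Fin k ⊕ (Fin m × Fin (J + 1 - 1)) → Fin n,
    subdivWeight J u v (adjInd G) φ * injInd fun a => col (φ a)

variable {n k m : ℕ} {γ : Type*} {J : ℕ} {u v : Fin m → Fin k} {G : SimpleGraph (Fin n)}

lemma rainbowCount_le_rainbowCount_id (col : Fin n → γ) :
    rainbowCount J u v G col ≤ rainbowCount J u v G id := by
  refine Finset.sum_le_sum fun φ _ =>
    mul_le_mul_of_nonneg_left ?_ (subdivWeight_nonneg _ _ _ (adjInd_nonneg G) _)
  by_cases h : Function.Injective fun a => col (φ a)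
  · have : Function.Injective fun a => id (φ a) := fun a b hab => h (congrArg col hab)
    simp only [injInd, if_pos h, if_pos this, le_refl]
  · rw [injInd, if_neg h]
    exact injInd_nonneg _

lemma exists_rainbowCount_ge {R : ℕ} (hR : 0 < R) :
    ∃ col : Fin n → Fin R,
      (1 - (Fintype.card (Fin k ⊕ (Fin m × Fin (J + 1 - 1))) : ℝ) ^ 2 / R) *
        rainbowCount J u v G id ≤ rainbowCount J u v G col := by
  have : NeZero R := ⟨hR.ne'⟩
  set q : ℝ := 1 - (Fintype.card (Fin k ⊕ (Fin m × Fin (J + 1 - 1))) : ℝ) ^ 2 / R with hq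
  have h : ∑ _col : Fin n → Fin R, q * rainbowCount J u v G id ≤
      ∑ col : Fin n → Fin R, rainbowCount J u v G col := by
    simp only [rainbowCount]
    rw [Finset.sum_comm, Finset.sum_const, nsmul_eq_mul, Finset.mul_sum, Finset.mul_sum]
    refine Finset.sum_le_sum fun φ _ => ?_
    rw [← Finset.mul_sum]
    have hw := subdivWeight_nonneg J u v (adjInd_nonneg G) φ
    by_cases hφ : Function.Injective φ
    · have := mul_le_mul_of_nonneg_left (le_sum_injInd_comp hR hφ) hw
      have h1 : (injInd fun a => id (φ a)) = 1 := if_pos hφ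
      rw [h1]
      simp only [Finset.card_univ, Fintype.card_fun, Fintype.card_fin, Nat.cast_pow]
      calc _ = subdivWeight J u v (adjInd G) φ * (q * (R : ℝ) ^ n) := by ring
        _ ≤ _ := this
    · have h1 : (injInd fun a => id (φ a)) = 0 := if_neg hφ
      rw [h1]
      simp only [mul_zero]
      exact mul_nonneg hw (Finset.sum_nonneg fun _ _ => injInd_nonneg _)
  obtain ⟨col, _, hcol⟩ := Finset.exists_le_of_sum_le Finset.univ_nonempty h
  exact ⟨col, hcol⟩

lemma subdivWeight_smul {α : Type*} (W : α → α → ℝ) (c : ℝ) (x) :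
    subdivWeight J u v (fun a b => c * W a b) x = c ^ (m * (J + 1)) * subdivWeight J u v W x := by
  simp [subdivWeight, Finset.prod_mul_distrib, pow_mul, pow_right_comm]

lemma integral_stepKer_rainbow [NeZero n] (p : ℝ) (col : Fin n → γ) :
    ∫ x, subdivWeight J u v (stepKer p G) x * rainbow col x
      ∂(Measure.pi fun _ => unitMeasure) =
    rainbowCount J u v G col / ((n : ℝ) ^ Fintype.card (Fin k ⊕ (Fin m × Fin (J + 1 - 1))) *
      p ^ (m * (J + 1))) := by
  have h := integral_pi_idxFin (n := n) (fun φ : Fin k ⊕ (Fin m × Fin (J + 1 - 1)) → Fin n =>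
    subdivWeight J u v (fun a b => (1 / p) * adjInd G a b) φ * injInd fun a => col (φ a))
  have e : ∀ x : Fin k ⊕ (Fin m × Fin (J + 1 - 1)) → ℝ,
      subdivWeight J u v (stepKer p G) x * rainbow col x =
      subdivWeight J u v (fun a b => (1 / p) * adjInd G a b) (fun i => idxFin n (x i)) *
        injInd fun a => col (idxFin n (x a)) := by
    intro x
    simp only [subdivWeight, stepKer, adjInd, mul_ite, mul_one, mul_zero, rainbow]
  simp only [e]
  rw [h, rainbowCount]
  simp only [subdivWeight_smul, mul_assoc]
  rw [← Finset.mul_sum, div_pow, one_pow, div_mul_eq_mul_div, one_mul, div_div, mul_comm (p ^ _)]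

lemma sum_sum_sameColour_le {R : ℕ} [NeZero R] :
    ∑ s : Fin n, ∑ t : Fin n, (if residueColour n R s = residueColour n R t then (1 : ℝ) else 0) ≤
      n * ((n : ℝ) / R + 1) := by
  calc _ ≤ ∑ _s : Fin n, ((n : ℝ) / R + 1) := by
        refine Finset.sum_le_sum fun s _ => ?_
        rw [Finset.sum_boole]
        refine le_trans (le_of_eq ?_) (card_residueColour_le n R (residueColour n R s))
        simp only [eq_comm]
    _ = _ := by simp [mul_add]

lemma integral_collision_eq [NeZero n] {V : Type*} [Fintype V] (col : Fin n → γ) {a b : V}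
    (hab : a ≠ b) :
    BddMeas (fun x : V → ℝ => collision (fun a => col (idxFin n (x a))) a b) ∧
    ∫ x : V → ℝ, collision (fun a => col (idxFin n (x a))) a b
      ∂(Measure.pi fun _ => unitMeasure) =
      (∑ s : Fin n, ∑ t : Fin n, if col s = col t then (1 : ℝ) else 0) / (n : ℝ) ^ 2 := by
  have hb := bddMeas_idxFin₂ (n := n) fun s t => if col s = col t then (1 : ℝ) else 0
  simp only [collision, ne_eq, hab, not_false_eq_true, true_and]
  exact ⟨BddMeas.pair (f := fun s t => if col (idxFin n s) = col (idxFin n t) then (1 : ℝ) else 0)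
      hb a b,
    (integral_pi_pair hab (f := fun s t =>
      if col (idxFin n s) = col (idxFin n t) then (1 : ℝ) else 0) hb).trans
      (integral_integral_idxFin (n := n) fun s t => if col s = col t then (1 : ℝ) else 0)⟩

lemma integral_one_sub_rainbow_le [NeZero n] {V : Type*} [Fintype V] {R : ℕ} [NeZero R] :
    ∫ x : V → ℝ, (1 - rainbow (residueColour n R) x) ∂(Measure.pi fun _ => unitMeasure) ≤
      (Fintype.card V : ℝ) ^ 2 * (1 / R + 1 / n) := by
  have hn : (0 : ℝ) < n := by exact_mod_cast NeZero.pos n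
  have hR : (0 : ℝ) < R := by exact_mod_cast NeZero.pos R
  have hz : ∀ (a : V) (f : V → Fin R), collision f a a = 0 := fun a f =>
    if_neg fun h => h.1 rfl
  have hb : ∀ a b : V, BddMeas (fun x : V → ℝ =>
      collision (fun a => residueColour n R (idxFin n (x a))) a b) := fun a b => by
    by_cases hab : a = b
    · subst hab
      simp only [hz]
      exact BddMeas.const 0
    · exact (integral_collision_eq _ hab).1
  calc _ ≤ ∫ x : V → ℝ, ∑ a : V, ∑ b : V,
        collision (fun a => residueColour n R (idxFin n (x a))) a b
          ∂(Measure.pi fun _ => unitMeasure) :=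
        ((BddMeas.const 1).sub (rainbow_bddMeas _)).integral_mono
          (BddMeas.sum _ fun a _ => BddMeas.sum _ fun b _ => hb a b) fun x => one_sub_injInd_le _
    _ = ∑ a : V, ∑ b : V, ∫ x : V → ℝ,
        collision (fun a => residueColour n R (idxFin n (x a))) a b
        ∂(Measure.pi fun _ => unitMeasure) := by
        rw [integral_finsetSum _ fun a _ => (BddMeas.sum _ fun b _ => hb a b).integrable _]
        exact Finset.sum_congr rfl fun a _ =>
          integral_finsetSum _ fun b _ => (hb a b).integrable _
    _ ≤ ∑ a : V, ∑ b : V, (1 / R + 1 / n : ℝ) := by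
        refine Finset.sum_le_sum fun a _ => Finset.sum_le_sum fun b _ => ?_
        by_cases hab : a = b
        · subst hab
          simp only [hz, integral_zero]
          positivity
        · rw [(integral_collision_eq _ hab).2, div_le_iff₀ (by positivity)]
          refine le_trans (le_of_eq ?_) (sum_sum_sameColour_le (n := n) (R := R)) |>.trans
            (le_of_eq ?_)
          · congr!
          · field_simp
    _ = _ := by
        simp only [Finset.sum_const, Finset.card_univ, nsmul_eq_mul]
        ring

end Counting

namespace SparseApprox

variable {C : ℝ} {j : ℕ} {p : ℕ → ℝ} {G : ∀ n, SimpleGraph (Fin (n + 1))} {U : ℕ → ℝ → ℝ → ℝ}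
  {k m : ℕ} {u v : Fin m → Fin k}

lemma integral_mul_rainbow_bounds (h : SparseApprox C j p G U) {γ : Type*} (n : ℕ)
    (col : Fin (n + 1) → γ) :
    ∫ x, subdivWeight (j + 1) u v (U n) x * rainbow col x
        ∂(Measure.pi fun _ => unitMeasure) ≤
      ∫ x, subdivWeight (j + 1) u v (U n) x ∂(Measure.pi fun _ => unitMeasure) ∧
    ∫ x, subdivWeight (j + 1) u v (U n) x ∂(Measure.pi fun _ => unitMeasure) ≤
      ∫ x, subdivWeight (j + 1) u v (U n) x * rainbow col x
        ∂(Measure.pi fun _ => unitMeasure) +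
      C ^ (m * (j + 2)) * ∫ x : Fin k ⊕ (Fin m × Fin (j + 1 + 1 - 1)) → ℝ, (1 - rainbow col x)
        ∂(Measure.pi fun _ => unitMeasure) := by
  have hb := subdivWeight_bddMeas (j + 1) u v (h.meas n)
  have hr := rainbow_bddMeas (V := Fin k ⊕ (Fin m × Fin (j + 1 + 1 - 1))) col
  have h0 := subdivWeight_nonneg (j + 1) u v (h.nonneg n)
  constructor
  · exact (hb.mul hr).integral_mono hb fun x => mul_le_of_le_one_right (h0 x) (injInd_le_one _)
  · have h1 : BddMeas (fun x : Fin k ⊕ (Fin m × Fin (j + 1 + 1 - 1)) → ℝ =>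
        C ^ (m * (j + 2)) * (1 - rainbow col x)) :=
      (BddMeas.const _).mul ((BddMeas.const 1).sub hr)
    rw [← integral_const_mul, ← integral_add ((hb.mul hr).integrable _) (h1.integrable _)]
    refine hb.integral_mono ((hb.mul hr).add h1) fun x => ?_
    have hle := mul_le_mul_of_nonneg_right
      (subdivWeight_le (j + 1) u v (h.nonneg n) (h.le n) x)
      (sub_nonneg.2 (injInd_le_one fun a => col (idxFin (n + 1) (x a))))
    change _ ≤ subdivWeight (j + 1) u v (U n) x * rainbow col x +
      C ^ (m * (j + 1 + 1)) * (1 - rainbow col x)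
    simp only [rainbow]
    linarith

lemma tendsto_rainbowCount_id (h : SparseApprox C j p G U) (huv : ∀ r, u r ≠ v r) {I : ℝ}
    (hI : ∀ n, ∫ x, subdivWeight (j + 1) u v (U n) x
      ∂(Measure.pi fun _ => unitMeasure) = I) :
    Tendsto (fun n => rainbowCount (j + 1) u v (G n) id /
      (((n + 1 : ℕ) : ℝ) ^ Fintype.card (Fin k ⊕ (Fin m × Fin (j + 1 + 1 - 1))) *
        p n ^ (m * (j + 1 + 1)))) atTop (nhds I) := by
  set c : ℝ := (Fintype.card (Fin k ⊕ (Fin m × Fin (j + 1 + 1 - 1))) : ℝ) ^ 2 with hc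
  have hc0 : 0 ≤ c := by positivity
  set B : ℝ := C ^ (m * (j + 2)) with hB
  have hB0 : 0 < B := pow_pos h.C_pos _
  have hI0 : 0 ≤ I := by
    rw [← hI 0]
    exact integral_nonneg fun x => subdivWeight_nonneg _ _ _ (h.nonneg 0) x
  have hIB : I ≤ B := by
    rw [← hI 0]
    have := (subdivWeight_bddMeas (j + 1) u v (h.meas 0)).integral_mono
      (μ := Measure.pi fun _ => unitMeasure) (BddMeas.const B)
      (subdivWeight_le (j + 1) u v (h.nonneg 0) (h.le 0))
    simpa using this
  rw [Metric.tendsto_nhds]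
  intro ε hε
  obtain ⟨R, hR⟩ := exists_nat_gt (c * (B + ε) * 4 / ε)
  have hR0 : (0 : ℝ) < R := lt_of_le_of_lt (by positivity) hR
  have hRpos : 0 < R := by exact_mod_cast hR0
  have : NeZero R := ⟨hRpos.ne'⟩
  have hq : c / R * (B + ε) < ε / 4 := by
    rw [div_lt_iff₀ hε] at hR
    rw [div_mul_eq_mul_div, div_lt_iff₀ hR0]
    linarith
  have hq0 : 0 ≤ c / R := by positivity
  choose col hcol using fun n => exists_rainbowCount_ge (G := G n) (J := j + 1) (u := u) (v := v)
    hRpos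
  have hlim : Tendsto (fun n : ℕ => B * c * (1 / ((n + 1 : ℕ) : ℝ))) atTop (nhds 0) := by
    have := tendsto_one_div_add_atTop_nhds_zero_nat (𝕜 := ℝ)
    simpa using this.const_mul (B * c)
  have hε4 : 0 < ε / 4 := by positivity
  filter_upwards [h.rainbow_close huv col hε4,
    h.rainbow_close huv (fun n => residueColour (n + 1) R) hε4,
    hlim.eventually (gt_mem_nhds hε4)] with n hup hlo hn
  rw [integral_stepKer_rainbow] at hup hlo
  set Z : ℝ := ((n + 1 : ℕ) : ℝ) ^ Fintype.card (Fin k ⊕ (Fin m × Fin (j + 1 + 1 - 1))) *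
        p n ^ (m * (j + 1 + 1)) with hZ
  have hZ0 : 0 < Z := by
    have := h.p_pos n
    positivity
  obtain ⟨hup1, -⟩ := h.integral_mul_rainbow_bounds (u := u) (v := v) n (col n)
  obtain ⟨-, hlo1⟩ := h.integral_mul_rainbow_bounds (u := u) (v := v) n
    (residueColour (n + 1) R)
  rw [hI n] at hup1 hlo1
  have hlo2 := mul_le_mul_of_nonneg_left (integral_one_sub_rainbow_le (n := n + 1) (R := R)
    (V := Fin k ⊕ (Fin m × Fin (j + 1 + 1 - 1)))) hB0.le
  have hlo3 := div_le_div_of_nonneg_right (rainbowCount_le_rainbowCount_id (J := j + 1) (u := u)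
    (v := v) (G := G n) (residueColour (n + 1) R)) hZ0.le
  have hup2 := div_le_div_of_nonneg_right (hcol n) hZ0.le
  rw [← hc] at hlo2 hup2
  rw [mul_div_assoc] at hup2
  set E := rainbowCount (j + 1) u v (G n) id / Z
  rw [abs_le] at hup hlo
  have hBq : B * (c * (1 / (R : ℝ) + 1 / ((n + 1 : ℕ) : ℝ))) =
      c / R * B + B * c * (1 / ((n + 1 : ℕ) : ℝ)) := by ring
  have hqε : 0 ≤ c / R * ε := by positivity
  have hqB : 0 ≤ c / R * B := by positivity
  rw [Real.dist_eq, abs_lt]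
  constructor
  · nlinarith [hlo.1]
  · have h1 : (1 - c / R) * E ≤ I + ε / 4 := by linarith [hup.2]
    have h2 : I + ε / 4 < (1 - c / R) * (I + ε) := by
      have : c / R * I ≤ c / R * B := mul_le_mul_of_nonneg_left hIB hq0
      nlinarith
    have hq1 : 0 < 1 - c / R := by
      by_contra hneg
      nlinarith
    have := lt_of_mul_lt_mul_left (h1.trans_lt h2) hq1.le
    linarith

end SparseApprox

section Subdivision

variable {k m J : ℕ} {u v : Fin m → Fin k}

lemma eq_of_pv_eq_of_internal {r s : Fin m} {a b : ℕ} (ha0 : 0 < a) (ha : a < J + 1)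
    (h : pv (J + 1) u v r a = pv (J + 1) u v s b) : r = s := by
  unfold pv at h
  split_ifs at h
  all_goals first
    | omega
    | (simp only [Sum.inr.injEq, Prod.mk.injEq] at h; exact h.1)

/-- The `i`-th edge of the `r`-th subdivided edge. -/
def subdivEdge (J : ℕ) (u v : Fin m → Fin k) (q : Fin m × Fin (J + 1)) :
    Sym2 (Fin k ⊕ (Fin m × Fin (J + 1 - 1))) :=
  s(pv (J + 1) u v q.1 q.2, pv (J + 1) u v q.1 (q.2 + 1))

lemma subdivEdge_injective (hJ : 1 ≤ J) (huv : ∀ r, u r ≠ v r) :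
    Function.Injective (subdivEdge J u v) := by
  rintro ⟨r, i, hi⟩ ⟨s, i', hi'⟩ h
  simp only [subdivEdge, Sym2.eq_iff] at h
  have hrs : r = s := by
    by_cases h0 : 0 < i
    · rcases h with h | h
      · exact eq_of_pv_eq_of_internal h0 hi h.1
      · exact eq_of_pv_eq_of_internal h0 hi h.1
    · rcases h with h | h
      · exact eq_of_pv_eq_of_internal (by omega) (by omega) h.2
      · exact eq_of_pv_eq_of_internal (by omega) (by omega) h.2
  subst hrs
  have hii : i = i' := by
    rcases h with h | h
    · exact pv_injOn huv r (by omega) (by omega) h.1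
    · have h1 := pv_injOn huv r (by omega) (by omega) h.1
      have h2 := pv_injOn huv r (by omega) (by omega) h.2
      omega
  subst hii
  rfl

lemma range_subdivEdge (huv : ∀ r, u r ≠ v r) :
    Set.range (subdivEdge J u v) = (multiSubdiv (J + 1) u v).edgeSet := by
  ext e
  induction e using Sym2.ind with
  | _ a b =>
    simp only [Set.mem_range, SimpleGraph.mem_edgeSet, multiSubdiv, SimpleGraph.fromRel_adj,
      subdivEdge, Sym2.eq_iff, Prod.exists]
    constructor
    · rintro ⟨r, i, h⟩
      have hne : pv (J + 1) u v r i ≠ pv (J + 1) u v r (i + 1) := fun h => by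
        have := pv_injOn huv r (by omega) (by omega) h
        omega
      rcases h with ⟨rfl, rfl⟩ | ⟨rfl, rfl⟩
      · exact ⟨hne, Or.inl ⟨r, i, i.2, rfl, rfl⟩⟩
      · exact ⟨hne.symm, Or.inr ⟨r, i, i.2, rfl, rfl⟩⟩
    · rintro ⟨-, ⟨r, i, hi, rfl, rfl⟩ | ⟨r, i, hi, rfl, rfl⟩⟩
      · exact ⟨r, ⟨i, hi⟩, Or.inl ⟨rfl, rfl⟩⟩
      · exact ⟨r, ⟨i, hi⟩, Or.inr ⟨rfl, rfl⟩⟩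

lemma edgeCount_multiSubdiv (hJ : 1 ≤ J) (huv : ∀ r, u r ≠ v r) :
    edgeCount (multiSubdiv (J + 1) u v) = m * (J + 1) := by
  rw [edgeCount, ← range_subdivEdge huv, Nat.card_range_of_injective (subdivEdge_injective hJ huv)]
  simp

lemma prod_edgeFinset_multiSubdiv (hJ : 1 ≤ J) (huv : ∀ r, u r ≠ v r)
    [Fintype (multiSubdiv (J + 1) u v).edgeSet] (f : Sym2 (Fin k ⊕ (Fin m × Fin (J + 1 - 1))) → ℝ) :
    ∏ e ∈ (multiSubdiv (J + 1) u v).edgeFinset, f e =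
      ∏ r, ∏ i ∈ Finset.range (J + 1), f s(pv (J + 1) u v r i, pv (J + 1) u v r (i + 1)) := by
  have h1 : ∀ r : Fin m, ∏ i ∈ Finset.range (J + 1),
      f s(pv (J + 1) u v r i, pv (J + 1) u v r (i + 1)) = ∏ i : Fin (J + 1),
        f (subdivEdge J u v (r, i)) := fun r =>
    Finset.prod_range fun i => f s(pv (J + 1) u v r i, pv (J + 1) u v r (i + 1))
  simp only [h1]
  rw [← Fintype.prod_prod_type']
  symm
  refine Finset.prod_bij (fun q _ => subdivEdge J u v q) ?_ ?_ ?_ ?_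
  · intro q _
    rw [SimpleGraph.mem_edgeFinset, ← range_subdivEdge huv]
    exact ⟨q, rfl⟩
  · exact fun q _ q' _ h => subdivEdge_injective hJ huv h
  · intro e he
    rw [SimpleGraph.mem_edgeFinset, ← range_subdivEdge huv] at he
    obtain ⟨q, rfl⟩ := he
    exact ⟨q, Finset.mem_univ _, rfl⟩
  · exact fun q _ => rfl

lemma adj_multiSubdiv_iff {n : ℕ} (G : SimpleGraph (Fin n)) (huv : ∀ r, u r ≠ v r)
    (φ : Fin k ⊕ (Fin m × Fin (J + 1 - 1)) → Fin n) :
    (∀ {a b}, (multiSubdiv (J + 1) u v).Adj a b → G.Adj (φ a) (φ b)) ↔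
      ∀ r, ∀ i ∈ Finset.range (J + 1),
        G.Adj (φ (pv (J + 1) u v r i)) (φ (pv (J + 1) u v r (i + 1))) := by
  constructor
  · intro h r i hi
    refine h ?_
    rw [← SimpleGraph.mem_edgeSet, ← range_subdivEdge huv]
    exact ⟨(r, ⟨i, Finset.mem_range.1 hi⟩), rfl⟩
  · intro h a b hab
    simp only [multiSubdiv, SimpleGraph.fromRel_adj] at hab
    obtain ⟨-, ⟨r, i, hi, rfl, rfl⟩ | ⟨r, i, hi, rfl, rfl⟩⟩ := hab
    · exact h r i (Finset.mem_range.2 hi)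
    · exact (h r i (Finset.mem_range.2 hi)).symm

lemma embCount_multiSubdiv {n : ℕ} (G : SimpleGraph (Fin n)) (huv : ∀ r, u r ≠ v r) :
    (embCount (multiSubdiv (J + 1) u v) G : ℝ) = rainbowCount J u v G id := by
  have e1 : {φ : multiSubdiv (J + 1) u v →g G // Function.Injective φ} ≃
      {φ : Fin k ⊕ (Fin m × Fin (J + 1 - 1)) → Fin n //
        (∀ r, ∀ i ∈ Finset.range (J + 1),
          G.Adj (φ (pv (J + 1) u v r i)) (φ (pv (J + 1) u v r (i + 1)))) ∧
        Function.Injective φ} :=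
    { toFun := fun φ => ⟨φ.1, (adj_multiSubdiv_iff G huv _).1 φ.1.map_rel, φ.2⟩
      invFun := fun φ => ⟨⟨φ.1, (adj_multiSubdiv_iff G huv _).2 φ.2.1⟩, φ.2.2⟩
      left_inv := fun _ => rfl
      right_inv := fun _ => rfl }
  rw [embCount, Nat.card_congr e1, Nat.card_eq_fintype_card, Fintype.card_subtype, rainbowCount,
    ← Finset.sum_boole]
  refine Finset.sum_congr rfl fun φ _ => ?_
  simp only [subdivWeight, adjInd, injInd, Finset.prod_ite_zero, Finset.prod_const_one,
    Finset.mem_univ, true_implies, id_eq, ite_and, ite_mul, one_mul, zero_mul]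
  congr!

end Subdivision

section Transfer

lemma embCount_congr {α β γ : Type*} {F : SimpleGraph α} {F' : SimpleGraph β} (e : F ≃g F')
    (G : SimpleGraph γ) : embCount F G = embCount F' G :=
  Nat.card_congr
    { toFun := fun φ => ⟨φ.1.comp e.symm.toHom, φ.2.comp e.symm.injective⟩
      invFun := fun φ => ⟨φ.1.comp e.toHom, φ.2.comp e.injective⟩
      left_inv := fun φ => by ext; simp
      right_inv := fun φ => by ext; simp }

lemma edgeCount_congr {α β : Type*} {F : SimpleGraph α} {F' : SimpleGraph β} (e : F ≃g F') :
    edgeCount F = edgeCount F' :=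
  Nat.card_congr e.mapEdgeSet

lemma sDen_congr {α β γ : Type*} [Fintype α] [Fintype β] [Fintype γ] {F : SimpleGraph α}
    {F' : SimpleGraph β} (e : F ≃g F') (p : ℝ) (G : SimpleGraph γ) :
    sDen p F G = sDen p F' G := by
  rw [sDen, sDen, embCount_congr e, edgeCount_congr e, Fintype.card_congr e.toEquiv]

lemma measurePreserving_comp_equiv {α β Ω : Type*} [Fintype α] [Fintype β] [MeasurableSpace Ω]
    (μ : Measure Ω) [SigmaFinite μ] (e : α ≃ β) :
    MeasurePreserving (fun (x : α → Ω) (b : β) => x (e.symm b)) (Measure.pi fun _ => μ)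
      (Measure.pi fun _ => μ) :=
  measurePreserving_arrowCongr' (fun _ => μ) (fun _ => μ) e (MeasurableEquiv.refl Ω)
    fun _ => MeasurePreserving.id μ

lemma homDensity_congr {α β : Type*} [Fintype α] [Fintype β] {F : SimpleGraph α}
    {F' : SimpleGraph β} (e : F ≃g F') (κ : ℝ → ℝ → ℝ) : homDensity F κ = homDensity F' κ := by
  rw [homDensity, homDensity, volume_pi, volume_pi, Measure.restrict_pi_pi,
    Measure.restrict_pi_pi]
  have hmp := measurePreserving_comp_equiv unitMeasure e.toEquiv
  have hme : MeasurableEmbedding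
      (fun (x : α → ℝ) (b : β) => x (e.toEquiv.symm b)) :=
    (MeasurableEquiv.arrowCongr' e.toEquiv (MeasurableEquiv.refl ℝ)).measurableEmbedding
  rw [← hmp.integral_comp hme]
  congr 1
  funext x
  refine Finset.prod_bij (fun q _ => q.map e) ?_ ?_ ?_ ?_
  · intro q hq
    rw [SimpleGraph.mem_edgeFinset] at hq ⊢
    exact (e.mapEdgeSet ⟨q, hq⟩).2
  · exact fun q _ q' _ h => Sym2.map.injective e.injective h
  · intro q hq
    rw [SimpleGraph.mem_edgeFinset] at hq
    refine ⟨q.map e.symm, ?_, ?_⟩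
    · rw [SimpleGraph.mem_edgeFinset]
      exact (e.symm.mapEdgeSet ⟨q, hq⟩).2
    · induction q using Sym2.ind with
      | _ a b => simp [Sym2.map_mk]
  · intro q _
    induction q using Sym2.ind with
    | _ a b =>
      have h : ∀ a, x (e.toEquiv.symm (e a)) = x a := fun a =>
        congrArg x (e.toEquiv.symm_apply_apply a)
      simp only [Sym2.map_mk, Sym2.lift_mk, h]

lemma homDensity_multiSubdiv {k m J : ℕ} {u v : Fin m → Fin k} (hJ : 1 ≤ J)
    (huv : ∀ r, u r ≠ v r) {κ : ℝ → ℝ → ℝ} (hκ : ∀ x y, κ x y = κ y x) :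
    homDensity (multiSubdiv (J + 1) u v) κ =
      ∫ x, subdivWeight J u v κ x ∂(Measure.pi fun _ => unitMeasure) := by
  rw [homDensity, volume_pi, Measure.restrict_pi_pi]
  congr 1
  funext x
  rw [prod_edgeFinset_multiSubdiv hJ huv, subdivWeight]
  refine Finset.prod_congr rfl fun r _ => Finset.prod_congr rfl fun i _ => ?_
  simp only [Sym2.lift_mk]
  rw [hκ (x (pv (J + 1) u v r (i + 1)))]
  ring

lemma integral_subdivWeight_comp {k m J : ℕ} {u v : Fin m → Fin k} {κ : ℝ → ℝ → ℝ}
    (hκ : BddMeas (fun q : ℝ × ℝ => κ q.1 q.2)) {τ : ℝ → ℝ} (hτ : MPBij τ) :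
    ∫ x, subdivWeight J u v (fun x y => κ (τ x) (τ y)) x ∂(Measure.pi fun _ => unitMeasure) =
      ∫ x, subdivWeight J u v κ x ∂(Measure.pi fun _ => unitMeasure) := by
  have hmp : MeasurePreserving
      (fun (x : Fin k ⊕ (Fin m × Fin (J + 1 - 1)) → ℝ) i => τ (x i))
      (Measure.pi fun _ => unitMeasure) (Measure.pi fun _ => unitMeasure) :=
    measurePreserving_pi (fun _ => unitMeasure) (fun _ => unitMeasure) fun _ => hτ.1
  rw [← hmp.map_eq, integral_map hmp.measurable.aemeasurable
    (subdivWeight_bddMeas J u v hκ).1.aestronglyMeasurable, hmp.map_eq]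
  rfl

end Transfer

lemma tendsto_pow_div_descFactorial (N : ℕ) :
    Tendsto (fun n : ℕ => ((n + 1 : ℕ) : ℝ) ^ N / ((n + 1).descFactorial N : ℝ)) atTop (nhds 1) := by
  induction N with
  | zero => simp
  | succ N ih =>
    have h1 : Tendsto (fun n : ℕ => ((n + 1 : ℕ) : ℝ) / ((n + 1 - N : ℕ) : ℝ)) atTop (nhds 1) := by
      have h0 : Tendsto (fun n : ℕ => (N : ℝ) / ((n + 1 : ℕ) : ℝ)) atTop (nhds 0) :=
        (tendsto_const_div_atTop_nhds_zero_nat (N : ℝ)).comp (tendsto_add_atTop_nat 1)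
      have h2 : Tendsto (fun n : ℕ => (1 - (N : ℝ) / ((n + 1 : ℕ) : ℝ))⁻¹) atTop (nhds 1) := by
        simpa using ((tendsto_const_nhds (x := (1 : ℝ))).sub h0).inv₀ (by norm_num)
      refine h2.congr' ?_
      filter_upwards [eventually_ge_atTop N] with n hn
      rw [Nat.cast_sub (by omega)]
      have hn0 : ((n + 1 : ℕ) : ℝ) ≠ 0 := by positivity
      have hnN : ((n + 1 : ℕ) : ℝ) - N ≠ 0 := by
        have : (N : ℝ) ≤ n := by exact_mod_cast hn
        push_cast
        linarith
      field_simp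
    have h3 := h1.mul ih
    rw [mul_one] at h3
    refine h3.congr fun n => ?_
    rw [Nat.descFactorial_succ, Nat.cast_mul, pow_succ', div_mul_div_comm]

lemma exists_sparseApprox (C : ℝ) (hC : 0 < C) (j : ℕ)
    (p : ℕ → ℝ) (hp : ∀ n, p n ∈ Ioc (0:ℝ) 1)
    (G : ∀ n, SimpleGraph (Fin n))
    (htree : ∀ (m : ℕ) (T : SimpleGraph (Fin m)), T.IsTree →
      ∃ M : ℝ, ∀ n, sDen (p n) T (G n) ≤ M)
    (hpath2 : ∃ D : ℝ, ∀ n,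
      (∑ u : Fin n, ∑ v : Fin n,
          if v ≠ u then (pathCount (G n) (j + 1) u v : ℝ) ^ 2 else 0)
        ≤ D * (n:ℝ) ^ (2 + 2 * j) * p n ^ (2 * (j + 1)))
    (hpathk : ∀ k : ℕ, 1 ≤ k → ∃ D : ℝ, ∀ n,
      (∑ u : Fin n, ∑ v : Fin n,
          if v ≠ u then (pathCount (G n) (j + 2) u v : ℝ) ^ k else 0)
        ≤ D * (n:ℝ) ^ (2 + k * (j + 1)) * p n ^ (k * (j + 2)))
    (κ : ℝ → ℝ → ℝ) (hκ : IsKernelBdd κ C)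
    (hconv : Tendsto (fun n => cutDist (graphKernel (p n) (G n)) κ) atTop (nhds 0)) :
    ∃ τ : ℕ → ℝ → ℝ, (∀ n, MPBij (τ n)) ∧
      SparseApprox C j (fun n => p (n + 1)) (fun n => G (n + 1))
        (fun n x y => κ (τ n x) (τ n y)) := by
  have hκb : BddMeas (fun q : ℝ × ℝ => κ q.1 q.2) := BddMeas.of_bound hκ.1 C fun q => by
    rw [abs_of_nonneg (hκ.2.2 _ _).1]
    exact (hκ.2.2 _ _).2
  have hδ : ∀ n : ℕ, cutDist (graphKernel (p (n + 1)) (G (n + 1))) κ <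
      cutDist (graphKernel (p (n + 1)) (G (n + 1))) κ + 1 / ((n : ℝ) + 1) := fun n => by
    have : (0 : ℝ) < 1 / ((n : ℝ) + 1) := by positivity
    linarith
  choose τ hτ hcut using fun n => exists_rearrangement κ hκb (hδ n)
  refine ⟨τ, hτ, ⟨hC, fun n => (hp _).1, fun k => ?_, ?_, fun k hk => ?_, fun n => ?_,
    fun n x y => (hκ.2.2 _ _).1, fun n x y => hκ.2.1 _ _, fun n x y => (hκ.2.2 _ _).2, ?_⟩⟩
  · obtain ⟨M, hM⟩ := htree (k + 1) _ (SimpleGraph.isTree_starGraph 0)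
    exact ⟨M, fun n => hM (n + 1)⟩
  · obtain ⟨D, hD⟩ := hpath2
    exact ⟨D, fun n => hD (n + 1)⟩
  · obtain ⟨D, hD⟩ := hpathk k hk
    exact ⟨D, fun n => hD (n + 1)⟩
  · exact hκb.comp (((hτ n).1.measurable.comp measurable_fst).prodMk
      ((hτ n).1.measurable.comp measurable_snd))
  · intro δ hδ0
    have hlim : Tendsto (fun n : ℕ => cutDist (graphKernel (p (n + 1)) (G (n + 1))) κ +
        1 / ((n : ℝ) + 1)) atTop (nhds 0) := by
      simpa using (hconv.comp (tendsto_add_atTop_nat 1)).add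
        (tendsto_one_div_add_atTop_nhds_zero_nat (𝕜 := ℝ))
    filter_upwards [hlim.eventually (gt_mem_nhds hδ0)] with n hn S T hS hT
    exact (hcut n S T hS hT).trans hn.le

/-- Sparse counting lemma for embeddings of graphs in `F_ℓ`. -/
theorem sparse_embedding_counting (C : ℝ) (hC : 0 < C) (ℓ : ℕ) (hℓ : 3 ≤ ℓ)
    (p : ℕ → ℝ) (hp : ∀ n, p n ∈ Ioc (0:ℝ) 1)
    (G : ∀ n, SimpleGraph (Fin n))
    (htree : ∀ (m : ℕ) (T : SimpleGraph (Fin m)), T.IsTree →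
      ∃ M : ℝ, ∀ n, sDen (p n) T (G n) ≤ M)
    (hpath2 : ∃ D : ℝ, ∀ n,
      (∑ u : Fin n, ∑ v : Fin n,
          if v ≠ u then (pathCount (G n) (ℓ - 1) u v : ℝ) ^ 2 else 0)
        ≤ D * (n:ℝ) ^ (2 * ℓ - 2) * p n ^ (2 * ℓ - 2))
    (hpathk : ∀ k : ℕ, 1 ≤ k → ∃ D : ℝ, ∀ n,
      (∑ u : Fin n, ∑ v : Fin n,
          if v ≠ u then (pathCount (G n) ℓ u v : ℝ) ^ k else 0)
        ≤ D * (n:ℝ) ^ (2 + k * (ℓ - 1)) * p n ^ (k * ℓ))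
    (κ : ℝ → ℝ → ℝ) (hκ : IsKernelBdd κ C)
    (hconv : Tendsto (fun n => cutDist (graphKernel (p n) (G n)) κ) atTop (nhds 0)) :
    ∀ (N : ℕ) (F : SimpleGraph (Fin N)), InFamilyF ℓ F →
      Tendsto (fun n => sDen (p n) F (G n)) atTop (nhds (homDensity F κ)) := by
  obtain ⟨j, rfl⟩ : ∃ j, ℓ = j + 2 := ⟨ℓ - 2, by omega⟩
  have e1 : j + 2 - 1 = j + 1 := rfl
  have e2 : 2 * (j + 2) - 2 = 2 * (j + 1) := by omega
  have e3 : 2 + 2 * j = 2 * (j + 1) := by ring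
  rw [e1, e2] at hpath2
  rw [e1] at hpathk
  obtain ⟨τ, hτ, h⟩ := exists_sparseApprox C hC j p hp G htree (by rw [e3]; exact hpath2) hpathk κ
    hκ hconv
  rintro N F ⟨k, m, u, v, -, huv, ⟨e⟩⟩
  have hκb : BddMeas (fun q : ℝ × ℝ => κ q.1 q.2) := BddMeas.of_bound hκ.1 C fun q => by
    rw [abs_of_nonneg (hκ.2.2 _ _).1]
    exact (hκ.2.2 _ _).2
  rw [← tendsto_add_atTop_iff_nat 1, homDensity_congr e,
    homDensity_multiSubdiv (J := j + 1) (by omega) huv hκ.2.1]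
  have hE := h.tendsto_rainbowCount_id huv fun n =>
    integral_subdivWeight_comp (J := j + 1) (u := u) (v := v) hκb (hτ n)
  have hlim := hE.mul (tendsto_pow_div_descFactorial
    (Fintype.card (Fin k ⊕ (Fin m × Fin (j + 1 + 1 - 1)))))
  rw [mul_one] at hlim
  refine hlim.congr fun n => ?_
  have hn : ((n + 1 : ℕ) : ℝ) ^ Fintype.card (Fin k ⊕ (Fin m × Fin (j + 1 + 1 - 1))) ≠ 0 := by
    positivity
  rw [sDen_congr e, sDen, edgeCount_multiSubdiv (J := j + 1) (by omega) huv,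
    embCount_multiSubdiv (J := j + 1) _ huv, Fintype.card_fin, div_mul_div_comm,
    mul_comm (rainbowCount _ _ _ _ _), mul_assoc, mul_div_mul_left _ _ hn]
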